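/- Let p, q, σ₁, σ₂ ∈ (0,∞], α₁, α₂ ∈ ℝ, α₃ ≥ 0, {t_k} ∈ 𝒳^{α₃}_{α,σ,p} with σ₂ ≥ p, where α = (α₁,α₂), σ = (σ₁,σ₂). Let G be a special Lipschitz domain with constant M ≥ 1, let φ₀ ∈ D(−K) with ∫φ₀(x)dx = 1, φ := φ₀ − 2^{−n}φ₀(·/2), and assume 1 + L_φ > α₂. Then for every ω ∈ D(ℝⁿ) there is a constant C > 0 such that for every f ∈ B^{φ₀}_{p,q}({t_k}) one has ωf ∈ B^{φ₀}_{p,q}({t_k}) and ‖ωf | B^{φ₀}_{p,q}({t_k})‖ ≤ C ‖f | B^{φ₀}_{p,q}({t_k})‖, with C independent of f. -/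

import Mathlib

open MeasureTheory ENNReal Filter Topology

noncomputable section

def lqNorm (q : ℝ≥0∞) (a : ℕ → ℝ≥0∞) : ℝ≥0∞ :=
  if q = ∞ then ⨆ k, a k else (∑' k, a k ^ q.toReal) ^ (1 / q.toReal)

def lpSum {ι : Type*} (p : ℝ≥0∞) (a : ι → ℝ≥0∞) : ℝ≥0∞ :=
  if p = ∞ then ⨆ m, a m else (∑' m, a m ^ p.toReal) ^ (1 / p.toReal)

def dyadicCube (n k : ℕ) (m : Fin n → ℤ) : Set (Fin n → ℝ) :=
  {x | ∀ i, (m i : ℝ) / 2 ^ k ≤ x i ∧ x i ≤ ((m i : ℝ) + 1) / 2 ^ k}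

def dilatedCube (n : ℕ) (c : ℝ) (k : ℕ) (m : Fin n → ℤ) : Set (Fin n → ℝ) :=
  {x | ∀ i, |x i - ((m i : ℝ) + 1 / 2) / 2 ^ k| ≤ c / (2 * 2 ^ k)}

def tkm (n : ℕ) (p : ℝ≥0∞) (t : ℕ → (Fin n → ℝ) → ℝ) (k : ℕ) (m : Fin n → ℤ) : ℝ≥0∞ :=
  eLpNorm (t k) p (volume.restrict (dyadicCube n k m))

def PAdmissible (n : ℕ) (p : ℝ≥0∞) (t : ℕ → (Fin n → ℝ) → ℝ) : Prop :=
  (∀ k, Measurable (t k)) ∧ (∀ k, ∀ᵐ x : Fin n → ℝ, 0 < t k x) ∧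
    ∀ k m, tkm n p t k m < ∞

def MemX (n : ℕ) (p σ₁ σ₂ : ℝ≥0∞) (α₁ α₂ α₃ : ℝ) (t : ℕ → (Fin n → ℝ) → ℝ) : Prop :=
  PAdmissible n p t ∧
  (∃ C₁ : ℝ, 0 < C₁ ∧ ∀ k j : ℕ, k ≤ j → ∀ m : Fin n → ℤ,
    (((2 : ℝ≥0∞) ^ (k * n)) ^ p⁻¹.toReal * tkm n p t k m) *
      (((2 : ℝ≥0∞) ^ (k * n)) ^ σ₁⁻¹.toReal *
        eLpNorm (fun x => (t j x)⁻¹) σ₁ (volume.restrict (dyadicCube n k m)))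
      ≤ ENNReal.ofReal (C₁ * 2 ^ (α₁ * ((k : ℝ) - (j : ℝ))))) ∧
  (∃ C₂ : ℝ, 0 < C₂ ∧ ∀ k j : ℕ, k ≤ j → ∀ m : Fin n → ℤ,
    ((2 : ℝ≥0∞) ^ (k * n)) ^ σ₂⁻¹.toReal *
        eLpNorm (t j) σ₂ (volume.restrict (dyadicCube n k m))
      ≤ ENNReal.ofReal (C₂ * 2 ^ (α₂ * ((j : ℝ) - (k : ℝ)))) *
        (((2 : ℝ≥0∞) ^ (k * n)) ^ p⁻¹.toReal * tkm n p t k m)) ∧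
  (∀ k m, 0 < tkm n p t k m) ∧
  (∀ (k : ℕ) (m m' : Fin n → ℤ), (∀ i, |m i - m' i| ≤ 1) →
    tkm n p t k m ≤ ENNReal.ofReal (2 ^ α₃) * tkm n p t k m')

def tbar (n : ℕ) (p : ℝ≥0∞) (t : ℕ → (Fin n → ℝ) → ℝ) (k : ℕ) (x : Fin n → ℝ) : ℝ :=
  (2 : ℝ) ^ (((k * n : ℕ) : ℝ) / p.toReal) * (tkm n p t k fun i => ⌊x i * 2 ^ k⌋).toReal

abbrev Dstrb (n : ℕ) := ((Fin n → ℝ) → ℝ) →ₗ[ℝ] ℝ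

def distConv (n : ℕ) (f : Dstrb n) (φ : (Fin n → ℝ) → ℝ) (x : Fin n → ℝ) : ℝ :=
  f fun y => φ (x - y)

def IsTestFun (n : ℕ) (g : (Fin n → ℝ) → ℝ) : Prop :=
  ContDiff ℝ (⊤ : ℕ∞) g ∧ HasCompactSupport g

def phiOf (n : ℕ) (φ₀ : (Fin n → ℝ) → ℝ) (x : Fin n → ℝ) : ℝ :=
  φ₀ x - (2 : ℝ)⁻¹ ^ n * φ₀ ((2 : ℝ)⁻¹ • x)

def phiFam (n : ℕ) (φ₀ : (Fin n → ℝ) → ℝ) : ℕ → (Fin n → ℝ) → ℝ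
  | 0 => φ₀
  | k + 1 => fun x => (2 : ℝ) ^ ((k + 1) * n) * phiOf n φ₀ ((2 : ℝ) ^ (k + 1) • x)

def kernFam (n : ℕ) (ψ₀ ψ : (Fin n → ℝ) → ℝ) : ℕ → (Fin n → ℝ) → ℝ
  | 0 => ψ₀
  | k + 1 => fun x => (2 : ℝ) ^ ((k + 1) * n) * ψ ((2 : ℝ) ^ (k + 1) • x)

def besovNorm (n : ℕ) (p q : ℝ≥0∞) (t : ℕ → (Fin n → ℝ) → ℝ)
    (φ₀ : (Fin n → ℝ) → ℝ) (f : Dstrb n) : ℝ≥0∞ :=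
  lqNorm q fun k =>
    eLpNorm (fun x => t k x * distConv n f (phiFam n φ₀ k) x) p volume

def seSeminorm (n : ℕ) (N : ℕ) (g : (Fin n → ℝ) → ℝ) : ℝ≥0∞ :=
  ⨆ x : Fin n → ℝ, ENNReal.ofReal
    (Real.exp (N * ‖x‖) * ∑ i ∈ Finset.range (N + 1), ‖iteratedFDeriv ℝ i g x‖)

def MemSe' (n : ℕ) (f : Dstrb n) : Prop :=
  ∃ (C : ℝ) (N : ℕ), 0 < C ∧ ∀ g : (Fin n → ℝ) → ℝ, ContDiff ℝ (⊤ : ℕ∞) g →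
    ENNReal.ofReal |f g| ≤ ENNReal.ofReal C * seSeminorm n N g

def MomentsVanish (n : ℕ) (L : ℤ) (ψ : (Fin n → ℝ) → ℝ) : Prop :=
  ∀ β : Fin n → ℕ, ((∑ i, β i : ℕ) : ℤ) ≤ L → (∫ x, (∏ i, x i ^ β i) * ψ x) = 0

def sqNorm (d : ℕ) (y : Fin d → ℝ) : ℝ := Real.sqrt (∑ i, y i ^ 2)

def lowerPart (d : ℕ) (x : Fin (d + 1) → ℝ) : Fin d → ℝ := fun i => x i.castSucc

def IsLipFun (d : ℕ) (M : ℝ) (ϖ : (Fin d → ℝ) → ℝ) : Prop :=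
  ∀ y z, |ϖ y - ϖ z| ≤ M * sqNorm d (fun i => y i - z i)

def specialLip (d : ℕ) (ϖ : (Fin d → ℝ) → ℝ) : Set (Fin (d + 1) → ℝ) :=
  {x | ϖ (lowerPart d x) < x (Fin.last d)}

def negConeK (d : ℕ) (M : ℝ) : Set (Fin (d + 1) → ℝ) :=
  {x | M * sqNorm d (lowerPart d x) < -x (Fin.last d)}

def maxFunG (d : ℕ) (G : Set (Fin (d+1) → ℝ)) (φ₀ : (Fin (d+1) → ℝ) → ℝ) (A : ℝ)
    (m : Fin (d+1) → ℤ) (j : ℕ) (c : ℝ) (f : Dstrb (d+1)) : ℝ≥0∞ :=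
  ⨆ (k : ℕ) (_ : j ≤ k), ⨆ y ∈ dilatedCube (d+1) c j m ∩ G,
    ENNReal.ofReal ((2 : ℝ) ^ (A * ((j : ℝ) - (k : ℝ))) *
      |distConv (d+1) f (phiFam (d+1) φ₀ k) y|)

def MemSeG (n : ℕ) (G : Set (Fin n → ℝ)) (f : Dstrb n) : Prop :=
  ∃ (C : ℝ) (N : ℕ), 0 < C ∧ ∀ θ, IsTestFun n θ → tsupport θ ⊆ G →
    ENNReal.ofReal |f θ| ≤ ENNReal.ofReal C *
      ⨆ x ∈ G, ENNReal.ofReal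
        (Real.exp (N * ‖x‖) * ∑ i ∈ Finset.range (N + 1), ‖iteratedFDeriv ℝ i θ x‖)

def MemD' (n : ℕ) (U : Set (Fin n → ℝ)) (f : Dstrb n) : Prop :=
  ∀ K : Set (Fin n → ℝ), IsCompact K → K ⊆ U →
    ∃ (C : ℝ) (N : ℕ), 0 < C ∧ ∀ θ, IsTestFun n θ → tsupport θ ⊆ K →
      ENNReal.ofReal |f θ| ≤ ENNReal.ofReal C *
        ⨆ x, ENNReal.ofReal (∑ i ∈ Finset.range (N + 1), ‖iteratedFDeriv ℝ i θ x‖)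

/-- Multiplication by a fixed function, as a linear operator on functions. -/
def mulFun (n : ℕ) (ω : (Fin n → ℝ) → ℝ) :
    ((Fin n → ℝ) → ℝ) →ₗ[ℝ] ((Fin n → ℝ) → ℝ) where
  toFun g := fun x => ω x * g x
  map_add' g h := by funext x; simp [mul_add]
  map_smul' c g := by funext x; simp [smul_eq_mul]; ring

/-- The product `ω f` of a smooth function and a distribution: `⟨ωf, θ⟩ = ⟨f, ωθ⟩`. -/
def mulDist (n : ℕ) (ω : (Fin n → ℝ) → ℝ) (f : Dstrb n) : Dstrb n :=
  f.comp (mulFun n ω)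

theorem lpSum_top {ι : Type*} (a : ι → ℝ≥0∞) : lpSum ∞ a = ⨆ m, a m := by simp [lpSum]

theorem lpSum_ne {ι : Type*} {p : ℝ≥0∞} (hp : p ≠ ∞) (a : ι → ℝ≥0∞) :
    lpSum p a = (∑' m, a m ^ p.toReal) ^ (1 / p.toReal) := by simp [lpSum, hp]

theorem lpSum_pow {ι : Type*} {p : ℝ≥0∞} (hp0 : 0 < p) (hp : p ≠ ∞) (a : ι → ℝ≥0∞) :
    lpSum p a ^ p.toReal = ∑' m, a m ^ p.toReal := by
  have : 0 < p.toReal := ENNReal.toReal_pos hp0.ne' hp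
  rw [lpSum_ne hp, ← ENNReal.rpow_mul, one_div, inv_mul_cancel₀ this.ne', ENNReal.rpow_one]

theorem le_of_rpow_le' {a b : ℝ≥0∞} {r : ℝ} (hr : 0 < r) (h : a ^ r ≤ b ^ r) : a ≤ b :=
  (ENNReal.rpow_le_rpow_iff hr).1 h

theorem lpSum_mono {ι : Type*} (p : ℝ≥0∞) {a b : ι → ℝ≥0∞} (h : ∀ m, a m ≤ b m) :
    lpSum p a ≤ lpSum p b := by
  unfold lpSum
  split_ifs
  · exact iSup_mono h
  · gcongr with m; exact h m

theorem lpSum_const_mul {ι : Type*} {p : ℝ≥0∞} (hp0 : 0 < p) (c : ℝ≥0∞) (a : ι → ℝ≥0∞) :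
    lpSum p (fun m => c * a m) = c * lpSum p a := by
  by_cases hp : p = ∞
  · subst hp; rw [lpSum_top, lpSum_top, ENNReal.mul_iSup]
  · have h : 0 < p.toReal := ENNReal.toReal_pos hp0.ne' hp
    rw [lpSum_ne hp, lpSum_ne hp]
    simp_rw [ENNReal.mul_rpow_of_nonneg _ _ h.le]
    rw [ENNReal.tsum_mul_left, ENNReal.mul_rpow_of_nonneg _ _ (by positivity), ← ENNReal.rpow_mul,
      one_div, mul_inv_cancel₀ h.ne', ENNReal.rpow_one]

theorem iSup_rpow_le_tsum {ι : Type*} {r : ℝ} (hr : 0 < r) (a : ι → ℝ≥0∞) :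
    (⨆ i, a i) ^ r ≤ ∑' i, a i ^ r := by
  have : (⨆ i, a i) ^ r = ⨆ i, a i ^ r := (ENNReal.orderIsoRpow r hr).map_iSup a
  rw [this]
  exact iSup_le fun i => ENNReal.le_tsum i

theorem le_lpSum {ι : Type*} {p : ℝ≥0∞} (hp0 : 0 < p) (a : ι → ℝ≥0∞) (i : ι) :
    a i ≤ lpSum p a := by
  by_cases hp : p = ∞
  · subst hp; rw [lpSum_top]; exact le_iSup a i
  · have h : 0 < p.toReal := ENNReal.toReal_pos hp0.ne' hp
    apply le_of_rpow_le' h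
    rw [lpSum_pow hp0 hp]
    exact ENNReal.le_tsum (f := fun i => a i ^ p.toReal) i

theorem lpSum_W {ι κ : Type*} {p : ℝ≥0∞} (hp0 : 0 < p) (w : κ → ι → ℝ≥0∞) (U : ι → ℝ≥0∞)
    (K : ℝ≥0∞) (hK : ∀ i, lpSum p (fun m => w m i) ≤ K) :
    lpSum p (fun m => ⨆ i, w m i * U i) ≤ K * lpSum p U := by
  by_cases hp : p = ∞
  · subst hp; rw [lpSum_top]
    refine iSup_le fun m => iSup_le fun i => mul_le_mul' ?_ (le_lpSum hp0 U i)
    exact (le_lpSum hp0 (fun m => w m i) m).trans (hK i)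
  · have h : 0 < p.toReal := ENNReal.toReal_pos hp0.ne' hp
    apply le_of_rpow_le' h
    rw [lpSum_pow hp0 hp, ENNReal.mul_rpow_of_nonneg _ _ h.le, lpSum_pow hp0 hp]
    calc ∑' m, (⨆ i, w m i * U i) ^ p.toReal ≤ ∑' m, ∑' i, (w m i * U i) ^ p.toReal :=
          ENNReal.tsum_le_tsum fun m => iSup_rpow_le_tsum h _
      _ = ∑' i, (∑' m, w m i ^ p.toReal) * U i ^ p.toReal := by
          rw [ENNReal.tsum_comm]
          simp_rw [ENNReal.mul_rpow_of_nonneg _ _ h.le, ENNReal.tsum_mul_right]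
      _ ≤ ∑' i, K ^ p.toReal * U i ^ p.toReal := by
          gcongr with i
          rw [← lpSum_pow hp0 hp]
          gcongr
          exact hK i
      _ = _ := ENNReal.tsum_mul_left

theorem lpSum_S {ι κ : Type*} {p : ℝ≥0∞} (hp0 : 0 < p) (w : ι → ℝ≥0∞) (X : ι → κ → ℝ≥0∞) :
    lpSum p (fun m => ⨆ i, w i * X i m) ≤ lpSum p w * ⨆ i, lpSum p (X i) := by
  by_cases hp : p = ∞
  · subst hp; rw [lpSum_top]
    refine iSup_le fun m => iSup_le fun i => mul_le_mul' (le_lpSum hp0 w i) ?_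
    exact (le_lpSum hp0 (X i) m).trans (le_iSup (fun i => lpSum ∞ (X i)) i)
  · have h : 0 < p.toReal := ENNReal.toReal_pos hp0.ne' hp
    apply le_of_rpow_le' h
    rw [lpSum_pow hp0 hp, ENNReal.mul_rpow_of_nonneg _ _ h.le, lpSum_pow hp0 hp]
    calc ∑' m, (⨆ i, w i * X i m) ^ p.toReal ≤ ∑' m, ∑' i, (w i * X i m) ^ p.toReal :=
          ENNReal.tsum_le_tsum fun m => iSup_rpow_le_tsum h _
      _ = ∑' i, w i ^ p.toReal * ∑' m, X i m ^ p.toReal := by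
          rw [ENNReal.tsum_comm]
          simp_rw [ENNReal.mul_rpow_of_nonneg _ _ h.le, ENNReal.tsum_mul_left]
      _ ≤ ∑' i, w i ^ p.toReal * (⨆ i, lpSum p (X i)) ^ p.toReal := by
          gcongr with i
          rw [← lpSum_pow hp0 hp]
          gcongr
          exact le_iSup (fun i => lpSum p (X i)) i
      _ = _ := ENNReal.tsum_mul_right

theorem eLpNorm_pow {α : Type*} [MeasurableSpace α] {μ : Measure α} {p : ℝ≥0∞} (hp0 : 0 < p)
    (hp : p ≠ ∞) (g : α → ℝ≥0∞) : eLpNorm g p μ ^ p.toReal = ∫⁻ x, g x ^ p.toReal ∂μ := by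
  have h : 0 < p.toReal := ENNReal.toReal_pos hp0.ne' hp
  rw [eLpNorm_eq_lintegral_rpow_enorm_toReal hp0.ne' hp, ← ENNReal.rpow_mul, one_div,
    inv_mul_cancel₀ h.ne', ENNReal.rpow_one]
  simp

theorem eLpNorm_top_ennreal {α : Type*} [MeasurableSpace α] {μ : Measure α} (g : α → ℝ≥0∞) :
    eLpNorm g ∞ μ = essSup g μ := by
  rw [eLpNorm_exponent_top, eLpNormEssSup]; simp

theorem eLpNorm_S {α : Type*} [MeasurableSpace α] {μ : Measure α} {ι : Type*} [Countable ι]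
    {p : ℝ≥0∞} (hp0 : 0 < p) (w : ι → ℝ≥0∞) (g : ι → α → ℝ≥0∞) (hg : ∀ i, Measurable (g i)) :
    eLpNorm (fun x => ⨆ i, w i * g i x) p μ ≤ lpSum p w * ⨆ i, eLpNorm (g i) p μ := by
  by_cases hp : p = ∞
  · subst hp; rw [eLpNorm_top_ennreal]
    refine essSup_le_of_ae_le _ ?_
    have : ∀ i, ∀ᵐ x ∂μ, g i x ≤ eLpNorm (g i) ∞ μ := fun i => by
      rw [eLpNorm_top_ennreal]; exact ae_le_essSup
    filter_upwards [ae_all_iff.2 this] with x hx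
    exact iSup_le fun i => mul_le_mul' (le_lpSum hp0 w i)
      ((hx i).trans (le_iSup (fun i => eLpNorm (g i) ∞ μ) i))
  · have h : 0 < p.toReal := ENNReal.toReal_pos hp0.ne' hp
    apply le_of_rpow_le' h
    rw [eLpNorm_pow hp0 hp, ENNReal.mul_rpow_of_nonneg _ _ h.le, lpSum_pow hp0 hp]
    calc ∫⁻ x, (⨆ i, w i * g i x) ^ p.toReal ∂μ ≤ ∫⁻ x, ∑' i, (w i * g i x) ^ p.toReal ∂μ :=
          lintegral_mono fun m => iSup_rpow_le_tsum h _
      _ = ∑' i, w i ^ p.toReal * ∫⁻ x, g i x ^ p.toReal ∂μ := by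
          rw [lintegral_tsum]
          · simp_rw [ENNReal.mul_rpow_of_nonneg _ _ h.le]
            congr with i
            rw [lintegral_const_mul]
            exact (hg i).pow_const _
          · intro i
            exact (((hg i).const_mul _).pow_const _).aemeasurable
      _ ≤ ∑' i, w i ^ p.toReal * (⨆ i, eLpNorm (g i) p μ) ^ p.toReal := by
          gcongr with i
          rw [← eLpNorm_pow hp0 hp]
          gcongr
          exact le_iSup (fun i => eLpNorm (g i) p μ) i
      _ = _ := ENNReal.tsum_mul_right

/-- decomposition of the norm along a countable partition -/
theorem eLpNorm_partition {α : Type*} [MeasurableSpace α] {μ : Measure α} {ι : Type*} [Countable ι]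
    {p : ℝ≥0∞} (hp0 : 0 < p) (s : ι → Set α) (hs : ∀ i, MeasurableSet (s i))
    (hd : Pairwise (Function.onFun Disjoint s)) (hu : ⋃ i, s i = Set.univ) (g : α → ℝ≥0∞) :
    eLpNorm g p μ = lpSum p (fun i => eLpNorm g p (μ.restrict (s i))) := by
  by_cases hp : p = ∞
  · subst hp; rw [lpSum_top]
    apply le_antisymm
    · rw [eLpNorm_top_ennreal]
      refine essSup_le_of_ae_le _ ?_
      have : ∀ i, ∀ᵐ x ∂μ, x ∈ s i → g x ≤ eLpNorm g ∞ (μ.restrict (s i)) := fun i => by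
        rw [← ae_restrict_iff' (hs i), eLpNorm_top_ennreal]; exact ae_le_essSup
      filter_upwards [ae_all_iff.2 this] with x hx
      have hxu : x ∈ ⋃ i, s i := hu ▸ Set.mem_univ x
      obtain ⟨i, hi⟩ := Set.mem_iUnion.1 hxu
      exact (hx i hi).trans (le_iSup (fun i => eLpNorm g ∞ (μ.restrict (s i))) i)
    · exact iSup_le fun i => eLpNorm_mono_measure _ Measure.restrict_le_self
  · have h : 0 < p.toReal := ENNReal.toReal_pos hp0.ne' hp
    have : eLpNorm g p μ ^ p.toReal = (lpSum p (fun i => eLpNorm g p (μ.restrict (s i)))) ^ p.toReal := by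
      rw [eLpNorm_pow hp0 hp, lpSum_pow hp0 hp]
      simp_rw [eLpNorm_pow hp0 hp]
      rw [← lintegral_iUnion hs hd, hu, Measure.restrict_univ]
    exact le_antisymm (le_of_rpow_le' h this.le) (le_of_rpow_le' h this.ge)

/-- geometric sums over `ℕ` -/
theorem tsum_geom_ne_top {x : ℝ≥0∞} (hx : x < 1) : ∑' l : ℕ, x ^ l ≠ ∞ := by
  rw [ENNReal.tsum_geometric]
  exact ENNReal.inv_ne_top.2 (tsub_pos_of_lt hx).ne'

theorem tsum_int_geom_ne_top {x : ℝ≥0∞} (hx : x < 1) : ∑' l : ℤ, x ^ l.natAbs ≠ ∞ := by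
  have h := tsum_geom_ne_top hx
  have : ∑' l : ℤ, x ^ l.natAbs ≤ ∑' l : ℕ ⊕ ℕ, Sum.elim (fun n => x ^ n) (fun n => x ^ n) l := by
    rw [← Equiv.intEquivNatSumNat.symm.tsum_eq]
    refine ENNReal.tsum_le_tsum fun l => ?_
    rcases l with l | l
    · simp [Equiv.intEquivNatSumNat]
    · simp only [Equiv.intEquivNatSumNat, Sum.elim_inr]
      simp
      exact pow_le_pow_right_of_le_one' hx.le (by omega)
  refine ne_top_of_le_ne_top ?_ this
  rw [ENNReal.summable.tsum_sum ENNReal.summable]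
  simpa using h

theorem tsum_lattice_prod (n : ℕ) (a : ℤ → ℝ≥0∞) (ha : ∑' l, a l ≠ ∞) :
    ∑' m : Fin n → ℤ, ∏ i, a (m i) ≠ ∞ := by
  induction n with
  | zero => simp
  | succ n ih =>
    rw [← (Fin.consEquiv (fun _ => ℤ)).tsum_eq, ENNReal.tsum_prod']
    simp [Fin.consEquiv, Fin.prod_univ_succ, ENNReal.tsum_mul_left, ENNReal.tsum_mul_right]
    exact ENNReal.mul_ne_top ha ih

/-- sup-norm of integer vectors as natural number -/
def zn {n : ℕ} (m : Fin n → ℤ) : ℕ := Finset.univ.sup fun i => (m i).natAbs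

theorem le_zn {n : ℕ} (m : Fin n → ℤ) (i : Fin n) : (m i).natAbs ≤ zn m :=
  Finset.le_sup (f := fun i => (m i).natAbs) (Finset.mem_univ i)

theorem tsum_lattice_ne_top (n : ℕ) {x : ℝ≥0∞} (hx : x < 1) :
    ∑' m : Fin n → ℤ, x ^ zn m ≠ ∞ := by
  rcases Nat.eq_zero_or_pos n with rfl | hn
  · simp [zn]
  set y : ℝ≥0∞ := x ^ ((n : ℝ)⁻¹) with hy
  have hn' : (0:ℝ) < n := by exact_mod_cast hn
  have hy1 : y < 1 := ENNReal.rpow_lt_one hx (by positivity)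
  refine ne_top_of_le_ne_top (tsum_lattice_prod n _ (tsum_int_geom_ne_top hy1)) ?_
  refine ENNReal.tsum_le_tsum fun m => ?_
  rw [Finset.prod_pow_eq_pow_sum]
  have hxy : x = y ^ n := by
    rw [hy, ← ENNReal.rpow_natCast, ← ENNReal.rpow_mul, inv_mul_cancel₀ hn'.ne', ENNReal.rpow_one]
  rw [hxy, ← pow_mul]
  refine pow_le_pow_right_of_le_one' hy1.le ?_
  calc ∑ i, (m i).natAbs ≤ ∑ i : Fin n, zn m := Finset.sum_le_sum fun i _ => le_zn m i
    _ = n * zn m := by simp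

theorem lpSum_lattice_ne_top (n : ℕ) {p x : ℝ≥0∞} (hp0 : 0 < p) (hx : x < 1) :
    lpSum p (fun m : Fin n → ℤ => x ^ zn m) ≠ ∞ := by
  by_cases hp : p = ∞
  · subst hp; rw [lpSum_top]
    refine ne_top_of_le_ne_top one_ne_top (iSup_le fun m => pow_le_one' hx.le _)
  · have h : 0 < p.toReal := ENNReal.toReal_pos hp0.ne' hp
    rw [lpSum_ne hp]
    refine ENNReal.rpow_ne_top_of_nonneg (by positivity) ?_
    have := tsum_lattice_ne_top n (ENNReal.rpow_lt_one hx h)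
    convert this using 3 with m
    rw [← ENNReal.rpow_natCast, ← ENNReal.rpow_mul, mul_comm, ENNReal.rpow_mul, ENNReal.rpow_natCast]

theorem lpSum_nat_ne_top {p x : ℝ≥0∞} (hp0 : 0 < p) (hx : x < 1) :
    lpSum p (fun l : ℕ => x ^ l) ≠ ∞ := by
  by_cases hp : p = ∞
  · subst hp; rw [lpSum_top]
    refine ne_top_of_le_ne_top one_ne_top (iSup_le fun m => pow_le_one' hx.le _)
  · have h : 0 < p.toReal := ENNReal.toReal_pos hp0.ne' hp
    rw [lpSum_ne hp]
    refine ENNReal.rpow_ne_top_of_nonneg (by positivity) ?_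
    have := tsum_geom_ne_top (ENNReal.rpow_lt_one hx h)
    convert this using 3 with m
    rw [← ENNReal.rpow_natCast, ← ENNReal.rpow_mul, mul_comm, ENNReal.rpow_mul, ENNReal.rpow_natCast]

theorem lqNorm_eq (q : ℝ≥0∞) (a : ℕ → ℝ≥0∞) : lqNorm q a = lpSum q a := rfl

def ew {n : ℕ} (B : ℝ) (j : ℕ) (x y : Fin n → ℝ) : ℝ≥0∞ :=
  ENNReal.ofReal (Real.exp (-(B * 2 ^ j * ‖x - y‖)))

def PM {n : ℕ} (A : ℕ) (B : ℝ) (u : ℕ → (Fin n → ℝ) → ℝ≥0∞) (j : ℕ) (x : Fin n → ℝ) : ℝ≥0∞ :=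
  ⨆ (k : ℕ), ⨆ y, (2⁻¹ : ℝ≥0∞) ^ (k * A) * ew B j x y * u (j + k) y

def IM {n : ℕ} (A : ℕ) (B r : ℝ) (u : ℕ → (Fin n → ℝ) → ℝ≥0∞) (j : ℕ) (x : Fin n → ℝ) : ℝ≥0∞ :=
  ∑' l : ℕ, (2 : ℝ≥0∞) ^ ((j + l) * n) *
    ∫⁻ z, ((2⁻¹ : ℝ≥0∞) ^ (l * A) * ew B j x z * u (j + l) z) ^ r

def BIP {n : ℕ} (u : ℕ → (Fin n → ℝ) → ℝ≥0∞) (A : ℕ) (C : ℝ≥0∞) (c : ℝ) : Prop :=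
  ∀ k y, u k y ≤ C * ∑' l : ℕ, (2⁻¹ : ℝ≥0∞) ^ (l * A) * 2 ^ (k * n) *
    ∫⁻ z in Metric.closedBall y (c / 2 ^ k), u (k + l) z

theorem ew_ne_top {n : ℕ} (B : ℝ) (j : ℕ) (x y : Fin n → ℝ) : ew B j x y ≠ ∞ := ENNReal.ofReal_ne_top

theorem ew_le_ball {n : ℕ} {B c : ℝ} (hB : 0 ≤ B) (j k : ℕ) (x y z : Fin n → ℝ)
    (hc : 0 ≤ c) (h : z ∈ Metric.closedBall y (c / 2 ^ (j + k))) :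
    ew B j x y ≤ ENNReal.ofReal (Real.exp (B * c)) * ew B j x z := by
  unfold ew
  rw [← ENNReal.ofReal_mul (Real.exp_pos _).le, ← Real.exp_add]
  refine ENNReal.ofReal_le_ofReal (Real.exp_le_exp.2 ?_)
  have h1 : ‖z - y‖ ≤ c / 2 ^ (j + k) := by simpa [dist_eq_norm] using h
  have h2 : c / 2 ^ (j + k) ≤ c / 2 ^ j := by
    gcongr; norm_num; omega
  have h3 : ‖x - z‖ ≤ ‖x - y‖ + c / 2 ^ j := by
    have : x - z = (x - y) - (z - y) := by abel
    rw [this]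
    exact (norm_sub_le _ _).trans (by linarith)
  have h4 : B * 2 ^ j * ‖x - z‖ ≤ B * 2 ^ j * (‖x - y‖ + c / 2 ^ j) := by gcongr
  have h5 : B * 2 ^ j * (‖x - y‖ + c / 2 ^ j) = B * 2 ^ j * ‖x - y‖ + B * c := by
    field_simp
  linarith

theorem ew_trans {n : ℕ} {B : ℝ} (hB : 0 ≤ B) (j k : ℕ) (x y z : Fin n → ℝ) :
    ew B j x y * ew B (j + k) y z ≤ ew B j x z := by
  unfold ew
  rw [← ENNReal.ofReal_mul (Real.exp_pos _).le, ← Real.exp_add]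
  refine ENNReal.ofReal_le_ofReal (Real.exp_le_exp.2 ?_)
  have h3 : ‖x - z‖ ≤ ‖x - y‖ + ‖y - z‖ := by
    simpa using norm_add_le (x - y) (y - z)
  have h4 : B * 2 ^ j * ‖x - z‖ ≤ B * 2 ^ j * (‖x - y‖ + ‖y - z‖) := by gcongr
  have h6 : (2:ℝ) ^ j ≤ 2 ^ (j + k) := pow_le_pow_right₀ (by norm_num) (by omega)
  have h5 : B * 2 ^ j * ‖y - z‖ ≤ B * 2 ^ (j + k) * ‖y - z‖ := by gcongr
  linarith

theorem ew_mono {n : ℕ} {B B' : ℝ} (h : B ≤ B') (j : ℕ) (x y : Fin n → ℝ) :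
    ew B' j x y ≤ ew B j x y := by
  unfold ew
  refine ENNReal.ofReal_le_ofReal (Real.exp_le_exp.2 ?_)
  have : B * 2 ^ j * ‖x - y‖ ≤ B' * 2 ^ j * ‖x - y‖ := by gcongr
  linarith

theorem PM_le_aux {n : ℕ} {A : ℕ} {B r c : ℝ} {C : ℝ≥0∞} (hB : 0 ≤ B) (hr0 : 0 < r) (hr1 : r ≤ 1)
    (hc : 0 ≤ c) (u : ℕ → (Fin n → ℝ) → ℝ≥0∞) (hBI : BIP u A C c) (j : ℕ) (x : Fin n → ℝ)
    (hP : PM A B u j x ≠ ∞) :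
    PM A B u j x ^ r ≤ C * ENNReal.ofReal (Real.exp (B * c)) * IM A B r u j x := by
  set P := PM A B u j x with hPdef
  set e := ENNReal.ofReal (Real.exp (B * c)) with he
  set F : ℕ → (Fin n → ℝ) → ℝ≥0∞ := fun l z => (2⁻¹ : ℝ≥0∞) ^ (l * A) * ew B j x z * u (j + l) z with hF
  have hFP : ∀ l z, F l z ≤ F l z ^ r * P ^ (1 - r) := by
    intro l z
    have h1 : F l z ≤ P := le_iSup_of_le (f := fun k => ⨆ y, (2⁻¹ : ℝ≥0∞) ^ (k * A) * ew B j x y * u (j + k) y) l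
      (le_iSup (fun z => F l z) z)
    calc F l z = F l z ^ (r + (1 - r)) := by simp
      _ = F l z ^ r * F l z ^ (1 - r) := ENNReal.rpow_add_of_nonneg _ _ hr0.le (by linarith)
      _ ≤ _ := by gcongr
  have hPr : P ^ (1 - r) ≠ ∞ := ENNReal.rpow_ne_top_of_nonneg (by linarith) hP
  have hehe : e ≠ ∞ := ENNReal.ofReal_ne_top
  have key : P ≤ C * e * IM A B r u j x * P ^ (1 - r) := by
    refine iSup_le fun k => iSup_le fun y => ?_
    have hne : (2⁻¹ : ℝ≥0∞) ^ (k * A) * ew B j x y ≠ ∞ :=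
      ENNReal.mul_ne_top (by simp) (ew_ne_top _ _ _ _)
    calc (2⁻¹ : ℝ≥0∞) ^ (k * A) * ew B j x y * u (j + k) y
        ≤ (2⁻¹ : ℝ≥0∞) ^ (k * A) * ew B j x y * (C * ∑' l : ℕ, (2⁻¹ : ℝ≥0∞) ^ (l * A) * 2 ^ ((j + k) * n) *
          ∫⁻ z in Metric.closedBall y (c / 2 ^ (j + k)), u (j + k + l) z) := by
          gcongr; exact hBI _ _
      _ = C * ∑' l : ℕ, 2 ^ ((j + k) * n) * ∫⁻ z in Metric.closedBall y (c / 2 ^ (j + k)),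
            ((2⁻¹ : ℝ≥0∞) ^ (k * A) * ew B j x y) * (2⁻¹ : ℝ≥0∞) ^ (l * A) * u (j + k + l) z := by
          rw [mul_left_comm, ← ENNReal.tsum_mul_left]
          congr 1; congr with l
          rw [lintegral_const_mul' _ _ (ENNReal.mul_ne_top hne (by simp))]
          ring
      _ ≤ C * ∑' l : ℕ, 2 ^ ((j + (k + l)) * n) * ∫⁻ z, e * P ^ (1 - r) * F (k + l) z ^ r := by
          refine mul_le_mul' le_rfl (ENNReal.tsum_le_tsum fun l => mul_le_mul' ?_ ?_)
          · exact pow_le_pow_right₀ (by norm_num) (Nat.mul_le_mul_right _ (by omega))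
          refine le_trans ?_ (setLIntegral_le_lintegral (Metric.closedBall y (c / 2 ^ (j + k))) _)
          refine setLIntegral_mono' measurableSet_closedBall fun z hz => ?_
          calc (2⁻¹ : ℝ≥0∞) ^ (k * A) * ew B j x y * (2⁻¹ : ℝ≥0∞) ^ (l * A) * u (j + k + l) z
              ≤ (2⁻¹ : ℝ≥0∞) ^ (k * A) * (e * ew B j x z) * (2⁻¹ : ℝ≥0∞) ^ (l * A) * u (j + k + l) z := by
                gcongr; exact ew_le_ball hB j k x y z hc hz
            _ = e * F (k + l) z := by
                simp only [hF]; rw [add_mul, pow_add, add_assoc]; ring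
            _ ≤ e * (F (k + l) z ^ r * P ^ (1 - r)) := by gcongr; exact hFP _ _
            _ = _ := by ring
      _ = C * e * (∑' l : ℕ, 2 ^ ((j + (k + l)) * n) * ∫⁻ z, F (k + l) z ^ r) * P ^ (1 - r) := by
          have : ∀ l : ℕ, (2 : ℝ≥0∞) ^ ((j + (k + l)) * n) * ∫⁻ z, e * P ^ (1 - r) * F (k + l) z ^ r
            = (e * P ^ (1 - r)) * (2 ^ ((j + (k + l)) * n) * ∫⁻ z, F (k + l) z ^ r) := fun l => by
            rw [lintegral_const_mul' _ _ (ENNReal.mul_ne_top hehe hPr)]; ring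
          simp_rw [this]
          rw [ENNReal.tsum_mul_left]; ring
      _ ≤ C * e * IM A B r u j x * P ^ (1 - r) := by
          gcongr
          exact ENNReal.tsum_comp_le_tsum_of_injective (f := fun l => k + l) (add_right_injective k)
            (fun l => 2 ^ ((j + l) * n) * ∫⁻ z, F l z ^ r)
  rcases eq_or_ne P 0 with h0 | h0
  · rw [h0, ENNReal.zero_rpow_of_pos hr0]; exact zero_le
  · have h1 : P ^ (1 - r) ≠ 0 := by
      rw [Ne, ENNReal.rpow_eq_zero_iff]; push Not
      exact ⟨fun h => absurd h h0, fun h => absurd h hP⟩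
    have h2 : P = P ^ r * P ^ (1 - r) := by
      rw [← ENNReal.rpow_add_of_nonneg _ _ hr0.le (by linarith)]; simp
    exact (ENNReal.mul_le_mul_iff_left h1 hPr).1 (h2.symm.trans_le key)

theorem IM_boot {n : ℕ} {A A' : ℕ} {B B' r : ℝ} (hA : A ≤ A') (hB : 0 ≤ B) (hBB : B ≤ B')
    (hr0 : 0 < r) (u : ℕ → (Fin n → ℝ) → ℝ≥0∞) (j k : ℕ) (x y : Fin n → ℝ) :
    ((2⁻¹ : ℝ≥0∞) ^ (k * A) * ew B j x y) ^ r * IM A' B' r u (j + k) y ≤ IM A B r u j x := by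
  have hne : ((2⁻¹ : ℝ≥0∞) ^ (k * A) * ew B j x y) ≠ ∞ :=
      ENNReal.mul_ne_top (by simp) (ew_ne_top _ _ _ _)
  unfold IM
  rw [← ENNReal.tsum_mul_left]
  refine le_trans ?_ (ENNReal.tsum_comp_le_tsum_of_injective (f := fun l => k + l) (add_right_injective k)
            (fun l => 2 ^ ((j + l) * n) * ∫⁻ z, ((2⁻¹ : ℝ≥0∞) ^ (l * A) * ew B j x z * u (j + l) z) ^ r))
  refine ENNReal.tsum_le_tsum fun l => ?_
  rw [mul_left_comm, ← lintegral_const_mul' _ _ (ENNReal.rpow_ne_top_of_nonneg hr0.le hne)]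
  simp only [← add_assoc]
  refine mul_le_mul' le_rfl (lintegral_mono fun z => ?_)
  rw [← ENNReal.mul_rpow_of_nonneg _ _ hr0.le]
  refine ENNReal.rpow_le_rpow ?_ hr0.le
  calc (2⁻¹ : ℝ≥0∞) ^ (k * A) * ew B j x y * ((2⁻¹ : ℝ≥0∞) ^ (l * A') * ew B' (j + k) y z * u (j + k + l) z)
      ≤ (2⁻¹ : ℝ≥0∞) ^ (k * A) * ew B j x y * ((2⁻¹ : ℝ≥0∞) ^ (l * A) * ew B (j + k) y z * u (j + k + l) z) := by
        refine mul_le_mul' le_rfl (mul_le_mul' (mul_le_mul' ?_ (ew_mono hBB _ _ _)) le_rfl)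
        exact pow_le_pow_right_of_le_one' (by simp) (Nat.mul_le_mul_left _ hA)
    _ = (2⁻¹ : ℝ≥0∞) ^ ((k + l) * A) * (ew B j x y * ew B (j + k) y z) * u (j + k + l) z := by
        rw [add_mul, pow_add]; ring
    _ ≤ _ := by gcongr; exact ew_trans hB _ _ _ _ _

theorem PM_ne_top {n : ℕ} {A A0 : ℕ} {B B0 : ℝ} {C0 : ℝ≥0∞} (hC0 : C0 ≠ ∞) (hA : A0 ≤ A) (hB0 : 0 ≤ B0)
    (hB : B0 ≤ B) (u : ℕ → (Fin n → ℝ) → ℝ≥0∞)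
    (hu : ∀ k y, u k y ≤ C0 * 2 ^ (k * A0) * ENNReal.ofReal (Real.exp (B0 * ‖y‖)))
    (j : ℕ) (x : Fin n → ℝ) : PM A B u j x ≠ ∞ := by
  have : PM A B u j x ≤ C0 * 2 ^ (j * A0) * ENNReal.ofReal (Real.exp (B0 * ‖x‖)) := by
    refine iSup_le fun k => iSup_le fun y => ?_
    have h1 : ew B j x y * ENNReal.ofReal (Real.exp (B0 * ‖y‖)) ≤ ENNReal.ofReal (Real.exp (B0 * ‖x‖)) := by
      unfold ew
      rw [← ENNReal.ofReal_mul (Real.exp_pos _).le, ← Real.exp_add]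
      refine ENNReal.ofReal_le_ofReal (Real.exp_le_exp.2 ?_)
      have h1 : ‖y‖ ≤ ‖x‖ + ‖x - y‖ := by
        have := norm_sub_le x (x - y); simpa using this
      have h2 : B0 * ‖y‖ ≤ B0 * (‖x‖ + ‖x - y‖) := by gcongr
      have h3 : B0 * 1 * ‖x - y‖ ≤ B * 2 ^ j * ‖x - y‖ := by
        gcongr
        · linarith
        · exact one_le_pow₀ (by norm_num)
      linarith
    have h2 : (2⁻¹ : ℝ≥0∞) ^ (k * A) * 2 ^ (k * A0) ≤ 1 := by
      calc (2⁻¹ : ℝ≥0∞) ^ (k * A) * 2 ^ (k * A0) ≤ (2⁻¹ : ℝ≥0∞) ^ (k * A0) * 2 ^ (k * A0) := by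
            gcongr ?_ * _
            refine pow_le_pow_right_of_le_one' (by simp) ?_
            gcongr
        _ = 1 := by rw [← mul_pow, ENNReal.inv_mul_cancel (by simp) (by simp), one_pow]
    calc (2⁻¹ : ℝ≥0∞) ^ (k * A) * ew B j x y * u (j + k) y
       ≤ (2⁻¹ : ℝ≥0∞) ^ (k * A) * ew B j x y * (C0 * 2 ^ ((j + k) * A0) * ENNReal.ofReal (Real.exp (B0 * ‖y‖))) := by
          gcongr; exact hu _ _
      _ = ((2⁻¹ : ℝ≥0∞) ^ (k * A) * 2 ^ (k * A0)) * (C0 * 2 ^ (j * A0)) * (ew B j x y * ENNReal.ofReal (Real.exp (B0 * ‖y‖))) := by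
          rw [add_mul, pow_add]; ring
      _ ≤ 1 * (C0 * 2 ^ (j * A0)) * ENNReal.ofReal (Real.exp (B0 * ‖x‖)) := by gcongr
      _ = _ := by ring
  refine ne_top_of_le_ne_top ?_ this
  exact ENNReal.mul_ne_top (ENNReal.mul_ne_top hC0 (by simp)) ENNReal.ofReal_ne_top

theorem PM_le {n : ℕ} {CA : ℕ → ℝ≥0∞} {cA : ℕ → ℝ} (hCA : ∀ A, CA A ≠ ∞) (hcA : ∀ A, 0 ≤ cA A)
    {A : ℕ} {B r : ℝ} (hB : 0 ≤ B) (hr0 : 0 < r) (hr1 : r ≤ 1)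
    (u : ℕ → (Fin n → ℝ) → ℝ≥0∞) (hBI : ∀ A, BIP u A (CA A) (cA A))
    (hgr : ∃ (C0 : ℝ≥0∞) (A0 : ℕ) (B0 : ℝ), C0 ≠ ∞ ∧ 0 ≤ B0 ∧
      ∀ k y, u k y ≤ C0 * 2 ^ (k * A0) * ENNReal.ofReal (Real.exp (B0 * ‖y‖)))
    (j : ℕ) (x : Fin n → ℝ) :
    PM A B u j x ^ r ≤ CA A * ENNReal.ofReal (Real.exp (B * cA A)) * IM A B r u j x := by
  by_cases hI : IM A B r u j x = ∞
  · by_cases hP : PM A B u j x = ∞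
    · -- then the constant is nonzero
      by_cases hC : CA A = 0
      · exfalso
        have : ∀ k y, u k y = 0 := fun k y => by
          have := hBI A k y
          simpa [hC] using this
        simp [PM, this] at hP
      · rw [hI, ENNReal.mul_top]
        · exact le_top
        · refine mul_ne_zero hC ?_
          simp [Real.exp_pos]
    · exact PM_le_aux hB hr0 hr1 (hcA A) u (hBI A) j x hP
  · obtain ⟨C0, A0, B0, hC0, hB0, hu⟩ := hgr
    refine PM_le_aux hB hr0 hr1 (hcA A) u (hBI A) j x ?_
    set A' := max A A0
    set B' := max B B0
    have hfin : ∀ j x, PM A' B' u j x ≠ ∞ := fun j x =>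
      PM_ne_top hC0 (le_max_right _ _) hB0 (le_max_right _ _) u hu j x
    have h1 := fun j x => PM_le_aux (hB.trans (le_max_left B B0)) hr0 hr1 (hcA A') u (hBI A') j x (hfin j x)
    set K := CA A' * ENNReal.ofReal (Real.exp (B' * cA A')) with hK
    have hKt : K ≠ ∞ := ENNReal.mul_ne_top (hCA _) ENNReal.ofReal_ne_top
    have h2 : PM A B u j x ^ r ≤ K * IM A B r u j x := by
      have e1 : PM A B u j x ^ r = ⨆ k, ⨆ y, ((2⁻¹ : ℝ≥0∞) ^ (k * A) * ew B j x y * u (j + k) y) ^ r := by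
        have := (ENNReal.orderIsoRpow r hr0).map_iSup (fun k => ⨆ y, (2⁻¹ : ℝ≥0∞) ^ (k * A) * ew B j x y * u (j + k) y)
        refine Eq.trans this ?_
        congr with k
        exact (ENNReal.orderIsoRpow r hr0).map_iSup (fun y => (2⁻¹ : ℝ≥0∞) ^ (k * A) * ew B j x y * u (j + k) y)
      rw [e1]
      refine iSup_le fun k => iSup_le fun y => ?_
      have h3 : u (j + k) y ≤ PM A' B' u (j + k) y := by
        refine le_iSup_of_le 0 (le_iSup_of_le y ?_)
        simp [ew]
      rw [ENNReal.mul_rpow_of_nonneg _ _ hr0.le]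
      calc _ ≤ ((2⁻¹ : ℝ≥0∞) ^ (k * A) * ew B j x y) ^ r * (K * IM A' B' r u (j + k) y) := by
            gcongr
            exact (ENNReal.rpow_le_rpow h3 hr0.le).trans (h1 _ _)
        _ = K * (((2⁻¹ : ℝ≥0∞) ^ (k * A) * ew B j x y) ^ r * IM A' B' r u (j + k) y) := by ring
        _ ≤ _ := by
            gcongr
            exact IM_boot (le_max_left _ _) hB (le_max_left _ _) hr0 u j k x y
    intro htop
    rw [htop, ENNReal.top_rpow_of_pos hr0] at h2
    exact ENNReal.mul_ne_top hKt hI (top_le_iff.1 h2)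

def cIdx {n : ℕ} (j : ℕ) (x : Fin n → ℝ) : Fin n → ℤ := fun i => ⌊x i * 2 ^ j⌋

def Qo {n : ℕ} (j : ℕ) (m : Fin n → ℤ) : Set (Fin n → ℝ) := cIdx j ⁻¹' {m}

theorem measurable_cIdx {n : ℕ} (j : ℕ) : Measurable (cIdx (n := n) j) :=
  measurable_pi_lambda _ fun i => Int.measurable_floor.comp ((measurable_pi_apply i).mul_const _)

theorem measurableSet_Qo {n : ℕ} (j : ℕ) (m : Fin n → ℤ) : MeasurableSet (Qo j m) :=
  measurable_cIdx j (measurableSet_singleton m)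

theorem Qo_disj {n : ℕ} (j : ℕ) : Pairwise (Function.onFun Disjoint (Qo (n := n) j)) := by
  intro a b hab
  rw [Function.onFun, Set.disjoint_left]
  intro x hx hy
  exact hab (hx.symm.trans hy)

theorem Qo_union {n : ℕ} (j : ℕ) : ⋃ m, Qo (n := n) j m = Set.univ := by
  ext x; simp [Qo]

theorem mem_Qo {n : ℕ} (j : ℕ) (x : Fin n → ℝ) : x ∈ Qo j (cIdx j x) := rfl

theorem Qo_sub {n : ℕ} (j : ℕ) (m : Fin n → ℤ) : Qo j m ⊆ dyadicCube n j m := by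
  intro x hx i
  have h : ⌊x i * 2 ^ j⌋ = m i := congrFun hx i
  have h1 := Int.floor_eq_iff.1 h
  have h2 : (0:ℝ) < 2 ^ j := by positivity
  constructor
  · rw [div_le_iff₀ h2]; exact h1.1
  · rw [le_div_iff₀ h2]; exact h1.2.le

theorem volume_dyadicCube (n j : ℕ) (m : Fin n → ℤ) :
    volume (dyadicCube n j m) = ((2 : ℝ≥0∞) ^ (j * n))⁻¹ := by
  have : dyadicCube n j m = Set.Icc (fun i => (m i : ℝ) / 2 ^ j) (fun i => ((m i : ℝ) + 1) / 2 ^ j) := by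
    ext x
    simp [dyadicCube, Set.mem_Icc, Pi.le_def, forall_and]
  rw [this, Real.volume_Icc_pi]
  have h : ∀ i, ENNReal.ofReal (((m i : ℝ) + 1) / 2 ^ j - (m i : ℝ) / 2 ^ j) = ((2 : ℝ≥0∞) ^ j)⁻¹ := by
    intro i
    rw [← sub_div, add_sub_cancel_left, one_div, ENNReal.ofReal_inv_of_pos (by positivity),
      ENNReal.ofReal_pow (by norm_num)]
    simp
  simp_rw [h]
  rw [Finset.prod_const, Finset.card_univ, Fintype.card_fin, pow_mul, ENNReal.inv_pow, ENNReal.inv_pow, ENNReal.inv_pow]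

theorem Qo_dist {n : ℕ} (j : ℕ) {m m' : Fin n → ℤ} {x z : Fin n → ℝ} (hx : x ∈ Qo j m) (hz : z ∈ Qo j m') :
    (zn (m - m') : ℝ) - 1 ≤ 2 ^ j * ‖x - z‖ := by
  rcases Nat.eq_zero_or_pos (zn (m - m')) with h0 | h0
  · rw [h0]
    have : 0 ≤ 2 ^ j * ‖x - z‖ := by positivity
    simp; linarith
  have hne : (Finset.univ : Finset (Fin n)).Nonempty := by
    by_contra hh
    rw [Finset.not_nonempty_iff_eq_empty] at hh
    simp [zn, hh] at h0
  obtain ⟨i, -, hi⟩ := Finset.exists_mem_eq_sup _ hne (fun i => ((m - m') i).natAbs)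
  have hzn : zn (m - m') = ((m - m') i).natAbs := hi
  have h1 := Int.floor_eq_iff.1 (congrFun hx i : ⌊x i * 2 ^ j⌋ = m i)
  have h2 := Int.floor_eq_iff.1 (congrFun hz i : ⌊z i * 2 ^ j⌋ = m' i)
  have h3 : |x i - z i| ≤ ‖x - z‖ := by simpa using norm_le_pi_norm (x - z) i
  have h4 : (2:ℝ) ^ j * |x i - z i| ≤ 2 ^ j * ‖x - z‖ := by gcongr
  rw [hzn]
  have h5 : ((((m - m') i).natAbs : ℕ) : ℝ) = |(m i : ℝ) - m' i| := by
    rw [Nat.cast_natAbs]; simp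
  rw [h5]
  refine le_trans ?_ h4
  have h6 : (2:ℝ) ^ j * |x i - z i| = |x i * 2 ^ j - z i * 2 ^ j| := by
    rw [← sub_mul, abs_mul, abs_of_pos (by positivity : (0:ℝ) < 2 ^ j), mul_comm]
  rw [h6]
  rw [sub_le_iff_le_add]
  refine abs_le.2 ⟨?_, ?_⟩
  · have := neg_abs_le (x i * 2 ^ j - z i * 2 ^ j); linarith
  · have := le_abs_self (x i * 2 ^ j - z i * 2 ^ j); linarith

theorem ew_cube {n : ℕ} {b : ℝ} (hb : 0 ≤ b) (j : ℕ) {m m' : Fin n → ℤ} {x z : Fin n → ℝ}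
    (hx : x ∈ Qo j m) (hz : z ∈ Qo j m') :
    ew (b * Real.log 2) j x z ≤ ENNReal.ofReal (2 ^ b) * ENNReal.ofReal (2 ^ (-b)) ^ zn (m - m') := by
  unfold ew
  rw [← ENNReal.ofReal_pow (by positivity), ← ENNReal.ofReal_mul (by positivity)]
  refine ENNReal.ofReal_le_ofReal ?_
  rw [← Real.rpow_natCast (2 ^ (-b)) (zn (m - m')), ← Real.rpow_mul (by norm_num), ← Real.rpow_add (by norm_num),
    Real.rpow_def_of_pos (by norm_num)]
  refine Real.exp_le_exp.2 ?_
  have h := Qo_dist j hx hz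
  have hl : 0 ≤ b * Real.log 2 := mul_nonneg hb (Real.log_nonneg (by norm_num))
  nlinarith [mul_le_mul_of_nonneg_left h hl]

theorem tkm_chain {n : ℕ} {p : ℝ≥0∞} {t : ℕ → (Fin n → ℝ) → ℝ} {a : ℝ≥0∞}
    (h : ∀ (k : ℕ) (m m' : Fin n → ℤ), (∀ i, |m i - m' i| ≤ 1) → tkm n p t k m ≤ a * tkm n p t k m')
    (k : ℕ) (m' : Fin n → ℤ) (N : ℕ) :
    ∀ m, zn (m - m') ≤ N → tkm n p t k m ≤ a ^ N * tkm n p t k m' := by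
  induction N with
  | zero =>
    intro m hm
    have : m = m' := by
      ext i
      have := (le_zn (m - m') i).trans hm
      simp only [Pi.sub_apply] at this
      omega
    simp [this]
  | succ N ih =>
    intro m hm
    have h1 := h k m (fun i => m i - (m i - m' i).sign) (fun i => by
      rcases lt_trichotomy (m i - m' i) 0 with hh | hh | hh
      · simp [Int.sign_eq_neg_one_of_neg hh]
      · simp [hh]
      · simp [Int.sign_eq_one_of_pos hh])
    have h2 := ih (fun i => m i - (m i - m' i).sign) (by
      unfold zn
      refine Finset.sup_le fun i _ => ?_
      have := (le_zn (m - m') i).trans hm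
      simp only [Pi.sub_apply] at this ⊢
      rcases lt_trichotomy (m i - m' i) 0 with hh | hh | hh
      · rw [Int.sign_eq_neg_one_of_neg hh]; omega
      · rw [hh]; simp; omega
      · rw [Int.sign_eq_one_of_pos hh]; omega)
    calc _ ≤ a * (a ^ N * tkm n p t k m') := h1.trans (by gcongr)
      _ = _ := by rw [pow_succ]; ring

theorem two_pow_rpow_inv_mul {N : ℕ} {a b : ℝ} :
    ((2 : ℝ≥0∞) ^ N) ^ a * (((2 : ℝ≥0∞) ^ N)⁻¹) ^ (a - b) = ((2 : ℝ≥0∞) ^ N) ^ b := by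
  rw [ENNReal.inv_rpow, ← ENNReal.rpow_neg, ← ENNReal.rpow_add _ _ (by simp) (by simp)]
  congr 1; ring

/-- Condition (i) with a smaller exponent. -/
theorem cond_i_small {n : ℕ} {p σ₁ σ : ℝ≥0∞} (hσ : σ ≤ σ₁) {t : ℕ → (Fin n → ℝ) → ℝ} {k j : ℕ}
    {m : Fin n → ℤ} {X : ℝ≥0∞} (htm : Measurable (t j))
    (h : (((2 : ℝ≥0∞) ^ (k * n)) ^ p⁻¹.toReal * tkm n p t k m) *
      (((2 : ℝ≥0∞) ^ (k * n)) ^ σ₁⁻¹.toReal *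
        eLpNorm (fun x => (t j x)⁻¹) σ₁ (volume.restrict (dyadicCube n k m))) ≤ X) :
    (((2 : ℝ≥0∞) ^ (k * n)) ^ p⁻¹.toReal * tkm n p t k m) *
      (((2 : ℝ≥0∞) ^ (k * n)) ^ σ⁻¹.toReal *
        eLpNorm (fun x => (t j x)⁻¹) σ (volume.restrict (dyadicCube n k m))) ≤ X := by
  refine le_trans ?_ h
  refine mul_le_mul' le_rfl ?_
  have h1 := eLpNorm_le_eLpNorm_mul_rpow_measure_univ (μ := volume.restrict (dyadicCube n k m))
    (f := fun x => (t j x)⁻¹) hσ htm.inv.aestronglyMeasurable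
  rw [Measure.restrict_apply_univ, volume_dyadicCube] at h1
  calc _ ≤ ((2 : ℝ≥0∞) ^ (k * n)) ^ σ⁻¹.toReal * _ := mul_le_mul' le_rfl h1
    _ = (((2 : ℝ≥0∞) ^ (k * n)) ^ σ⁻¹.toReal * (((2 : ℝ≥0∞) ^ (k * n))⁻¹) ^ (1 / σ.toReal - 1 / σ₁.toReal)) *
       eLpNorm (fun x => (t j x)⁻¹) σ₁ (volume.restrict (dyadicCube n k m)) := by ring
    _ = _ := by
      rw [ENNReal.toReal_inv, ENNReal.toReal_inv, one_div, one_div, two_pow_rpow_inv_mul]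

theorem cond_ii_p {n : ℕ} {p σ₂ : ℝ≥0∞} (hσ : p ≤ σ₂) {t : ℕ → (Fin n → ℝ) → ℝ} {k j : ℕ}
    {m : Fin n → ℤ} {X : ℝ≥0∞} (htm : Measurable (t j))
    (h : ((2 : ℝ≥0∞) ^ (k * n)) ^ σ₂⁻¹.toReal *
        eLpNorm (t j) σ₂ (volume.restrict (dyadicCube n k m))
      ≤ X * (((2 : ℝ≥0∞) ^ (k * n)) ^ p⁻¹.toReal * tkm n p t k m)) :
    eLpNorm (t j) p (volume.restrict (dyadicCube n k m)) ≤ X * tkm n p t k m := by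
  have h1 := eLpNorm_le_eLpNorm_mul_rpow_measure_univ (μ := volume.restrict (dyadicCube n k m))
    (f := t j) hσ htm.aestronglyMeasurable
  rw [Measure.restrict_apply_univ, volume_dyadicCube] at h1
  set T := ((2 : ℝ≥0∞) ^ (k * n)) ^ p⁻¹.toReal with hT
  have hT0 : T ≠ 0 := by simp [hT, ENNReal.rpow_eq_zero_iff]
  have hTt : T ≠ ∞ := ENNReal.rpow_ne_top_of_nonneg (by simp) (by simp)
  have : T * eLpNorm (t j) p (volume.restrict (dyadicCube n k m)) ≤ T * (X * tkm n p t k m) := by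
    calc _ ≤ T * _ := mul_le_mul' le_rfl h1
      _ = (T * (((2 : ℝ≥0∞) ^ (k * n))⁻¹) ^ (1 / p.toReal - 1 / σ₂.toReal)) *
         eLpNorm (t j) σ₂ (volume.restrict (dyadicCube n k m)) := by ring
      _ = ((2 : ℝ≥0∞) ^ (k * n)) ^ σ₂⁻¹.toReal *
        eLpNorm (t j) σ₂ (volume.restrict (dyadicCube n k m)) := by
        rw [hT, ENNReal.toReal_inv, ENNReal.toReal_inv, one_div, one_div, two_pow_rpow_inv_mul]
      _ ≤ _ := h
      _ = _ := by ring
  exact (ENNReal.mul_le_mul_iff_right hT0 hTt).1 this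

/-- Hölder on a cube. -/
theorem holder_cube {n : ℕ} {p σ r : ℝ≥0∞} [HolderTriple p σ r] (hr0 : 0 < r) (hr : r ≠ ∞) (hp : 0 < p) (hσ : 0 < σ)
    {t : ℕ → (Fin n → ℝ) → ℝ} {k j : ℕ}
    {m : Fin n → ℤ} {X : ℝ≥0∞} (htm : Measurable (t j)) (htp : ∀ᵐ x : Fin n → ℝ, 0 < t j x)
    (h : (((2 : ℝ≥0∞) ^ (k * n)) ^ p⁻¹.toReal * tkm n p t k m) *
      (((2 : ℝ≥0∞) ^ (k * n)) ^ σ⁻¹.toReal *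
        eLpNorm (fun x => (t j x)⁻¹) σ (volume.restrict (dyadicCube n k m))) ≤ X)
    (g : (Fin n → ℝ) → ℝ) (hg : Continuous g) :
    tkm n p t k m ^ r.toReal * (2 ^ (k * n) * ∫⁻ z in Qo k m, ‖g z‖ₑ ^ r.toReal) ≤
      (X * eLpNorm (fun x => t j x * g x) p (volume.restrict (Qo k m))) ^ r.toReal := by
  have hrr : 0 < r.toReal := ENNReal.toReal_pos hr0.ne' hr
  have e1 : ∫⁻ z in Qo k m, ‖g z‖ₑ ^ r.toReal = eLpNorm g r (volume.restrict (Qo k m)) ^ r.toReal := by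
    rw [eLpNorm_eq_lintegral_rpow_enorm_toReal hr0.ne' hr, ← ENNReal.rpow_mul, one_div,
      inv_mul_cancel₀ hrr.ne', ENNReal.rpow_one]
  have e2 : eLpNorm g r (volume.restrict (Qo k m)) ≤
      eLpNorm (fun x => t j x * g x) p (volume.restrict (Qo k m)) *
      eLpNorm (fun x => (t j x)⁻¹) σ (volume.restrict (Qo k m)) := by
    have := eLpNorm_smul_le_mul_eLpNorm (p := p) (q := σ) (r := r) (μ := volume.restrict (Qo k m))
      (f := fun x => (t j x)⁻¹) htm.inv.aestronglyMeasurable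
      (φ := fun x => t j x * g x) (htm.mul hg.measurable).aestronglyMeasurable
    refine le_trans (le_of_eq (eLpNorm_congr_ae ?_)) this
    filter_upwards [ae_restrict_of_ae htp] with x hx
    simp only [Pi.smul_apply', smul_eq_mul]
    field_simp
  have e3 : eLpNorm (fun x => (t j x)⁻¹) σ (volume.restrict (Qo k m)) ≤
      eLpNorm (fun x => (t j x)⁻¹) σ (volume.restrict (dyadicCube n k m)) :=
    eLpNorm_mono_measure _ (Measure.restrict_mono (Qo_sub k m) le_rfl)
  have hinv : r.toReal⁻¹ = p⁻¹.toReal + σ⁻¹.toReal := by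
    rw [← ENNReal.toReal_inv, ← HolderTriple.inv_add_inv_eq_inv p σ r, ENNReal.toReal_add]
    · exact ENNReal.inv_ne_top.2 hp.ne'
    · exact ENNReal.inv_ne_top.2 hσ.ne'
  have e4 : (2 : ℝ≥0∞) ^ (k * n) = ((((2 : ℝ≥0∞) ^ (k * n)) ^ p⁻¹.toReal * ((2 : ℝ≥0∞) ^ (k * n)) ^ σ⁻¹.toReal)) ^ r.toReal := by
    rw [← ENNReal.rpow_add _ _ (by simp) (by simp), ← hinv, ← ENNReal.rpow_mul, inv_mul_cancel₀ hrr.ne',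
      ENNReal.rpow_one]
  rw [e1]
  nth_rewrite 1 [e4]
  rw [← ENNReal.mul_rpow_of_nonneg _ _ hrr.le, ← ENNReal.mul_rpow_of_nonneg _ _ hrr.le]
  refine ENNReal.rpow_le_rpow ?_ hrr.le
  set U := eLpNorm (fun x => t j x * g x) p (volume.restrict (Qo k m))
  calc _ ≤ tkm n p t k m * (((2 : ℝ≥0∞) ^ (k * n)) ^ p⁻¹.toReal * ((2 : ℝ≥0∞) ^ (k * n)) ^ σ⁻¹.toReal *
        (U * eLpNorm (fun x => (t j x)⁻¹) σ (volume.restrict (dyadicCube n k m)))) := by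
        gcongr; exact e2.trans (by gcongr)
    _ = ((((2 : ℝ≥0∞) ^ (k * n)) ^ p⁻¹.toReal * tkm n p t k m) *
      (((2 : ℝ≥0∞) ^ (k * n)) ^ σ⁻¹.toReal *
        eLpNorm (fun x => (t j x)⁻¹) σ (volume.restrict (dyadicCube n k m)))) * U := by ring
    _ ≤ X * U := by gcongr

theorem half_pow_eq (N : ℕ) : (2⁻¹ : ℝ≥0∞) ^ N = ENNReal.ofReal (2 ^ (-(N : ℝ))) := by
  rw [Real.rpow_neg (by norm_num), Real.rpow_natCast, ENNReal.ofReal_inv_of_pos (by positivity),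
    ENNReal.ofReal_pow (by norm_num)]
  simp [ENNReal.inv_pow]

theorem two_pow_eq (N : ℕ) : (2 : ℝ≥0∞) ^ N = ENNReal.ofReal (2 ^ ((N : ℝ))) := by
  rw [Real.rpow_natCast, ENNReal.ofReal_pow (by norm_num)]
  simp

theorem A_choice {n A j l : ℕ} {rr α₁ C₁ : ℝ} (hrr : 0 < rr) (hC : 0 < C₁) (hA : n / rr - α₁ + 3 ≤ A) :
    ((2⁻¹ : ℝ≥0∞) ^ (l * A)) ^ rr * 2 ^ (l * n) *
      (ENNReal.ofReal (C₁ * 2 ^ (α₁ * ((j : ℝ) - ((j + l : ℕ) : ℝ))))) ^ rr ≤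
      (ENNReal.ofReal C₁ * (2⁻¹) ^ (3 * l)) ^ rr := by
  have h2 : (2 : ℝ≥0∞) ^ (l * n) = (ENNReal.ofReal (2 ^ ((l : ℝ) * n / rr))) ^ rr := by
    rw [two_pow_eq, ENNReal.ofReal_rpow_of_nonneg (by positivity) hrr.le, ← Real.rpow_mul (by norm_num)]
    congr 2
    push_cast
    field_simp
  rw [h2, ← ENNReal.mul_rpow_of_nonneg _ _ hrr.le, ← ENNReal.mul_rpow_of_nonneg _ _ hrr.le]
  refine ENNReal.rpow_le_rpow ?_ hrr.le
  rw [half_pow_eq, half_pow_eq, ← ENNReal.ofReal_mul (by positivity), ← ENNReal.ofReal_mul (by positivity),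
    ← ENNReal.ofReal_mul (by positivity)]
  refine ENNReal.ofReal_le_ofReal ?_
  calc _ = C₁ * (2 ^ (-((l * A : ℕ) : ℝ)) * 2 ^ ((l : ℝ) * n / rr) * 2 ^ (α₁ * ((j : ℝ) - ((j + l : ℕ) : ℝ)))) := by ring
    _ ≤ _ := by
      rw [← Real.rpow_add (by norm_num), ← Real.rpow_add (by norm_num)]
      gcongr
      · norm_num
      push_cast
      have hl : (0:ℝ) ≤ l := by positivity
      have := mul_le_mul_of_nonneg_left hA hl
      have e : (l:ℝ) * (n / rr - α₁ + 3) = l * n / rr - l * α₁ + 3 * l := by ring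
      rw [e] at this
      linarith

/-- One term of the discretization. -/
theorem disc_term {n : ℕ} {p σ r : ℝ≥0∞} [HolderTriple p σ r] (hr0 : 0 < r) (hr : r ≠ ∞) (hp : 0 < p) (hσ : 0 < σ)
    {t : ℕ → (Fin n → ℝ) → ℝ} {j l A : ℕ} {α₁ α₃ C₁ : ℝ} (hα₃ : 0 ≤ α₃) (hC : 0 < C₁)
    (hA : n / r.toReal - α₁ + 3 ≤ A)
    {m m' : Fin n → ℤ} (htm : Measurable (t (j + l))) (htp : ∀ᵐ x : Fin n → ℝ, 0 < t (j + l) x)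
    (h : (((2 : ℝ≥0∞) ^ (j * n)) ^ p⁻¹.toReal * tkm n p t j m') *
      (((2 : ℝ≥0∞) ^ (j * n)) ^ σ⁻¹.toReal *
        eLpNorm (fun x => (t (j + l) x)⁻¹) σ (volume.restrict (dyadicCube n j m'))) ≤
        ENNReal.ofReal (C₁ * 2 ^ (α₁ * ((j : ℝ) - ((j + l : ℕ) : ℝ)))))
    (hch : ∀ (k : ℕ) (m m' : Fin n → ℤ), (∀ i, |m i - m' i| ≤ 1) →
      tkm n p t k m ≤ ENNReal.ofReal (2 ^ α₃) * tkm n p t k m')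
    (g : (Fin n → ℝ) → ℝ) (hg : Continuous g) {x : Fin n → ℝ} (hx : x ∈ Qo j m) :
    tkm n p t j m ^ r.toReal * ((2 : ℝ≥0∞) ^ ((j + l) * n) *
      ∫⁻ z in Qo j m', ((2⁻¹ : ℝ≥0∞) ^ (l * A) * ew ((α₃ + 2) * Real.log 2) j x z * ‖g z‖ₑ) ^ r.toReal) ≤
    (ENNReal.ofReal (2 ^ (α₃ + 2)) * ENNReal.ofReal C₁ * ((2⁻¹ : ℝ≥0∞) ^ l * 2⁻¹ ^ zn (m - m')) *
      (2⁻¹ ^ (2 * l) * (2⁻¹ ^ zn (m - m') *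
        eLpNorm (fun x => t (j + l) x * g x) p (volume.restrict (Qo j m'))))) ^ r.toReal := by
  have hrr : 0 < r.toReal := ENNReal.toReal_pos hr0.ne' hr
  set rr := r.toReal
  set U := eLpNorm (fun x => t (j + l) x * g x) p (volume.restrict (Qo j m'))
  set N := zn (m - m') with hN
  set e := ENNReal.ofReal (2 ^ (α₃ + 2)) with he
  set e' := ENNReal.ofReal (2 ^ (-(α₃ + 2))) with he'
  set a := ENNReal.ofReal (2 ^ α₃) with ha
  set y : ℝ≥0∞ := 2⁻¹ with hy
  set X := ENNReal.ofReal (C₁ * 2 ^ (α₁ * ((j : ℝ) - ((j + l : ℕ) : ℝ)))) with hX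
  have h1 := holder_cube hr0 hr hp hσ htm htp h g hg
  have h2 : tkm n p t j m ≤ a ^ N * tkm n p t j m' := tkm_chain hch j m' N m le_rfl
  have h3 : ∫⁻ z in Qo j m', (y ^ (l * A) * ew ((α₃ + 2) * Real.log 2) j x z * ‖g z‖ₑ) ^ rr ≤
      (y ^ (l * A) * (e * e' ^ N)) ^ rr * ∫⁻ z in Qo j m', ‖g z‖ₑ ^ rr := by
    rw [← lintegral_const_mul' _ _ (ENNReal.rpow_ne_top_of_nonneg hrr.le (by finiteness))]
    refine setLIntegral_mono' (measurableSet_Qo j m') fun z hz => ?_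
    rw [← ENNReal.mul_rpow_of_nonneg _ _ hrr.le]
    gcongr
    exact ew_cube (by linarith) j hx hz
  have hae : a * e' = y * y := by
    have h4 : y * y = y ^ 2 := by ring
    rw [h4, hy, half_pow_eq, ha, he', ← ENNReal.ofReal_mul (by positivity), ← Real.rpow_add (by norm_num)]
    congr 2; push_cast; ring
  calc _ ≤ (a ^ N * tkm n p t j m') ^ rr * (2 ^ ((j + l) * n) *
        ((y ^ (l * A) * (e * e' ^ N)) ^ rr * ∫⁻ z in Qo j m', ‖g z‖ₑ ^ rr)) := by gcongr
    _ = ((y ^ (l * A)) ^ rr * 2 ^ (l * n)) * (e * (a * e') ^ N) ^ rr *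
        (tkm n p t j m' ^ rr * (2 ^ (j * n) * ∫⁻ z in Qo j m', ‖g z‖ₑ ^ rr)) := by
        simp only [ENNReal.mul_rpow_of_nonneg _ _ hrr.le, mul_pow, add_mul, pow_add]; ring
    _ ≤ ((y ^ (l * A)) ^ rr * 2 ^ (l * n)) * (e * (a * e') ^ N) ^ rr * (X * U) ^ rr := by gcongr
    _ = ((y ^ (l * A)) ^ rr * 2 ^ (l * n) * X ^ rr) * (e * (a * e') ^ N * U) ^ rr := by
        simp only [ENNReal.mul_rpow_of_nonneg _ _ hrr.le]; ring
    _ ≤ (ENNReal.ofReal C₁ * y ^ (3 * l)) ^ rr * (e * (a * e') ^ N * U) ^ rr := by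
        gcongr; exact A_choice hrr hC hA
    _ = _ := by
        rw [← ENNReal.mul_rpow_of_nonneg _ _ hrr.le, hae]
        congr 1
        ring

theorem tsum_zn_sub (n : ℕ) (x : ℝ≥0∞) (m : Fin n → ℤ) :
    ∑' m' : Fin n → ℤ, x ^ zn (m - m') = ∑' m' : Fin n → ℤ, x ^ zn m' :=
  (Equiv.subLeft m).tsum_eq (fun m' => x ^ zn m')

def Zc (n : ℕ) (rr : ℝ) : ℝ≥0∞ := (∑' l : ℕ, ((2⁻¹ : ℝ≥0∞) ^ rr) ^ l) * ∑' m : Fin n → ℤ, ((2⁻¹ : ℝ≥0∞) ^ rr) ^ zn m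

theorem half_rpow_lt {rr : ℝ} (h : 0 < rr) : (2⁻¹ : ℝ≥0∞) ^ rr < 1 := by
  rw [← ENNReal.one_rpow rr]
  exact ENNReal.rpow_lt_rpow (by simp) h

theorem Zc_ne_top (n : ℕ) {rr : ℝ} (h : 0 < rr) : Zc n rr ≠ ∞ :=
  ENNReal.mul_ne_top (tsum_geom_ne_top (half_rpow_lt h)) (tsum_lattice_ne_top n (half_rpow_lt h))

theorem disc_point {n : ℕ} {p σ r : ℝ≥0∞} [HolderTriple p σ r] (hr0 : 0 < r) (hr : r ≠ ∞) (hp : 0 < p) (hσ : 0 < σ)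
    {t : ℕ → (Fin n → ℝ) → ℝ} {j A : ℕ} {α₁ α₃ C₁ : ℝ} (hα₃ : 0 ≤ α₃) (hC : 0 < C₁)
    (hA : n / r.toReal - α₁ + 3 ≤ A)
    (htm : ∀ j, Measurable (t j)) (htp : ∀ j, ∀ᵐ x : Fin n → ℝ, 0 < t j x)
    (h : ∀ k j : ℕ, k ≤ j → ∀ m : Fin n → ℤ,
      (((2 : ℝ≥0∞) ^ (k * n)) ^ p⁻¹.toReal * tkm n p t k m) *
      (((2 : ℝ≥0∞) ^ (k * n)) ^ σ⁻¹.toReal *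
        eLpNorm (fun x => (t j x)⁻¹) σ (volume.restrict (dyadicCube n k m))) ≤
        ENNReal.ofReal (C₁ * 2 ^ (α₁ * ((k : ℝ) - (j : ℝ)))))
    (hch : ∀ (k : ℕ) (m m' : Fin n → ℤ), (∀ i, |m i - m' i| ≤ 1) →
      tkm n p t k m ≤ ENNReal.ofReal (2 ^ α₃) * tkm n p t k m')
    (g : ℕ → (Fin n → ℝ) → ℝ) (hg : ∀ k, Continuous (g k)) {K : ℝ≥0∞}
    {m : Fin n → ℤ} {x : Fin n → ℝ} (hx : x ∈ Qo j m)
    (hK : PM A ((α₃ + 2) * Real.log 2) (fun k y => ‖g k y‖ₑ) j x ^ r.toReal ≤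
      K * IM A ((α₃ + 2) * Real.log 2) r.toReal (fun k y => ‖g k y‖ₑ) j x) :
    tkm n p t j m * PM A ((α₃ + 2) * Real.log 2) (fun k y => ‖g k y‖ₑ) j x ≤
      (K * Zc n r.toReal) ^ (r.toReal)⁻¹ * (ENNReal.ofReal (2 ^ (α₃ + 2)) * ENNReal.ofReal C₁) *
      ⨆ l : ℕ, (2⁻¹ : ℝ≥0∞) ^ (2 * l) * ⨆ m' : Fin n → ℤ, 2⁻¹ ^ zn (m - m') *
        eLpNorm (fun x => t (j + l) x * g (j + l) x) p (volume.restrict (Qo j m')) := by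
  have hrr : 0 < r.toReal := ENNReal.toReal_pos hr0.ne' hr
  set S := ⨆ l : ℕ, (2⁻¹ : ℝ≥0∞) ^ (2 * l) * ⨆ m' : Fin n → ℤ, 2⁻¹ ^ zn (m - m') *
        eLpNorm (fun x => t (j + l) x * g (j + l) x) p (volume.restrict (Qo j m')) with hS
  set E := ENNReal.ofReal (2 ^ (α₃ + 2)) * ENNReal.ofReal C₁ with hE
  refine le_of_rpow_le' hrr ?_
  have hSle : ∀ (l : ℕ) (m' : Fin n → ℤ), (2⁻¹ : ℝ≥0∞) ^ (2 * l) * (2⁻¹ ^ zn (m - m') *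
        eLpNorm (fun x => t (j + l) x * g (j + l) x) p (volume.restrict (Qo j m'))) ≤ S := by
    intro l m'
    refine le_trans ?_ (le_iSup (fun l : ℕ => (2⁻¹ : ℝ≥0∞) ^ (2 * l) * ⨆ m' : Fin n → ℤ, 2⁻¹ ^ zn (m - m') *
        eLpNorm (fun x => t (j + l) x * g (j + l) x) p (volume.restrict (Qo j m'))) l)
    exact mul_le_mul' le_rfl (le_iSup (fun m' : Fin n → ℤ => (2⁻¹ : ℝ≥0∞) ^ zn (m - m') *
        eLpNorm (fun x => t (j + l) x * g (j + l) x) p (volume.restrict (Qo j m'))) m')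
  rw [ENNReal.mul_rpow_of_nonneg _ _ hrr.le]
  calc _ ≤ tkm n p t j m ^ r.toReal * (K * IM A ((α₃ + 2) * Real.log 2) r.toReal (fun k y => ‖g k y‖ₑ) j x) := by gcongr
    _ = K * ∑' l : ℕ, ∑' m' : Fin n → ℤ, tkm n p t j m ^ r.toReal * ((2 : ℝ≥0∞) ^ ((j + l) * n) *
      ∫⁻ z in Qo j m', ((2⁻¹ : ℝ≥0∞) ^ (l * A) * ew ((α₃ + 2) * Real.log 2) j x z * ‖g (j + l) z‖ₑ) ^ r.toReal) := by
      rw [mul_left_comm, IM, ← ENNReal.tsum_mul_left]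
      congr 1
      refine tsum_congr fun l => ?_
      rw [ENNReal.tsum_mul_left, ENNReal.tsum_mul_left, ← lintegral_iUnion (measurableSet_Qo j) (Qo_disj j),
        Qo_union, Measure.restrict_univ]
    _ ≤ K * ∑' l : ℕ, ∑' m' : Fin n → ℤ, (E * S) ^ r.toReal *
        ((((2⁻¹ : ℝ≥0∞) ^ r.toReal) ^ l) * ((2⁻¹ : ℝ≥0∞) ^ r.toReal) ^ zn (m - m')) := by
      refine mul_le_mul' le_rfl (ENNReal.tsum_le_tsum fun l => ENNReal.tsum_le_tsum fun m' => ?_)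
      refine (disc_term hr0 hr hp hσ hα₃ hC hA (htm _) (htp _) (h j (j + l) (by omega) m') hch
        (g (j + l)) (hg _) hx).trans ?_
      have hc : ∀ N : ℕ, (((2⁻¹ : ℝ≥0∞) ^ r.toReal) ^ N) = ((2⁻¹ : ℝ≥0∞) ^ N) ^ r.toReal := by
        intro N
        rw [← ENNReal.rpow_natCast, ← ENNReal.rpow_mul, mul_comm, ENNReal.rpow_mul, ENNReal.rpow_natCast]
      rw [hc, hc, ← ENNReal.mul_rpow_of_nonneg _ _ hrr.le, ← ENNReal.mul_rpow_of_nonneg _ _ hrr.le]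
      refine ENNReal.rpow_le_rpow ?_ hrr.le
      rw [mul_right_comm]
      gcongr
      exact hSle l m'
    _ = (K * Zc n r.toReal) * (E * S) ^ r.toReal := by
      simp_rw [ENNReal.tsum_mul_left]
      simp_rw [tsum_zn_sub, ENNReal.tsum_mul_right]
      unfold Zc; ring
    _ = _ := by
      rw [mul_assoc _ E S, ENNReal.mul_rpow_of_nonneg _ (E * S) hrr.le, ← ENNReal.rpow_mul, inv_mul_cancel₀ hrr.ne',
        ENNReal.rpow_one]

theorem lpSum_equiv {ι κ : Type*} (p : ℝ≥0∞) (e : ι ≃ κ) (a : κ → ℝ≥0∞) :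
    lpSum p (fun i => a (e i)) = lpSum p a := by
  unfold lpSum
  split_ifs
  · exact e.iSup_comp (g := a)
  · rw [e.tsum_eq (fun k => a k ^ p.toReal)]

theorem eLpNorm_enorm_eq {α : Type*} [MeasurableSpace α] {μ : Measure α} (p : ℝ≥0∞) (g : α → ℝ) :
    eLpNorm (fun x => ‖g x‖ₑ) p μ = eLpNorm g p μ := by
  exact eLpNorm_enorm g

def Dj {n : ℕ} (p : ℝ≥0∞) (t : ℕ → (Fin n → ℝ) → ℝ) (P : ℕ → (Fin n → ℝ) → ℝ≥0∞) (j : ℕ) : ℝ≥0∞ :=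
  lpSum p (fun m : Fin n → ℤ => tkm n p t j m * ⨆ x : Qo j m, P j x)

theorem disc_lp {n : ℕ} {p : ℝ≥0∞} (hp : 0 < p) {t : ℕ → (Fin n → ℝ) → ℝ} 
    (g : ℕ → (Fin n → ℝ) → ℝ) (P : ℕ → (Fin n → ℝ) → ℝ≥0∞) (j : ℕ) (K : ℝ≥0∞)
    (h : ∀ m, ∀ x ∈ Qo j m, tkm n p t j m * P j x ≤ K * ⨆ l : ℕ, (2⁻¹ : ℝ≥0∞) ^ (2 * l) * ⨆ m' : Fin n → ℤ, 2⁻¹ ^ zn (m - m') *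
        eLpNorm (fun x => t (j + l) x * g (j + l) x) p (volume.restrict (Qo j m'))) :
    Dj p t P j ≤ K * (lpSum p (fun l : ℕ => (2⁻¹ : ℝ≥0∞) ^ l) * lpSum p (fun m : Fin n → ℤ => (2⁻¹ : ℝ≥0∞) ^ zn m)) *
      ⨆ l : ℕ, (2⁻¹ : ℝ≥0∞) ^ l * eLpNorm (fun x => t (j + l) x * g (j + l) x) p volume := by
  unfold Dj
  set c1 := lpSum p (fun l : ℕ => (2⁻¹ : ℝ≥0∞) ^ l)
  set c2 := lpSum p (fun m : Fin n → ℤ => (2⁻¹ : ℝ≥0∞) ^ zn m) with hc2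
  calc _ ≤ lpSum p (fun m : Fin n → ℤ => K * ⨆ l : ℕ, (2⁻¹ : ℝ≥0∞) ^ (l) * ((2⁻¹ : ℝ≥0∞) ^ (l) * ⨆ m' : Fin n → ℤ, 2⁻¹ ^ zn (m - m') *
        eLpNorm (fun x => t (j + l) x * g (j + l) x) p (volume.restrict (Qo j m')))) := by
        refine lpSum_mono p fun m => ?_
        rw [ENNReal.mul_iSup]
        refine iSup_le fun x => (h m x x.2).trans (le_of_eq ?_)
        congr 1
        refine iSup_congr fun l => ?_
        rw [two_mul, pow_add, mul_assoc]
    _ = K * lpSum p (fun m : Fin n → ℤ => ⨆ l : ℕ, (2⁻¹ : ℝ≥0∞) ^ (l) * ((2⁻¹ : ℝ≥0∞) ^ (l) * ⨆ m' : Fin n → ℤ, 2⁻¹ ^ zn (m - m') *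
        eLpNorm (fun x => t (j + l) x * g (j + l) x) p (volume.restrict (Qo j m')))) := lpSum_const_mul hp _ _
    _ ≤ K * (c1 * ⨆ l : ℕ, lpSum p (fun m : Fin n → ℤ => (2⁻¹ : ℝ≥0∞) ^ (l) * ⨆ m' : Fin n → ℤ, 2⁻¹ ^ zn (m - m') *
        eLpNorm (fun x => t (j + l) x * g (j + l) x) p (volume.restrict (Qo j m')))) := by
        gcongr
        exact lpSum_S hp _ _
    _ ≤ K * (c1 * ⨆ l : ℕ, (2⁻¹ : ℝ≥0∞) ^ (l) * (c2 * 
        eLpNorm (fun x => t (j + l) x * g (j + l) x) p volume)) := by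
        gcongr with l
        rw [lpSum_const_mul hp]
        gcongr
        refine (lpSum_W hp (fun m m' => (2⁻¹ : ℝ≥0∞) ^ zn (m - m')) _ c2 fun m' => ?_).trans ?_
        · exact le_of_eq (lpSum_equiv p (Equiv.subRight m') (fun m => (2⁻¹ : ℝ≥0∞) ^ zn m))
        · rw [← eLpNorm_enorm_eq p, eLpNorm_partition hp (Qo j) (measurableSet_Qo j) (Qo_disj j) (Qo_union j)]
          simp_rw [eLpNorm_enorm_eq]
          exact le_rfl
    _ = _ := by
        simp_rw [mul_left_comm _ c2]
        rw [← ENNReal.mul_iSup]; ring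

theorem lpSum_inj {ι κ : Type*} (p : ℝ≥0∞) {e : ι → κ} (he : Function.Injective e) (a : κ → ℝ≥0∞) :
    lpSum p (fun i => a (e i)) ≤ lpSum p a := by
  unfold lpSum
  split_ifs
  · exact iSup_le fun i => le_iSup a (e i)
  · refine ENNReal.rpow_le_rpow ?_ (by positivity)
    exact ENNReal.tsum_comp_le_tsum_of_injective he (fun k => a k ^ p.toReal)

def Wc (p y : ℝ≥0∞) : ℝ≥0∞ := lpSum p (fun m : Fin 1 → ℤ => y ^ zn m)

theorem Wc_ne_top {p y : ℝ≥0∞} (hp : 0 < p) (hy : y < 1) : Wc p y ≠ ∞ := lpSum_lattice_ne_top 1 hp hy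

theorem lpSum_nat_le_Wc (p y : ℝ≥0∞) (j : ℕ) : lpSum p (fun k : ℕ => y ^ ((k : ℤ) - j).natAbs) ≤ Wc p y := by
  have h := lpSum_inj p (e := fun k : ℕ => (fun _ : Fin 1 => (k : ℤ) - j))
    (fun a b hab => by have := congrFun hab 0; simp at this; exact this) (fun m => y ^ zn m)
  refine le_trans (le_of_eq ?_) h
  congr 1
  funext k
  simp [zn]

theorem lpSum_nat_le_Wc' (p y : ℝ≥0∞) (j : ℕ) : lpSum p (fun k : ℕ => y ^ ((j : ℤ) - k).natAbs) ≤ Wc p y := by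
  have : (fun k : ℕ => y ^ ((j : ℤ) - k).natAbs) = (fun k : ℕ => y ^ ((k : ℤ) - j).natAbs) := by
    funext k
    congr 1
    omega
  rw [this]; exact lpSum_nat_le_Wc p y j

theorem eLpNorm_const_mul_le {α : Type*} [MeasurableSpace α] {μ : Measure α} {p : ℝ≥0∞} (hp0 : 0 < p)
    (c : ℝ≥0∞) (g : α → ℝ≥0∞) (hg : Measurable g) :
    eLpNorm (fun x => c * g x) p μ ≤ c * eLpNorm g p μ := by
  have h := eLpNorm_S (μ := μ) hp0 (fun _ : Unit => c) (fun _ => g) (fun _ => hg)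
  have h2 : lpSum p (fun _ : Unit => c) = c := by
    by_cases hp : p = ∞
    · subst hp; simp [lpSum_top]
    · have h : 0 < p.toReal := ENNReal.toReal_pos hp0.ne' hp
      rw [lpSum_ne hp]
      simp [← ENNReal.rpow_mul, h.ne']
  rw [h2] at h
  simpa using h

theorem step2_term {n : ℕ} {p : ℝ≥0∞} (hp : 0 < p) {t : ℕ → (Fin n → ℝ) → ℝ} {j k : ℕ} (c c' : ℝ≥0∞)
    (htm : ∀ j, Measurable (t j)) (P : ℕ → (Fin n → ℝ) → ℝ≥0∞)
    (h : ∀ m, eLpNorm (t k) p (volume.restrict (dyadicCube n j m)) ≤ c' * tkm n p t j m) :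
    eLpNorm (fun x => c * (⨆ z : Qo j (cIdx j x), P j z) * ‖t k x‖ₑ) p volume ≤ c * c' * Dj p t P j := by
  rw [eLpNorm_partition hp (Qo j) (measurableSet_Qo j) (Qo_disj j) (Qo_union j), Dj, ← lpSum_const_mul hp]
  refine lpSum_mono p fun m => ?_
  have : eLpNorm (fun x => c * (⨆ z : Qo j (cIdx j x), P j z) * ‖t k x‖ₑ) p (volume.restrict (Qo j m)) =
    eLpNorm (fun x => c * (⨆ z : Qo j m, P j z) * ‖t k x‖ₑ) p (volume.restrict (Qo j m)) := by
    refine eLpNorm_congr_ae ?_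
    filter_upwards [ae_restrict_mem (measurableSet_Qo j m)] with x hx
    have hx' : cIdx j x = m := hx
    rw [hx']
  rw [this]
  refine (eLpNorm_const_mul_le hp _ _ (htm k).enorm).trans ?_
  rw [eLpNorm_enorm_eq]
  have h3 := (eLpNorm_mono_measure (t k) (Measure.restrict_mono (Qo_sub j m) (le_refl volume))).trans (h m)
  calc _ ≤ (c * ⨆ z : Qo j m, P j z) * (c' * tkm n p t j m) := by gcongr
    _ = _ := by ring

theorem step2 {n : ℕ} {p : ℝ≥0∞} (hp : 0 < p) {t : ℕ → (Fin n → ℝ) → ℝ} {s : ℕ} {α₂ C₂ : ℝ} (hC₂ : 0 < C₂)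
    (hs : α₂ < s) (htm : ∀ j, Measurable (t j)) (P V : ℕ → (Fin n → ℝ) → ℝ≥0∞) (K : ℝ≥0∞)
    (h : ∀ j k, j ≤ k → ∀ m, eLpNorm (t k) p (volume.restrict (dyadicCube n j m)) ≤
      ENNReal.ofReal (C₂ * 2 ^ (α₂ * ((k : ℝ) - (j : ℝ)))) * tkm n p t j m)
    (hV : ∀ k x, V k x ≤ K * ∑ j ∈ Finset.range (k + 1), (2⁻¹ : ℝ≥0∞) ^ ((k - j) * s) * P j x)
    {y : ℝ≥0∞} (hy : y = ENNReal.ofReal (2 ^ (-((s - α₂) / 3)))) (k : ℕ) :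
    eLpNorm (fun x => ‖t k x‖ₑ * V k x) p volume ≤
      K * (∑' l : ℕ, y ^ l) * (Wc p y * ENNReal.ofReal C₂) * ⨆ j : ℕ, y ^ ((k : ℤ) - j).natAbs * Dj p t P j := by
  set Z := ∑' l : ℕ, y ^ l with hZ
  set a := ENNReal.ofReal (2 ^ (-α₂)) with ha
  set T : ℕ → (Fin n → ℝ) → ℝ≥0∞ := fun j x => ⨆ z : Qo j (cIdx j x), P j z with hT
  have hTm : ∀ j, Measurable (T j) := fun j =>
    (measurable_of_countable (fun m : Fin n → ℤ => ⨆ z : Qo j m, P j z)).comp (measurable_cIdx j)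
  set hh : ℕ → (Fin n → ℝ) → ℝ≥0∞ := fun j x =>
    if j ≤ k then (y * a) ^ (k - j) * T j x * ‖t k x‖ₑ else 0 with hhh
  have hhm : ∀ j, Measurable (hh j) := by
    intro j
    by_cases hj : j ≤ k
    · simp only [hhh, hj, if_true]
      exact ((hTm j).const_mul _).mul (htm k).enorm
    · simp only [hhh, hj, if_false]
      exact measurable_const
  have hpt : ∀ x, ‖t k x‖ₑ * V k x ≤ K * Z * ⨆ j : ℕ, y ^ ((k : ℤ) - j).natAbs * hh j x := by
    intro x
    set S := ⨆ j : ℕ, y ^ ((k : ℤ) - j).natAbs * hh j x with hS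
    have h1 : ∀ j ∈ Finset.range (k + 1), ‖t k x‖ₑ * ((2⁻¹ : ℝ≥0∞) ^ ((k - j) * s) * P j x) ≤ y ^ (k - j) * S := by
      intro j hj
      have hj' : j ≤ k := by simp at hj; omega
      have hP : P j x ≤ T j x := le_iSup (fun z : Qo j (cIdx j x) => P j z) ⟨x, mem_Qo j x⟩
      have e1 : (2⁻¹ : ℝ≥0∞) ^ ((k - j) * s) = y ^ (k - j) * (y ^ (k - j) * (y * a) ^ (k - j)) := by
        rw [← mul_pow, ← mul_pow, mul_comm (k - j) s, pow_mul, half_pow_eq]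
        congr 1
        rw [hy, ha, ← ENNReal.ofReal_mul (by positivity), ← ENNReal.ofReal_mul (by positivity),
          ← ENNReal.ofReal_mul (by positivity), ← Real.rpow_add (by norm_num), ← Real.rpow_add (by norm_num),
          ← Real.rpow_add (by norm_num)]
        congr 2; ring
      have e2 : y ^ (k - j) * hh j x ≤ S := by
        refine le_trans (le_of_eq ?_) (le_iSup (fun j : ℕ => y ^ ((k : ℤ) - j).natAbs * hh j x) j)
        congr 2; omega
      rw [e1]
      calc _ ≤ ‖t k x‖ₑ * (y ^ (k - j) * (y ^ (k - j) * (y * a) ^ (k - j)) * T j x) := by gcongr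
        _ = y ^ (k - j) * (y ^ (k - j) * hh j x) := by simp only [hhh, hj', if_true]; ring
        _ ≤ _ := by gcongr
    calc _ ≤ ‖t k x‖ₑ * (K * ∑ j ∈ Finset.range (k + 1), (2⁻¹ : ℝ≥0∞) ^ ((k - j) * s) * P j x) := by gcongr; exact hV k x
      _ = K * ∑ j ∈ Finset.range (k + 1), ‖t k x‖ₑ * ((2⁻¹ : ℝ≥0∞) ^ ((k - j) * s) * P j x) := by
        rw [mul_left_comm, Finset.mul_sum]
      _ ≤ K * ∑ j ∈ Finset.range (k + 1), y ^ (k - j) * S := by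
        exact mul_le_mul' le_rfl (Finset.sum_le_sum h1)
      _ = K * ((∑ j ∈ Finset.range (k + 1), y ^ j) * S) := by
        rw [← Finset.sum_mul, ← Finset.sum_range_reflect (fun j => y ^ j)]
        congr 3
      _ ≤ K * (Z * S) := by
        gcongr; exact ENNReal.sum_le_tsum _
      _ = _ := by ring
  calc _ ≤ eLpNorm (fun x => K * Z * ⨆ j : ℕ, y ^ ((k : ℤ) - j).natAbs * hh j x) p volume :=
        eLpNorm_mono_enorm fun x => by simpa using hpt x
    _ ≤ K * Z * eLpNorm (fun x => ⨆ j : ℕ, y ^ ((k : ℤ) - j).natAbs * hh j x) p volume :=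
        eLpNorm_const_mul_le hp _ _ (Measurable.iSup fun j => (hhm j).const_mul _)
    _ ≤ K * Z * (Wc p y * ⨆ j, eLpNorm (hh j) p volume) := by
        gcongr
        refine (eLpNorm_S hp _ _ hhm).trans ?_
        gcongr
        exact lpSum_nat_le_Wc' p y k
    _ ≤ K * Z * (Wc p y * ⨆ j : ℕ, ENNReal.ofReal C₂ * (y ^ ((k : ℤ) - j).natAbs * Dj p t P j)) := by
        gcongr with j
        by_cases hj : j ≤ k
        · simp only [hhh, hj, if_true]
          refine (step2_term hp _ _ htm P (h j k hj)).trans (le_of_eq ?_)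
          have e3 : ((k : ℤ) - j).natAbs = k - j := by omega
          have e4 : a ^ (k - j) * ENNReal.ofReal (C₂ * 2 ^ (α₂ * ((k : ℝ) - (j : ℝ)))) = ENNReal.ofReal C₂ := by
            rw [ha, ← ENNReal.ofReal_pow (by positivity), ← ENNReal.ofReal_mul (by positivity),
              ← Real.rpow_natCast, ← Real.rpow_mul (by norm_num), mul_left_comm, ← Real.rpow_add (by norm_num),
              Nat.cast_sub hj]
            congr 1
            rw [show -α₂ * ((k : ℝ) - j) + α₂ * (k - j) = 0 by ring]; simp
          rw [e3, mul_pow, ← e4]; ring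
        · simp only [hhh, hj, if_false]
          simp
    _ = _ := by rw [← ENNReal.mul_iSup]; ring

theorem abstract_est {n : ℕ} (p q σ₁ σ₂ : ℝ≥0∞) (α₁ α₂ α₃ : ℝ)
    (hp : 0 < p) (hq : 0 < q) (hσ₁ : 0 < σ₁) (hα₃ : 0 ≤ α₃)
    (t : ℕ → (Fin n → ℝ) → ℝ) (ht : MemX n p σ₁ σ₂ α₁ α₂ α₃ t)
    (hσ₂p : p ≤ σ₂) (s : ℕ) (hs : α₂ < s) :
    ∃ (A : ℕ) (B rr : ℝ), 0 ≤ B ∧ 0 < rr ∧ rr ≤ 1 ∧ ∀ K : ℝ≥0∞, K ≠ ∞ → ∃ C : ℝ≥0∞, C ≠ ∞ ∧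
      ∀ (g : ℕ → (Fin n → ℝ) → ℝ) (V : ℕ → (Fin n → ℝ) → ℝ≥0∞), (∀ k, Continuous (g k)) →
      (∀ j x, PM A B (fun k y => ‖g k y‖ₑ) j x ^ rr ≤ K * IM A B rr (fun k y => ‖g k y‖ₑ) j x) →
      (∀ k x, V k x ≤ K * ∑ j ∈ Finset.range (k + 1), (2⁻¹ : ℝ≥0∞) ^ ((k - j) * s) *
        PM A B (fun k y => ‖g k y‖ₑ) j x) →
      lqNorm q (fun k => eLpNorm (fun x => ‖t k x‖ₑ * V k x) p volume) ≤
        C * lqNorm q (fun k => eLpNorm (fun x => t k x * g k x) p volume) := by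
  obtain ⟨⟨htm, htp, -⟩, ⟨C₁, hC₁, h1⟩, ⟨C₂, hC₂, h2⟩, -, h4⟩ := ht
  set σ := min σ₁ 1 with hσdef
  have hσ : 0 < σ := lt_min hσ₁ one_pos
  have hσ1 : σ ≤ 1 := min_le_right _ _
  set r : ℝ≥0∞ := (p⁻¹ + σ⁻¹)⁻¹ with hr
  have : HolderTriple p σ r := ⟨by rw [hr, inv_inv]⟩
  have hr1 : r ≤ 1 := by
    rw [hr, ENNReal.inv_le_one]
    exact (ENNReal.one_le_inv.2 hσ1).trans le_add_self
  have hrt : r ≠ ∞ := ne_top_of_le_ne_top one_ne_top hr1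
  have hr0 : 0 < r := by
    rw [hr, ENNReal.inv_pos]
    exact ENNReal.add_ne_top.2 ⟨ENNReal.inv_ne_top.2 hp.ne', ENNReal.inv_ne_top.2 hσ.ne'⟩
  have hrr : 0 < r.toReal := ENNReal.toReal_pos hr0.ne' hrt
  obtain ⟨A, hA⟩ := exists_nat_ge (n / r.toReal - α₁ + 3)
  set B := (α₃ + 2) * Real.log 2 with hB
  refine ⟨A, B, r.toReal, mul_nonneg (by linarith) (Real.log_nonneg (by norm_num)), hrr, ?_, ?_⟩
  · rw [← ENNReal.toReal_one]; exact ENNReal.toReal_mono one_ne_top hr1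
  intro K hK
  set y := ENNReal.ofReal (2 ^ (-(((s : ℝ) - α₂) / 3))) with hy
  have hy1 : y < 1 := by
    rw [hy, ENNReal.ofReal_lt_one]
    exact Real.rpow_lt_one_of_one_lt_of_neg (by norm_num) (by linarith)
  have hhalf : (2⁻¹ : ℝ≥0∞) < 1 := by simp
  set c1 := (K * Zc n r.toReal) ^ (r.toReal)⁻¹ * (ENNReal.ofReal (2 ^ (α₃ + 2)) * ENNReal.ofReal C₁) with hc1
  set c2 := c1 * (lpSum p (fun l : ℕ => (2⁻¹ : ℝ≥0∞) ^ l) * lpSum p (fun m : Fin n → ℤ => (2⁻¹ : ℝ≥0∞) ^ zn m)) with hc2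
  set c3 := K * (∑' l : ℕ, y ^ l) * (Wc p y * ENNReal.ofReal C₂) with hc3
  have hc1t : c1 ≠ ∞ := by
    refine ENNReal.mul_ne_top (ENNReal.rpow_ne_top_of_nonneg (by positivity)
      (ENNReal.mul_ne_top hK (Zc_ne_top n hrr))) (by finiteness)
  have hc2t : c2 ≠ ∞ := ENNReal.mul_ne_top hc1t (ENNReal.mul_ne_top (lpSum_nat_ne_top hp hhalf)
    (lpSum_lattice_ne_top n hp hhalf))
  have hc3t : c3 ≠ ∞ := ENNReal.mul_ne_top (ENNReal.mul_ne_top hK (tsum_geom_ne_top hy1))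
    (ENNReal.mul_ne_top (Wc_ne_top hp hy1) (by finiteness))
  refine ⟨c3 * (Wc q y * (c2 * Wc q 2⁻¹)), ENNReal.mul_ne_top hc3t (ENNReal.mul_ne_top (Wc_ne_top hq hy1)
    (ENNReal.mul_ne_top hc2t (Wc_ne_top hq hhalf))), ?_⟩
  intro g V hg hPM hV
  set P : ℕ → (Fin n → ℝ) → ℝ≥0∞ := PM A B (fun k y => ‖g k y‖ₑ) with hP
  have hD : ∀ j, Dj p t P j ≤ c2 * ⨆ i : ℕ, (2⁻¹ : ℝ≥0∞) ^ ((j : ℤ) - i).natAbs * eLpNorm (fun x => t i x * g i x) p volume := by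
    intro j
    refine (disc_lp hp g P j c1 ?_).trans ?_
    · intro m x hx
      exact disc_point hr0 hrt hp hσ hα₃ hC₁ hA htm htp
        (fun k j hkj m => cond_i_small (min_le_left _ _) (htm j) (h1 k j hkj m)) h4 g hg hx (hPM j x)
    · refine mul_le_mul' le_rfl ?_
      refine iSup_le fun l => le_trans (le_of_eq ?_) (le_iSup (fun i : ℕ => (2⁻¹ : ℝ≥0∞) ^ ((j : ℤ) - i).natAbs * eLpNorm (fun x => t i x * g i x) p volume) (j + l))
      congr 2; push_cast; omega
  have hS := step2 hp hC₂ hs htm P V K (fun j k hjk m => cond_ii_p hσ₂p (htm k) (h2 j k hjk m)) hV hy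
  rw [lqNorm_eq, lqNorm_eq]
  calc _ ≤ lpSum q (fun k : ℕ => c3 * ⨆ j : ℕ, y ^ ((k : ℤ) - j).natAbs * Dj p t P j) := lpSum_mono q hS
    _ = c3 * lpSum q (fun k : ℕ => ⨆ j : ℕ, y ^ ((k : ℤ) - j).natAbs * Dj p t P j) := lpSum_const_mul hq _ _
    _ ≤ c3 * (Wc q y * lpSum q (fun j => Dj p t P j)) := by
      gcongr
      exact lpSum_W hq (fun (k j : ℕ) => y ^ ((k : ℤ) - j).natAbs) _ _ (fun j => lpSum_nat_le_Wc q y j)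
    _ ≤ c3 * (Wc q y * lpSum q (fun j : ℕ => c2 * ⨆ i : ℕ, (2⁻¹ : ℝ≥0∞) ^ ((j : ℤ) - i).natAbs * eLpNorm (fun x => t i x * g i x) p volume)) := by
      gcongr
      exact lpSum_mono q hD
    _ ≤ c3 * (Wc q y * (c2 * (Wc q 2⁻¹ * lpSum q (fun i => eLpNorm (fun x => t i x * g i x) p volume)))) := by
      gcongr
      rw [lpSum_const_mul hq]
      gcongr
      exact lpSum_W hq (fun (k j : ℕ) => (2⁻¹ : ℝ≥0∞) ^ ((k : ℤ) - j).natAbs) _ _ (fun j => lpSum_nat_le_Wc q _ j)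
    _ = _ := by ring

/-- Vector valued convolution with a scalar kernel. -/
def cvv {n : ℕ} {F : Type*} [NormedAddCommGroup F] [NormedSpace ℝ F] (g : (Fin n → ℝ) → ℝ)
    (θ : (Fin n → ℝ) → F) (y : Fin n → ℝ) : F := ∫ t, g t • θ (y - t)

theorem cvv_eq {n : ℕ} {F : Type*} [NormedAddCommGroup F] [NormedSpace ℝ F] (g : (Fin n → ℝ) → ℝ)
    (θ : (Fin n → ℝ) → F) : cvv g θ = MeasureTheory.convolution g θ (ContinuousLinearMap.lsmul ℝ ℝ) volume := rfl

theorem fderiv_cvv {n : ℕ} {F : Type*} [NormedAddCommGroup F] [NormedSpace ℝ F] [CompleteSpace F]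
    {g : (Fin n → ℝ) → ℝ} {θ : (Fin n → ℝ) → F} (hg : Continuous g) (hθ : ContDiff ℝ 1 θ)
    (hc : HasCompactSupport θ) : fderiv ℝ (cvv g θ) = cvv g (fderiv ℝ θ) := by
  funext y
  rw [cvv_eq, (hc.hasFDerivAt_convolution_right (ContinuousLinearMap.lsmul ℝ ℝ) (μ := volume)
    hg.locallyIntegrable hθ y).fderiv]
  unfold MeasureTheory.convolution cvv
  congr 1

theorem isoInt {n : ℕ} {E F : Type*} [NormedAddCommGroup E] [NormedSpace ℝ E] [NormedAddCommGroup F] [NormedSpace ℝ F]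
    (I : E ≃ₗᵢ[ℝ] F) (φ : (Fin n → ℝ) → E) : ∫ t, I (φ t) = I (∫ t, φ t) :=
  ContinuousLinearEquiv.integral_comp_comm I.toContinuousLinearEquiv φ

theorem iter_cvv {n : ℕ} {F : Type*} [NormedAddCommGroup F] [NormedSpace ℝ F] [CompleteSpace F]
    {g : (Fin n → ℝ) → ℝ} {θ : (Fin n → ℝ) → F} (hg : Continuous g) (hθ : ContDiff ℝ (⊤ : ℕ∞) θ)
    (hc : HasCompactSupport θ) (i : ℕ) :
    iteratedFDeriv ℝ i (cvv g θ) = cvv g (iteratedFDeriv ℝ i θ) := by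
  induction i with
  | zero =>
    funext y
    rw [iteratedFDeriv_zero_eq_comp, iteratedFDeriv_zero_eq_comp]
    simp only [Function.comp_apply, cvv]
    set I := (continuousMultilinearCurryFin0 ℝ (Fin n → ℝ) F).symm with hI
    refine (ContinuousLinearEquiv.integral_comp_comm I.toContinuousLinearEquiv _).symm.trans ?_
    congr 1
  | succ i ih =>
    have hcd : ContDiff ℝ 1 (iteratedFDeriv ℝ i θ) :=
      hθ.iteratedFDeriv_right (by norm_cast; exact le_top)
    rw [iteratedFDeriv_succ_eq_comp_left, iteratedFDeriv_succ_eq_comp_left, ih,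
      fderiv_cvv hg hcd (hc.iteratedFDeriv i)]
    funext y
    simp only [Function.comp_apply, cvv]
    set I := (continuousMultilinearCurryLeftEquiv ℝ (fun _ : Fin (i + 1) => Fin n → ℝ) F).symm with hI
    refine (isoInt I (fun t => g t • fderiv ℝ (iteratedFDeriv ℝ i θ) (y - t))).symm.trans ?_
    congr 1

theorem integrable_test {n : ℕ} {F : Type*} [NormedAddCommGroup F] [NormedSpace ℝ F]
    {g : (Fin n → ℝ) → ℝ} {θ : (Fin n → ℝ) → F} (hg : Continuous g) (hgc : HasCompactSupport g)
    (hθ : Continuous θ) (y : Fin n → ℝ) : Integrable (fun t => g t • θ (y - t)) volume :=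
  Continuous.integrable_of_hasCompactSupport (by fun_prop) (hgc.smul_right)

theorem norm_cvv_le {n : ℕ} {F : Type*} [NormedAddCommGroup F] [NormedSpace ℝ F]
    {g : (Fin n → ℝ) → ℝ} {θ : (Fin n → ℝ) → F} (hg : Continuous g) (hgc : HasCompactSupport g)
    {K : ℝ} (hK : ∀ y, ‖θ y‖ ≤ K) (y : Fin n → ℝ) : ‖cvv g θ y‖ ≤ (∫ t, |g t|) * K := by
  unfold cvv
  have hi : Integrable (fun t => |g t| * K) volume := by
    refine Integrable.mul_const ?_ _
    exact (hg.integrable_of_hasCompactSupport hgc).abs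
  refine (norm_integral_le_of_norm_le hi (Eventually.of_forall fun t => ?_)).trans (le_of_eq ?_)
  · rw [norm_smul, Real.norm_eq_abs]
    exact mul_le_mul_of_nonneg_left (hK _) (abs_nonneg _)
  · rw [integral_mul_const]

theorem support_cvv {n : ℕ} {F : Type*} [NormedAddCommGroup F] [NormedSpace ℝ F]
    {g : (Fin n → ℝ) → ℝ} {θ : (Fin n → ℝ) → F} {x : Fin n → ℝ} {ρ ρ0 : ℝ}
    (hg : Function.support g ⊆ Metric.closedBall 0 ρ) (hθ : Function.support θ ⊆ Metric.closedBall x ρ0) :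
    Function.support (cvv g θ) ⊆ Metric.closedBall x (ρ0 + ρ) := by
  intro y hy
  have : ∃ t, g t • θ (y - t) ≠ 0 := by
    by_contra hh
    push Not at hh
    apply hy
    simp [cvv, hh]
  obtain ⟨t, ht⟩ := this
  have h1 : g t ≠ 0 := fun h => ht (by simp [h])
  have h2 : θ (y - t) ≠ 0 := fun h => ht (by simp [h])
  have h3 := hg h1
  have h4 := hθ h2
  rw [Metric.mem_closedBall, dist_eq_norm] at *
  calc ‖y - x‖ = ‖(y - t - x) + (t - 0)‖ := by congr 1; abel
    _ ≤ _ := (norm_add_le _ _).trans (add_le_add h4 h3)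

theorem IsTestFun.cont {n : ℕ} {g : (Fin n → ℝ) → ℝ} (h : IsTestFun n g) : Continuous g := h.1.continuous

theorem IsTestFun.ball {n : ℕ} {g : (Fin n → ℝ) → ℝ} (h : IsTestFun n g) :
    ∃ R : ℝ, 0 < R ∧ Function.support g ⊆ Metric.closedBall 0 R := by
  obtain ⟨R, hR⟩ := h.2.isCompact.isBounded.subset_closedBall 0
  exact ⟨max R 1, by positivity, (subset_tsupport g).trans (hR.trans (Metric.closedBall_subset_closedBall (le_max_left _ _)))⟩

theorem hasCompactSupport_of_ball {n : ℕ} {F : Type*} [Zero F] {g : (Fin n → ℝ) → F} {x : Fin n → ℝ} {R : ℝ}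
    (h : Function.support g ⊆ Metric.closedBall x R) : HasCompactSupport g :=
  HasCompactSupport.of_support_subset_isCompact (isCompact_closedBall x R) h

theorem cvv_test {n : ℕ} {g θ : (Fin n → ℝ) → ℝ} (hg : IsTestFun n g) (hθ : IsTestFun n θ) :
    IsTestFun n (cvv g θ) := by
  constructor
  · rw [cvv_eq]
    exact hθ.2.contDiff_convolution_right (ContinuousLinearMap.lsmul ℝ ℝ) (μ := volume) hg.cont.locallyIntegrable hθ.1
  · obtain ⟨R, _, hR⟩ := hg.ball
    obtain ⟨R', _, hR'⟩ := hθ.ball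
    exact hasCompactSupport_of_ball (support_cvv hR hR')

def TF (n : ℕ) : Submodule ℝ ((Fin n → ℝ) → ℝ) where
  carrier := {g | IsTestFun n g}
  add_mem' := fun ha hb => ⟨ha.1.add hb.1, ha.2.add hb.2⟩
  zero_mem' := ⟨contDiff_const, HasCompactSupport.zero⟩
  smul_mem' := fun c g hg => ⟨contDiff_const.smul hg.1, hg.2.smul_left (f := fun _ => c)⟩

def cv {n : ℕ} (g : TF n) : Module.End ℝ (TF n) where
  toFun θ := ⟨cvv g.1 θ.1, cvv_test g.2 θ.2⟩
  map_add' θ θ' := by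
    ext y
    simp only [cvv, Submodule.coe_add, Pi.add_apply, smul_add]
    exact integral_add (integrable_test (IsTestFun.cont g.2) g.2.2 (IsTestFun.cont θ.2) y)
      (integrable_test (IsTestFun.cont g.2) g.2.2 (IsTestFun.cont θ'.2) y)
  map_smul' c θ := by
    ext y
    simp only [cvv, Submodule.coe_smul, Pi.smul_apply, RingHom.id_apply]
    rw [← integral_smul]
    congr 1
    funext t
    simp; ring

theorem cv_apply {n : ℕ} (g θ : TF n) (y : Fin n → ℝ) : (cv g θ).1 y = cvv g.1 θ.1 y := rfl

theorem cvv_assoc {n : ℕ} {g h θ : (Fin n → ℝ) → ℝ} (hg : IsTestFun n g) (hh : IsTestFun n h) (hθ : IsTestFun n θ) :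
    cvv (cvv g h) θ = cvv g (cvv h θ) := by
  funext x
  simp only [cvv_eq]
  refine convolution_assoc _ _ _ _ (fun a b c => by simp [mul_assoc]) hg.cont.aestronglyMeasurable
    hh.cont.aestronglyMeasurable hθ.cont.aestronglyMeasurable ?_ ?_ ?_
  · exact Eventually.of_forall fun y => hh.2.convolutionExists_right _ hg.cont.locallyIntegrable hh.cont y
  · exact Eventually.of_forall fun y => hθ.2.norm.convolutionExists_right _ hh.cont.norm.locallyIntegrable hθ.cont.norm y
  · refine HasCompactSupport.convolutionExists_right _ ?_ hg.cont.norm.locallyIntegrable ?_ x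
    · exact HasCompactSupport.convolution _ hh.2.norm hθ.2.norm
    · exact hθ.2.norm.continuous_convolution_right _ hh.cont.norm.locallyIntegrable hθ.cont.norm

theorem cvv_comm {n : ℕ} (g h : (Fin n → ℝ) → ℝ) : cvv g h = cvv h g := by
  rw [cvv_eq, ← convolution_flip, cvv_eq]
  congr 1
  ext a
  simp

theorem cv_commute {n : ℕ} (g h : TF n) : Commute (cv g) (cv h) := by
  refine LinearMap.ext fun θ => ?_
  refine Subtype.ext ?_
  change cvv g.1 (cvv h.1 θ.1) = cvv h.1 (cvv g.1 θ.1)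
  rw [← cvv_assoc g.2 h.2 θ.2, cvv_comm g.1 h.1, cvv_assoc h.2 g.2 θ.2]

/-- Operator bound: `T` enlarges supports by at most `ρ`, and costs `s` derivatives with constant `K`. -/
def OpB {n : ℕ} (T : Module.End ℝ (TF n)) (ρ : ℝ) (s : ℕ) (K : ℝ) : Prop :=
  (∀ (θ : TF n) (x : Fin n → ℝ) (ρ0 : ℝ), Function.support θ.1 ⊆ Metric.closedBall x ρ0 →
    Function.support (T θ).1 ⊆ Metric.closedBall x (ρ0 + ρ)) ∧
  (∀ (θ : TF n) (i : ℕ) (K0 : ℝ), (∀ y, ‖iteratedFDeriv ℝ (i + s) θ.1 y‖ ≤ K0) →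
    ∀ y, ‖iteratedFDeriv ℝ i (T θ).1 y‖ ≤ K * K0)

theorem OpB.mul {n : ℕ} {T T' : Module.End ℝ (TF n)} {ρ ρ' : ℝ} {s s' : ℕ} {K K' : ℝ}
    (h : OpB T ρ s K) (h' : OpB T' ρ' s' K') : OpB (T * T') (ρ + ρ') (s + s') (K * K') := by
  constructor
  · intro θ x ρ0 h0
    have := h.1 _ x _ (h'.1 θ x ρ0 h0)
    rwa [add_assoc, add_comm ρ' ρ] at this
  · intro θ i K0 h0 y
    rw [mul_assoc]
    refine h.2 (T' θ) i (K' * K0) (h'.2 θ (i + s) K0 ?_) y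
    rwa [add_assoc]

theorem OpB.weaken {n : ℕ} {T : Module.End ℝ (TF n)} {ρ ρ' : ℝ} {s : ℕ} {K K' : ℝ}
    (h : OpB T ρ s K) (hρ : ρ ≤ ρ') (hK : K ≤ K') : OpB T ρ' s K' := by
  constructor
  · intro θ x ρ0 h0
    exact (h.1 θ x ρ0 h0).trans (Metric.closedBall_subset_closedBall (by linarith))
  · intro θ i K0 h0 y
    have : 0 ≤ K0 := (norm_nonneg _).trans (h0 y)
    exact (h.2 θ i K0 h0 y).trans (by gcongr)

theorem iter_add {n : ℕ} (θ θ' : TF n) (i : ℕ) (y : Fin n → ℝ) :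
    iteratedFDeriv ℝ i (θ + θ').1 y = iteratedFDeriv ℝ i θ.1 y + iteratedFDeriv ℝ i θ'.1 y := by
  have := iteratedFDeriv_add_apply (𝕜 := ℝ) (i := i) (x := y)
    ((θ.2.1.of_le (by norm_cast; exact le_top) : ContDiff ℝ i θ.1).contDiffAt)
    ((θ'.2.1.of_le (by norm_cast; exact le_top) : ContDiff ℝ i θ'.1).contDiffAt)
  exact this

theorem OpB.add {n : ℕ} {T T' : Module.End ℝ (TF n)} {ρ : ℝ} {s : ℕ} {K K' : ℝ}
    (h : OpB T ρ s K) (h' : OpB T' ρ s K') : OpB (T + T') ρ s (K + K') := by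
  constructor
  · intro θ x ρ0 h0
    refine (Function.support_add _ _).trans (Set.union_subset (h.1 θ x ρ0 h0) (h'.1 θ x ρ0 h0))
  · intro θ i K0 h0 y
    rw [LinearMap.add_apply, iter_add, add_mul]
    exact (norm_add_le _ _).trans (add_le_add (h.2 θ i K0 h0 y) (h'.2 θ i K0 h0 y))

theorem OpB.zero {n : ℕ} {ρ : ℝ} {s : ℕ} : OpB (0 : Module.End ℝ (TF n)) ρ s 0 := by
  constructor
  · intro θ x ρ0 h0
    simp
  · intro θ i K0 h0 y
    have : ((0 : TF n).1) = (0 : (Fin n → ℝ) → ℝ) := rfl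
    rw [LinearMap.zero_apply, this]
    simp

theorem OpB.one {n : ℕ} : OpB (1 : Module.End ℝ (TF n)) 0 0 1 := by
  constructor
  · intro θ x ρ0 h0
    simpa using h0
  · intro θ i K0 h0 y
    simpa using h0 y

theorem OpB.sum {n m : ℕ} {T : ℕ → Module.End ℝ (TF n)} {ρ : ℝ} {s : ℕ} {K : ℝ}
    (h : ∀ i < m, OpB (T i) ρ s K) : OpB (∑ i ∈ Finset.range m, T i) ρ s (m * K) := by
  induction m with
  | zero => simpa using OpB.zero
  | succ m ih =>
    rw [Finset.sum_range_succ]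
    have := (ih fun i hi => h i (by omega)).add (h m (by omega))
    refine this.weaken le_rfl (le_of_eq ?_)
    push_cast; ring

theorem OpB.pow {n : ℕ} {T : Module.End ℝ (TF n)} {ρ : ℝ} {s : ℕ} {K : ℝ} (h : OpB T ρ s K) (m : ℕ) :
    OpB (T ^ m) (m * ρ) (m * s) (K ^ m) := by
  induction m with
  | zero => simpa using OpB.one
  | succ m ih =>
    rw [pow_succ, pow_succ]
    have := ih.mul h
    rw [show ((m + 1 : ℕ) : ℝ) * ρ = m * ρ + ρ by push_cast; ring, show (m + 1) * s = m * s + s by ring]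
    exact this

theorem OpB.cv {n : ℕ} (g : TF n) {ρ : ℝ} (hg : Function.support g.1 ⊆ Metric.closedBall 0 ρ) :
    OpB (cv g) ρ 0 (∫ t, |g.1 t|) := by
  constructor
  · intro θ x ρ0 h0
    exact support_cvv hg h0
  · intro θ i K0 h0 y
    have : (_root_.cv g θ).1 = cvv g.1 θ.1 := rfl
    rw [this, iter_cvv (IsTestFun.cont g.2) θ.2.1 θ.2.2]
    exact norm_cvv_le (IsTestFun.cont g.2) g.2.2 h0 y

theorem lip_iter {n : ℕ} (θ : TF n) (i : ℕ) {K0 : ℝ} (h0 : ∀ y, ‖iteratedFDeriv ℝ (i + 1) θ.1 y‖ ≤ K0)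
    (y z : Fin n → ℝ) : ‖iteratedFDeriv ℝ i θ.1 y - iteratedFDeriv ℝ i θ.1 z‖ ≤ K0 * ‖y - z‖ := by
  refine Convex.norm_image_sub_le_of_norm_fderiv_le (𝕜 := ℝ) (s := Set.univ) (fun w _ => ?_) (fun w _ => ?_)
    convex_univ (Set.mem_univ z) (Set.mem_univ y)
  · have : Differentiable ℝ (iteratedFDeriv ℝ i θ.1) :=
      θ.2.1.differentiable_iteratedFDeriv (by norm_cast; exact ENat.coe_lt_top i)
    exact this w
  · rw [norm_fderiv_iteratedFDeriv]; exact h0 w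

theorem OpB.one_sub_cv {n : ℕ} (g : TF n) {ρ : ℝ} (hρ : 0 ≤ ρ) (hg : Function.support g.1 ⊆ Metric.closedBall 0 ρ)
    (h1 : ∫ t, g.1 t = 1) : OpB (1 - _root_.cv g) ρ 1 ((∫ t, |g.1 t|) * ρ) := by
  constructor
  · intro θ x ρ0 h0
    refine (Function.support_sub _ _).trans (Set.union_subset (h0.trans
      (Metric.closedBall_subset_closedBall (by linarith))) (support_cvv hg h0))
  · intro θ i K0 h0 y
    have e1 : ((1 - _root_.cv g : Module.End ℝ (TF n)) θ).1 = (θ + (-1 : ℝ) • _root_.cv g θ).1 := by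
      simp [sub_eq_add_neg]
    have e2 : iteratedFDeriv ℝ i ((-1 : ℝ) • _root_.cv g θ).1 y = (-1 : ℝ) • iteratedFDeriv ℝ i (_root_.cv g θ).1 y := by
      exact iteratedFDeriv_const_smul_apply (a := (-1 : ℝ)) ((_root_.cv g θ).2.1.of_le (by norm_cast; exact le_top) : ContDiff ℝ i _).contDiffAt
    have e3 : (_root_.cv g θ).1 = cvv g.1 θ.1 := rfl
    have hc : Continuous (iteratedFDeriv ℝ i θ.1) := θ.2.1.continuous_iteratedFDeriv (by norm_cast; exact le_top)
    rw [e1, iter_add, e2, e3, iter_cvv (IsTestFun.cont g.2) θ.2.1 θ.2.2]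
    have e4 : iteratedFDeriv ℝ i θ.1 y + (-1 : ℝ) • cvv g.1 (iteratedFDeriv ℝ i θ.1) y =
        ∫ t, g.1 t • (iteratedFDeriv ℝ i θ.1 y - iteratedFDeriv ℝ i θ.1 (y - t)) := by
      simp_rw [smul_sub]
      rw [integral_sub _ (integrable_test (IsTestFun.cont g.2) g.2.2 hc y), integral_smul_const, h1]
      · simp [cvv, sub_eq_add_neg]
      · exact ((IsTestFun.cont g.2).integrable_of_hasCompactSupport g.2.2).smul_const _
    rw [e4]
    have hi : Integrable (fun t => |g.1 t| * (ρ * K0)) volume :=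
      (((IsTestFun.cont g.2).integrable_of_hasCompactSupport g.2.2).abs).mul_const _
    refine (norm_integral_le_of_norm_le hi (Eventually.of_forall fun t => ?_)).trans (le_of_eq ?_)
    · rw [norm_smul, Real.norm_eq_abs]
      by_cases ht : g.1 t = 0
      · simp [ht]
      · refine mul_le_mul_of_nonneg_left ?_ (abs_nonneg _)
        refine (lip_iter θ i h0 y (y - t)).trans ?_
        have hK0 : 0 ≤ K0 := (norm_nonneg _).trans (h0 y)
        have : ‖t‖ ≤ ρ := by simpa using hg ht
        have e : y - (y - t) = t := by abel
        rw [e, mul_comm]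
        gcongr
    · rw [integral_mul_const]; ring

theorem cv_sub {n : ℕ} (g h : TF n) : cv (g - h) = cv g - cv h := by
  refine LinearMap.ext fun θ => Subtype.ext ?_
  funext y
  change cvv (g - h).1 θ.1 y = cvv g.1 θ.1 y - cvv h.1 θ.1 y
  unfold cvv
  rw [← integral_sub (integrable_test (IsTestFun.cont g.2) g.2.2 (IsTestFun.cont θ.2) y)
    (integrable_test (IsTestFun.cont h.2) h.2.2 (IsTestFun.cont θ.2) y)]
  congr 1
  funext t
  simp [sub_mul]

/-- translation -/
def tr {n : ℕ} (x : Fin n → ℝ) (θ : TF n) : TF n :=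
  ⟨fun y => θ.1 (y - x), θ.2.1.comp (contDiff_id.sub contDiff_const),
    θ.2.2.comp_homeomorph (Homeomorph.subRight x)⟩

theorem cv_tr {n : ℕ} (g θ : TF n) (x : Fin n → ℝ) : cv g (tr x θ) = tr x (cv g θ) := by
  refine Subtype.ext (funext fun y => ?_)
  change ∫ t, g.1 t • θ.1 (y - t - x) = ∫ t, g.1 t • θ.1 (y - x - t)
  simp_rw [sub_right_comm]

theorem cv_swap {n : ℕ} (g h : TF n) : cv g h = cv h g := Subtype.ext (cvv_comm g.1 h.1)

/-- reflected dilates -/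
def psi {n : ℕ} (φ : TF n) (j : ℕ) : TF n :=
  ⟨fun t => 2 ^ (j * n) * φ.1 (-((2 : ℝ) ^ j • t)), by
    constructor
    · refine contDiff_const.mul (φ.2.1.comp ?_)
      fun_prop
    · refine HasCompactSupport.mul_left ?_
      have h2 : (2 : ℝ) ^ j ≠ 0 := by positivity
      exact φ.2.2.comp_homeomorph ((Homeomorph.smulOfNeZero _ h2).trans (Homeomorph.neg _))⟩

def bk {n : ℕ} (φ : TF n) : ℕ → TF n
  | 0 => psi φ 0
  | k + 1 => psi φ (k + 1) - psi φ k

theorem bk_apply {n : ℕ} (φ : TF n) (k : ℕ) (t : Fin n → ℝ) : (bk φ k).1 t = phiFam n φ.1 k (-t) := by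
  cases k with
  | zero => simp [bk, psi, phiFam]
  | succ k =>
    change 2 ^ ((k + 1) * n) * φ.1 (-((2 : ℝ) ^ (k + 1) • t)) - 2 ^ (k * n) * φ.1 (-((2 : ℝ) ^ k • t)) = _
    simp only [phiFam, phiOf, mul_sub]
    rw [smul_neg, smul_neg, smul_smul, ← mul_assoc]
    congr 2
    · rw [add_mul, one_mul, pow_add, mul_assoc, ← mul_pow]; simp
    · rw [pow_succ]; congr 2; rw [mul_comm ((2:ℝ)^k), ← mul_assoc]; simp

theorem distConv_eq {n : ℕ} (φ : TF n) (f : Dstrb n) (k : ℕ) (x : Fin n → ℝ) :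
    distConv n f (phiFam n φ.1 k) x = f (tr x (bk φ k)).1 := by
  unfold distConv
  congr 1
  funext y
  change _ = (bk φ k).1 (y - x)
  rw [bk_apply, neg_sub]

theorem psi_support {n : ℕ} (φ : TF n) {R : ℝ} (hR : Function.support φ.1 ⊆ Metric.closedBall 0 R) (j : ℕ) :
    Function.support (psi φ j).1 ⊆ Metric.closedBall 0 (R / 2 ^ j) := by
  intro t ht
  have h1 : φ.1 (-((2 : ℝ) ^ j • t)) ≠ 0 := fun h => ht (by
    change 2 ^ (j * n) * φ.1 (-((2 : ℝ) ^ j • t)) = 0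
    rw [h, mul_zero])
  have h2 := hR h1
  rw [mem_closedBall_zero_iff, norm_neg, norm_smul] at h2
  rw [mem_closedBall_zero_iff, le_div_iff₀ (by positivity), mul_comm]
  simpa using h2

theorem psi_int {n : ℕ} (φ : TF n) (j : ℕ) (F : ℝ → ℝ) (hF : ∀ c : ℝ, 0 ≤ c → ∀ y, F (c * y) = c * F y) :
    ∫ t, F ((psi φ j).1 t) = ∫ t, F (φ.1 t) := by
  change ∫ t, F (2 ^ (j * n) * φ.1 (-((2 : ℝ) ^ j • t))) = _
  simp_rw [hF _ (by positivity : (0 : ℝ) ≤ 2 ^ (j * n)), ← smul_neg]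
  rw [integral_const_mul, integral_neg_eq_self (fun t => F (φ.1 ((2 : ℝ) ^ j • t))) volume,
    Measure.integral_comp_smul volume (fun t => F (φ.1 t))]
  simp only [Module.finrank_fintype_fun_eq_card, Fintype.card_fin, smul_eq_mul]
  rw [abs_of_nonneg (by positivity), ← mul_assoc, pow_mul, mul_inv_cancel₀ (by positivity), one_mul]

theorem ring_e {A : Type*} [Ring A] {x a : A} (h : Commute x a) : Commute x (1 - a * a) :=
  (Commute.one_right _).sub_right (h.mul_right h)

theorem ring_fac {A : Type*} [Ring A] (a : A) (m : ℕ) :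
    1 - (1 - a * a) ^ m = a * (a * ∑ i ∈ Finset.range m, (1 - a * a) ^ i) := by
  have := mul_neg_geom_sum (1 - a * a) m
  rw [← this, ← mul_assoc, _root_.sub_sub_cancel]

theorem ring_succ {A : Type*} [Ring A] {a b : A} (h : Commute a b) (m : ℕ) :
    1 - (1 - b * b) ^ m = 1 - (1 - a * a) ^ m + (b - a) * ((b + a) *
      ∑ i ∈ Finset.range m, (1 - a * a) ^ i * (1 - b * b) ^ (m - 1 - i)) := by
  have h1 := (ring_e (ring_e h).symm).symm.mul_geom_sum₂ m
  have h2 : (b - a) * (b + a) = (1 - a * a) - (1 - b * b) := by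
    have := h.eq
    simp only [mul_add, sub_mul, this]
    abel
  rw [← mul_assoc, h2, h1]; abel

section ops
variable {n : ℕ} (φ : TF n)

def aO (j : ℕ) : Module.End ℝ (TF n) := cv (psi φ j)
def bO (j : ℕ) : Module.End ℝ (TF n) := cv (bk φ j)
def eO (j : ℕ) : Module.End ℝ (TF n) := 1 - aO φ j * aO φ j
def aop : ℕ → Module.End ℝ (TF n)
  | 0 => aO φ 0
  | j + 1 => aO φ (j + 1) + aO φ j
def Sop (m : ℕ) : ℕ → Module.End ℝ (TF n)
  | 0 => ∑ i ∈ Finset.range m, eO φ 0 ^ i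
  | j + 1 => ∑ i ∈ Finset.range m, eO φ j ^ i * eO φ (j + 1) ^ (m - 1 - i)
def hO (m j : ℕ) : Module.End ℝ (TF n) := 1 - eO φ j ^ m

theorem aO_comm (i j : ℕ) : Commute (aO φ i) (aO φ j) := cv_commute _ _

theorem aO_eO (i j : ℕ) : Commute (aO φ i) (eO φ j) :=
  ring_e (A := Module.End ℝ (TF n)) (aO_comm φ i j)

theorem aop_eO (i j : ℕ) : Commute (aop φ i) (eO φ j) := by
  cases i with
  | zero => exact aO_eO φ 0 j
  | succ i => exact (aO_eO φ _ j).add_left (aO_eO φ _ j)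

theorem aop_Sop (m i j : ℕ) : Commute (aop φ i) (Sop φ m j) := by
  cases j with
  | zero => exact Commute.sum_right _ _ _ fun k _ => (aop_eO φ i 0).pow_right k
  | succ j => exact Commute.sum_right _ _ _ fun k _ => ((aop_eO φ i j).pow_right k).mul_right ((aop_eO φ i _).pow_right _)

theorem bO_zero : bO φ 0 = aO φ 0 := rfl
theorem bO_succ (j : ℕ) : bO φ (j + 1) = aO φ (j + 1) - aO φ j := cv_sub _ _

theorem hO_fac (m j : ℕ) : hO φ m j = aO φ j * (aO φ j * ∑ i ∈ Finset.range m, eO φ j ^ i) :=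
  ring_fac (aO φ j) m

theorem hO_zero (m : ℕ) : hO φ m 0 = bO φ 0 * (Sop φ m 0 * aop φ 0) := by
  rw [← (aop_Sop φ m 0 0).eq, hO_fac]; rfl

theorem hO_succ (m j : ℕ) : hO φ m (j + 1) = hO φ m j + bO φ (j + 1) * (Sop φ m (j + 1) * aop φ (j + 1)) := by
  rw [← (aop_Sop φ m (j + 1) (j + 1)).eq, bO_succ]
  exact ring_succ (A := Module.End ℝ (TF n)) (aO_comm φ j (j + 1)) m

theorem hO_sum (m J N : ℕ) : hO φ m (J + N) = hO φ m J +
    ∑ l ∈ Finset.range N, bO φ (J + l + 1) * (Sop φ m (J + l + 1) * aop φ (J + l + 1)) := by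
  induction N with
  | zero => simp
  | succ N ih => rw [Finset.sum_range_succ, ← add_assoc, ← add_assoc, ← ih, hO_succ]

theorem hO_bk (m J : ℕ) (x : Fin n → ℝ) : hO φ m J (tr x (bk φ J)) =
    bO φ J ((aO φ J * ∑ i ∈ Finset.range m, eO φ J ^ i) (tr x (psi φ J))) := by
  have h1 : Commute (aO φ J) (aO φ J * ∑ i ∈ Finset.range m, eO φ J ^ i) :=
    (aO_comm φ J J).mul_right (Commute.sum_right _ _ _ fun k _ => (aO_eO φ J J).pow_right k)
  have hb : ∀ i, Commute (bO φ J) (aO φ i) := fun i => cv_commute _ _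
  have hbe : Commute (bO φ J) (eO φ J) :=
    ring_e (A := Module.End ℝ (TF n)) (hb J)
  have h2 : Commute (bO φ J) (aO φ J * ∑ i ∈ Finset.range m, eO φ J ^ i) :=
    (hb J).mul_right (Commute.sum_right _ _ _ fun k _ => hbe.pow_right k)
  have h3 : aO φ J (tr x (bk φ J)) = bO φ J (tr x (psi φ J)) := by
    unfold aO bO
    rw [cv_tr, cv_tr, cv_swap]
  rw [hO_fac, h1.eq, Module.End.mul_apply, h3, ← Module.End.mul_apply, ← h2.eq, Module.End.mul_apply]

end ops

theorem OpB.neg {n : ℕ} {T : Module.End ℝ (TF n)} {ρ : ℝ} {s : ℕ} {K : ℝ} (h : OpB T ρ s K) : OpB (-T) ρ s K := by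
  constructor
  · intro θ x ρ0 h0
    have := h.1 θ x ρ0 h0
    have e : ((-T) θ).1 = -(T θ).1 := rfl
    rwa [e, Function.support_neg]
  · intro θ i K0 h0 y
    have e : ((-T) θ).1 = -(T θ).1 := rfl
    rw [e, iteratedFDeriv_neg_apply, norm_neg]
    exact h.2 θ i K0 h0 y

theorem OpB.pow0 {n : ℕ} {T : Module.End ℝ (TF n)} {ρ : ℝ} {K : ℝ} (h : OpB T ρ 0 K) (hρ : 0 ≤ ρ) (hK : 1 ≤ K)
    {i m : ℕ} (him : i ≤ m) : OpB (T ^ i) (m * ρ) 0 (K ^ m) := by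
  have := h.pow i
  rw [mul_zero] at this
  refine this.weaken ?_ (pow_le_pow_right₀ hK him)
  have : (i : ℝ) ≤ m := by exact_mod_cast him
  gcongr

theorem ring_fac2 {A : Type*} [Ring A] (a : A) : 1 - a * a = (1 - a) * (1 + a) := by noncomm_ring
theorem ring_fac3 {A : Type*} [Ring A] (a : A) : 1 - a * a = 1 + -(a * a) := by abel

theorem opbounds {n : ℕ} (φ : TF n) (h1 : ∫ t, φ.1 t = 1) (m : ℕ) (hm : 1 ≤ m) : ∃ c C : ℝ, 0 ≤ c ∧ 0 ≤ C ∧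
    (∀ j, OpB (aop φ j) (c / 2 ^ j) 0 C) ∧ (∀ j, OpB (Sop φ m j) (c / 2 ^ j) 0 C) ∧
    (∀ j, OpB (Sop φ m (j + 1)) (c / 2 ^ (j + 1)) (m - 1) (C / 2 ^ ((j + 1) * (m - 1)))) ∧
    (∀ j, OpB (aO φ j * ∑ i ∈ Finset.range m, eO φ j ^ i) (c / 2 ^ j) 0 C) ∧
    (∀ j, OpB (eO φ j ^ m) c m (C / 2 ^ (j * m))) := by
  obtain ⟨R, hR0, hR⟩ := IsTestFun.ball φ.2
  set I0 := ∫ t, |φ.1 t| with hI0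
  have hI0' : 0 ≤ I0 := integral_nonneg fun t => abs_nonneg _
  have hA : ∀ j, OpB (aO φ j) (R / 2 ^ j) 0 I0 := by
    intro j
    have := OpB.cv (psi φ j) (psi_support φ hR j)
    rwa [psi_int φ j abs (fun c hc y => by rw [abs_mul, abs_of_nonneg hc])] at this
  have hA1 : ∀ j, OpB (1 - aO φ j) (R / 2 ^ j) 1 (I0 * (R / 2 ^ j)) := by
    intro j
    have := OpB.one_sub_cv (psi φ j) (by positivity) (psi_support φ hR j)
      (by rw [← h1]; exact psi_int φ j id (fun c hc y => rfl))
    rwa [psi_int φ j abs (fun c hc y => by rw [abs_mul, abs_of_nonneg hc])] at this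
  have one' : ∀ ρ : ℝ, 0 ≤ ρ → OpB (1 : Module.End ℝ (TF n)) ρ 0 1 := fun ρ hρ => OpB.one.weaken hρ le_rfl
  have hAp : ∀ j, OpB (1 + aO φ j) (R / 2 ^ j) 0 (1 + I0) := fun j => (one' _ (by positivity)).add (hA j)
  have hE1 : ∀ j, OpB (eO φ j) (2 * R / 2 ^ j) 1 (I0 * R * (1 + I0) / 2 ^ j) := by
    intro j
    have := (hA1 j).mul (hAp j)
    have e : eO φ j = (1 - aO φ j) * (1 + aO φ j) := ring_fac2 (A := Module.End ℝ (TF n)) (aO φ j)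
    rw [e]
    refine this.weaken (le_of_eq ?_) (le_of_eq ?_)
    · ring
    · ring
  have hE0 : ∀ j, OpB (eO φ j) (2 * R / 2 ^ j) 0 (1 + I0 * I0) := by
    intro j
    have := ((one' (R / 2 ^ j + R / 2 ^ j) (by positivity)).add ((hA j).mul (hA j)).neg)
    have e : eO φ j = 1 + -(aO φ j * aO φ j) := ring_fac3 (A := Module.End ℝ (TF n)) (aO φ j)
    rw [e]
    exact this.weaken (le_of_eq (by ring)) le_rfl
  set K1 := I0 * R * (1 + I0) with hK1
  set K2 := 1 + I0 * I0 with hK2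
  have hK1' : 0 ≤ K1 := by positivity
  have hK2' : 1 ≤ K2 := by nlinarith
  have hP : ∀ j i, i ≤ m → OpB (eO φ j ^ i) (m * (2 * R / 2 ^ j)) 0 (K2 ^ m) := fun j i hi =>
    (hE0 j).pow0 (by positivity) hK2' hi
  have hK2m : (1:ℝ) ≤ K2 ^ m := one_le_pow₀ hK2'
  have hS : ∀ j, OpB (∑ i ∈ Finset.range m, eO φ j ^ i) (m * (2 * R / 2 ^ j)) 0 (m * K2 ^ m) := fun j =>
    OpB.sum fun i hi => hP j i hi.le
  set c := 2 * R + 3 * R + 8 * m * R with hc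
  set C := (2 * I0 + m * K2 ^ m + m * (K2 ^ m * K2 ^ m) + m * (K1 * 2) ^ (m - 1) + I0 * (m * K2 ^ m) + K1 ^ m) with hC
  refine ⟨c, C, by positivity, by positivity, ?_, ?_, ?_, ?_, ?_⟩
  · intro j
    cases j with
    | zero =>
      refine (hA 0).weaken ?_ ?_
      · gcongr; simp only [hc]
        have : 0 ≤ 8 * m * R := by positivity
        linarith
      · have : 0 ≤ m * K2 ^ m + m * (K2 ^ m * K2 ^ m) + m * (K1 * 2) ^ (m - 1) + I0 * (m * K2 ^ m) + K1 ^ m := by positivity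
        linarith
    | succ j =>
      refine (((hA (j + 1)).weaken (ρ' := 2 * R / 2 ^ (j + 1)) (by gcongr; linarith) le_rfl).add ((hA j).weaken (ρ' := 2 * R / 2 ^ (j + 1)) (le_of_eq ?_) le_rfl)).weaken ?_ ?_
      · rw [pow_succ]; field_simp
      · gcongr; simp only [hc]
        have : 0 ≤ 8 * m * R := by positivity
        linarith
      · have : 0 ≤ m * K2 ^ m + m * (K2 ^ m * K2 ^ m) + m * (K1 * 2) ^ (m - 1) + I0 * (m * K2 ^ m) + K1 ^ m := by positivity
        linarith
  · intro j
    cases j with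
    | zero =>
      refine (hS 0).weaken ?_ ?_
      · rw [← mul_div_assoc]
        gcongr; simp only [hc]
        have : 0 ≤ m * R := by positivity
        linarith
      · have : 0 ≤ 2 * I0 + m * (K2 ^ m * K2 ^ m) + m * (K1 * 2) ^ (m - 1) + I0 * (m * K2 ^ m) + K1 ^ m := by positivity
        linarith
    | succ j =>
      refine (OpB.sum fun i hi => (hP j i hi.le).mul (hP (j + 1) (m - 1 - i) (by omega))).weaken ?_ ?_
      · have e : m * (2 * R / 2 ^ j) + m * (2 * R / 2 ^ (j + 1)) = (6 * m * R) / 2 ^ (j + 1) := by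
          rw [pow_succ]; field_simp; ring
        rw [e]
        gcongr; simp only [hc]
        have : 0 ≤ m * R := by positivity
        linarith
      · have : 0 ≤ 2 * I0 + m * K2 ^ m + m * (K1 * 2) ^ (m - 1) + I0 * (m * K2 ^ m) + K1 ^ m := by positivity
        linarith
  · intro j
    have key : ∀ i < m, OpB (eO φ j ^ i * eO φ (j + 1) ^ (m - 1 - i)) (8 * m * R / 2 ^ (j + 1)) (m - 1) ((K1 / 2 ^ j) ^ (m - 1)) := by
      intro i hi
      have a1 := (hE1 j).pow i
      have a2 := ((hE1 (j + 1)).weaken (K' := K1 / 2 ^ j) le_rfl (by gcongr <;> norm_num)).pow (m - 1 - i)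
      have := a1.mul a2
      rw [← add_mul, mul_one, ← pow_add, show i + (m - 1 - i) = m - 1 by omega] at this
      refine this.weaken ?_ le_rfl
      have b1 : (i : ℝ) ≤ m := by exact_mod_cast hi.le
      have b2 : ((m - 1 - i : ℕ) : ℝ) ≤ m := by exact_mod_cast (by omega : m - 1 - i ≤ m)
      calc (i : ℝ) * (2 * R / 2 ^ j) + ((m - 1 - i : ℕ) : ℝ) * (2 * R / 2 ^ (j + 1)) ≤
          m * (2 * R / 2 ^ j) + m * (2 * R / 2 ^ (j + 1)) := by gcongr
        _ = (6 * m * R) / 2 ^ (j + 1) := by rw [pow_succ]; field_simp; ring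
        _ ≤ _ := by gcongr; norm_num
    refine (OpB.sum key).weaken ?_ ?_
    · gcongr; simp only [hc]; linarith
    · have e : (m : ℝ) * (K1 / 2 ^ j) ^ (m - 1) = (m * (K1 * 2) ^ (m - 1)) / 2 ^ ((j + 1) * (m - 1)) := by
        rw [pow_mul, ← mul_div_mul_right K1 _ (two_ne_zero (α := ℝ)), ← pow_succ, div_pow]; ring
      rw [e]
      gcongr
      have : 0 ≤ 2 * I0 + m * K2 ^ m + m * (K2 ^ m * K2 ^ m) + I0 * (m * K2 ^ m) + K1 ^ m := by positivity
      linarith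
  · intro j
    refine ((hA j).mul (hS j)).weaken ?_ ?_
    · rw [← mul_div_assoc, ← add_div]
      gcongr; simp only [hc]
      have : 0 ≤ m * R := by positivity
      linarith
    · have : 0 ≤ 2 * I0 + m * K2 ^ m + m * (K2 ^ m * K2 ^ m) + m * (K1 * 2) ^ (m - 1) + K1 ^ m := by positivity
      linarith
  · intro j
    have := (hE1 j).pow m
    rw [mul_one] at this
    refine this.weaken ?_ ?_
    · have : 2 * R / 2 ^ j ≤ 2 * R := div_le_self (by positivity) (one_le_pow₀ (by norm_num))
      calc m * (2 * R / 2 ^ j) ≤ m * (2 * R) := by gcongr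
        _ ≤ _ := by
          simp only [hc]
          have : 0 ≤ m * R := by positivity
          linarith
    · rw [div_pow, ← pow_mul]
      gcongr
      have : 0 ≤ 2 * I0 + m * K2 ^ m + m * (K2 ^ m * K2 ^ m) + m * (K1 * 2) ^ (m - 1) + I0 * (m * K2 ^ m) := by positivity
      linarith

/-- restriction of a functional to test functions -/
def fT {n : ℕ} (f : Dstrb n) : TF n →ₗ[ℝ] ℝ := f.comp (TF n).subtype

theorem fT_apply {n : ℕ} (f : Dstrb n) (θ : TF n) : fT f θ = f θ.1 := rfl

theorem iter_cont {n : ℕ} (θ : TF n) (i : ℕ) : Continuous (iteratedFDeriv ℝ i θ.1) :=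
  θ.2.1.continuous_iteratedFDeriv (by norm_cast; exact le_top)

theorem iter_bdd {n : ℕ} (θ : TF n) (i : ℕ) : ∃ K, 0 ≤ K ∧ ∀ y, ‖iteratedFDeriv ℝ i θ.1 y‖ ≤ K := by
  obtain ⟨K, hK⟩ := (iter_cont θ i).bounded_above_of_compact_support (θ.2.2.iteratedFDeriv i)
  exact ⟨K, (norm_nonneg _).trans (hK 0), hK⟩

theorem iter_bdd' {n : ℕ} (θ : TF n) (N : ℕ) : ∃ K, 0 ≤ K ∧ ∀ i ≤ N, ∀ y, ‖iteratedFDeriv ℝ i θ.1 y‖ ≤ K := by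
  choose K hK0 hK using iter_bdd θ
  refine ⟨∑ i ∈ Finset.range (N + 1), K i, Finset.sum_nonneg fun i _ => hK0 i, fun i hi y => (hK i y).trans ?_⟩
  exact Finset.single_le_sum (f := K) (fun i _ => hK0 i) (Finset.mem_range.2 (by omega))

theorem iter_zero_out {n : ℕ} (θ : TF n) {x : Fin n → ℝ} {ρ : ℝ} (h : Function.support θ.1 ⊆ Metric.closedBall x ρ)
    (i : ℕ) (y : Fin n → ℝ) (hy : y ∉ Metric.closedBall x ρ) : iteratedFDeriv ℝ i θ.1 y = 0 := by
  have h1 : tsupport θ.1 ⊆ Metric.closedBall x ρ := closure_minimal h Metric.isClosed_closedBall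
  have h2 := support_iteratedFDeriv_subset (𝕜 := ℝ) (f := θ.1) i
  by_contra hne
  exact hy (h1 (h2 hne))

theorem f_bound {n : ℕ} (f : Dstrb n) (hf : MemSe' n f) : ∃ (C : ℝ) (N : ℕ), 0 ≤ C ∧
    ∀ (θ : TF n) (x : Fin n → ℝ) (ρ K : ℝ), Function.support θ.1 ⊆ Metric.closedBall x ρ →
    (∀ i ≤ N, ∀ y, ‖iteratedFDeriv ℝ i θ.1 y‖ ≤ K) → |fT f θ| ≤ C * (Real.exp (N * (‖x‖ + ρ)) * K) := by
  obtain ⟨C, N, hC, h⟩ := hf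
  refine ⟨C * (N + 1), N, by positivity, fun θ x ρ K hs hK => ?_⟩
  have h1 := h θ.1 θ.2.1
  have hK0 : 0 ≤ K := (norm_nonneg _).trans (hK 0 (by omega) 0)
  have h2 : seSeminorm n N θ.1 ≤ ENNReal.ofReal (Real.exp (N * (‖x‖ + ρ)) * ((N + 1) * K)) := by
    refine iSup_le fun y => ENNReal.ofReal_le_ofReal ?_
    by_cases hy : y ∈ Metric.closedBall x ρ
    · have : ‖y‖ ≤ ‖x‖ + ρ := by
        rw [mem_closedBall_iff_norm] at hy
        calc ‖y‖ = ‖x + (y - x)‖ := by congr 1; abel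
          _ ≤ _ := (norm_add_le _ _).trans (by gcongr)
      refine mul_le_mul ?_ ?_ (Finset.sum_nonneg fun i _ => norm_nonneg _) (Real.exp_pos _).le
      · apply Real.exp_le_exp.2; gcongr
      · refine (Finset.sum_le_card_nsmul _ _ K fun i hi => hK i (by simpa [Nat.lt_succ_iff] using hi) y).trans (le_of_eq ?_)
        simp
    · rw [Finset.sum_eq_zero fun i _ => by rw [iter_zero_out θ hs i y hy, norm_zero], mul_zero]
      positivity
  have h3 := h1.trans (mul_le_mul_right h2 _)
  rw [← ENNReal.ofReal_mul hC.le, ENNReal.ofReal_le_ofReal_iff (by positivity)] at h3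
  refine h3.trans (le_of_eq ?_)
  ring

theorem iter_tr {n : ℕ} (x : Fin n → ℝ) (θ : TF n) (i : ℕ) (y : Fin n → ℝ) :
    iteratedFDeriv ℝ i (tr x θ).1 y = iteratedFDeriv ℝ i θ.1 (y - x) :=
  congrFun (iteratedFDeriv_comp_sub' i x) y

section embed
variable {n : ℕ} {W : ℕ → Type} [∀ i, NormedAddCommGroup (W i)] [∀ i, NormedSpace ℝ (W i)]
  [∀ i, CompleteSpace (W i)]

/-- An abstract system of derivatives. -/
structure AbsD (n : ℕ) (W : ℕ → Type) [∀ i, NormedAddCommGroup (W i)] [∀ i, NormedSpace ℝ (W i)] where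
  D : ∀ i, TF n → (Fin n → ℝ) → W i
  hadd : ∀ i θ θ' y, D i (θ + θ') y = D i θ y + D i θ' y
  hsmul : ∀ i (c : ℝ) θ y, D i (c • θ) y = c • D i θ y
  hcont : ∀ i θ, Continuous (D i θ)
  hsupp : ∀ i θ R, Function.support θ.1 ⊆ Metric.closedBall 0 R → ∀ y, y ∉ Metric.closedBall 0 R → D i θ y = 0
  hinj : ∀ θ y, D 0 θ y = 0 → θ.1 y = 0
  hlip : ∀ i θ, ∃ K : ℝ, 0 ≤ K ∧ ∀ y z, ‖D i θ y - D i θ z‖ ≤ K * ‖y - z‖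
  htr : ∀ i x θ y, D i (tr x θ) y = D i θ (y - x)
  hcv : ∀ i g η y, D i (cv g η) y = ∫ z, η.1 z • D i g (y - z)

abbrev EJ (n N : ℕ) (W : ℕ → Type) [∀ i, NormedAddCommGroup (W i)] [∀ i, NormedSpace ℝ (W i)] :=
  (i : Fin (N + 1)) → BoundedContinuousFunction (Fin n → ℝ) (W i)

theorem AbsD.wcont (A : AbsD n W) (N : ℕ) (θ : TF n) (i : ℕ) :
    Continuous (fun y => Real.exp (N * ‖y‖) • A.D i θ y) := by
  have := A.hcont i θ
  fun_prop

theorem AbsD.wbdd (A : AbsD n W) (N : ℕ) (θ : TF n) (i : ℕ) :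
    ∃ C, ∀ y, ‖Real.exp (N * ‖y‖) • A.D i θ y‖ ≤ C := by
  obtain ⟨R, hR0, hR⟩ := IsTestFun.ball θ.2
  refine (A.wcont N θ i).bounded_above_of_compact_support (hasCompactSupport_of_ball (x := 0) (R := R) ?_)
  intro y hy
  by_contra hh
  exact hy (by simp only [A.hsupp i θ R hR y hh, smul_zero])

def AbsD.Jm (A : AbsD n W) (N : ℕ) : TF n →ₗ[ℝ] EJ n N W where
  toFun θ i := BoundedContinuousFunction.ofNormedAddCommGroup (fun y => Real.exp (N * ‖y‖) • A.D i θ y)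
    (A.wcont N θ i) (A.wbdd N θ i).choose (A.wbdd N θ i).choose_spec
  map_add' θ θ' := by
    funext i; ext1 y
    simp [A.hadd, smul_add]
  map_smul' c θ := by
    funext i; ext1 y
    change Real.exp (N * ‖y‖) • A.D i (c • θ) y = c • (Real.exp (N * ‖y‖) • A.D i θ y)
    rw [A.hsmul, smul_comm]

theorem AbsD.Jm_apply (A : AbsD n W) (N : ℕ) (θ : TF n) (i : Fin (N + 1)) (y : Fin n → ℝ) :
    A.Jm N θ i y = Real.exp (N * ‖y‖) • A.D i θ y := rfl

theorem AbsD.Jm_inj (A : AbsD n W) (N : ℕ) : Function.Injective (A.Jm N) := by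
  rw [injective_iff_map_eq_zero]
  intro θ h
  refine Subtype.ext (funext fun y => ?_)
  have h1 : A.Jm N θ 0 y = 0 := by rw [h]; rfl
  rw [Jm_apply, smul_eq_zero, or_iff_right (Real.exp_pos _).ne'] at h1
  exact A.hinj θ y h1

theorem AbsD.f_ext (A : AbsD n W) (F : TF n →ₗ[ℝ] ℝ) {C : ℝ} {N : ℕ} (hC : 0 ≤ C)
    (h : ∀ θ B, (∀ y, Real.exp (N * ‖y‖) * ∑ i ∈ Finset.range (N + 1), ‖A.D i θ y‖ ≤ B) → |F θ| ≤ C * B) :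
    ∃ (Λ : EJ n N W →L[ℝ] ℝ), ∀ θ, Λ (A.Jm N θ) = F θ := by
  have hb : ∀ θ : TF n, ‖F θ‖ ≤ (C * (N + 1)) * ‖A.Jm N θ‖ := by
    intro θ
    rw [mul_assoc]
    refine h θ _ fun y => ?_
    rw [Finset.mul_sum]
    refine (Finset.sum_le_card_nsmul _ _ ‖A.Jm N θ‖ fun i hi => ?_).trans (le_of_eq ?_)
    · have a := norm_le_pi_norm (A.Jm N θ) ⟨i, Finset.mem_range.1 hi⟩
      have b := (A.Jm N θ ⟨i, Finset.mem_range.1 hi⟩).norm_coe_le_norm y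
      rw [Jm_apply, norm_smul, Real.norm_eq_abs, abs_of_nonneg (Real.exp_pos _).le] at b
      exact b.trans a
    · simp
  let e := LinearEquiv.ofInjective (A.Jm N) (A.Jm_inj N)
  let l : LinearMap.range (A.Jm N) →L[ℝ] ℝ := LinearMap.mkContinuous (F.comp e.symm.toLinearMap) (C * (N + 1)) (by
    intro x
    obtain ⟨θ, rfl⟩ := e.surjective x
    have := hb θ
    simpa [e] using this)
  obtain ⟨Λ, hΛ, -⟩ := exists_extension_norm_eq (LinearMap.range (A.Jm N)) l
  refine ⟨Λ, fun θ => ?_⟩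
  have := hΛ (e θ)
  simpa [l, e] using this

theorem AbsD.Jtr_cont (A : AbsD n W) (N : ℕ) (g : TF n) : Continuous fun z => A.Jm N (tr z g) := by
  refine continuous_pi fun i => ?_
  rw [Metric.continuous_iff']
  intro z0 ε hε
  obtain ⟨R, hR0, hR⟩ := IsTestFun.ball g.2
  obtain ⟨K, hK0, hK⟩ := A.hlip i g
  set D := Real.exp (N * (‖z0‖ + 1 + R)) * K with hD
  have hD0 : 0 ≤ D := by positivity
  have hδ : 0 < min 1 (ε / (2 * (D + 1))) := by positivity
  filter_upwards [Metric.ball_mem_nhds z0 hδ] with z hz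
  rw [Metric.mem_ball, dist_eq_norm, lt_min_iff] at hz
  have hle : dist (A.Jm N (tr z g) i) (A.Jm N (tr z0 g) i) ≤ D * ‖z - z0‖ := by
    rw [BoundedContinuousFunction.dist_le (by positivity)]
    intro y
    rw [dist_eq_norm, Jm_apply, Jm_apply, ← smul_sub, norm_smul, A.htr, A.htr, Real.norm_eq_abs, abs_of_nonneg (Real.exp_pos _).le]
    by_cases hy : ‖y‖ ≤ ‖z0‖ + 1 + R
    · rw [hD, mul_assoc]
      refine mul_le_mul ?_ ?_ (norm_nonneg _) (Real.exp_pos _).le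
      · apply Real.exp_le_exp.2; gcongr
      · have := hK (y - z) (y - z0)
        rwa [show y - z - (y - z0) = -(z - z0) by abel, norm_neg] at this
    · have a1 : ‖y‖ ≤ ‖y - z‖ + ‖z - z0‖ + ‖z0‖ := by
        calc ‖y‖ = ‖(y - z) + (z - z0) + z0‖ := by congr 1; abel
          _ ≤ _ := norm_add₃_le
      have a2 : ‖y‖ ≤ ‖y - z0‖ + ‖z0‖ := by
        calc ‖y‖ = ‖(y - z0) + z0‖ := by congr 1; abel
          _ ≤ _ := norm_add_le _ _
      rw [A.hsupp i g R hR (y - z), A.hsupp i g R hR (y - z0), sub_zero, norm_zero, mul_zero]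
      · positivity
      · rw [mem_closedBall_zero_iff]; push Not at hy; intro hh; linarith
      · rw [mem_closedBall_zero_iff]; push Not at hy; intro hh; linarith [hz.1]
  refine hle.trans_lt ?_
  have : ‖z - z0‖ * (2 * (D + 1)) < ε := by rw [← lt_div_iff₀ (by positivity)]; exact hz.2
  nlinarith [norm_nonneg (z - z0)]

theorem AbsD.concl (A : AbsD n W) (F : TF n →ₗ[ℝ] ℝ) {C : ℝ} {N : ℕ} (hC : 0 ≤ C)
    (h : ∀ θ B, (∀ y, Real.exp (N * ‖y‖) * ∑ i ∈ Finset.range (N + 1), ‖A.D i θ y‖ ≤ B) → |F θ| ≤ C * B) :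
    (∀ g, Continuous fun z => F (tr z g)) ∧ ∀ g η, F (cv g η) = ∫ z, η.1 z * F (tr z g) := by
  obtain ⟨Λ, hΛ⟩ := A.f_ext F hC h
  constructor
  · intro g
    simp_rw [← hΛ]
    exact Λ.continuous.comp (A.Jtr_cont N g)
  intro g η
  have hi : Integrable (fun z => η.1 z • A.Jm N (tr z g)) volume :=
    Continuous.integrable_of_hasCompactSupport ((IsTestFun.cont η.2).smul (A.Jtr_cont N g)) η.2.2.smul_right
  have key : A.Jm N (cv g η) = ∫ z, η.1 z • A.Jm N (tr z g) := by
    funext i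
    ext1 y
    have h1 := ((BoundedContinuousFunction.evalCLM ℝ y).comp
      (ContinuousLinearMap.proj (R := ℝ) (φ := fun i : Fin (N + 1) => BoundedContinuousFunction (Fin n → ℝ) (W i)) i)).integral_comp_comm hi
    refine Eq.trans ?_ h1
    rw [Jm_apply, A.hcv, ← integral_smul]
    congr 1
    funext z
    change _ = η.1 z • (A.Jm N (tr z g) i y)
    rw [Jm_apply, A.htr, smul_comm]
  rw [← hΛ, key, ← Λ.integral_comp_comm hi]
  congr 1
  funext z
  rw [map_smul, hΛ, smul_eq_mul]

end embed

def iterD (n : ℕ) : AbsD n (fun i => (Fin n → ℝ) [×i]→L[ℝ] ℝ) where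
  D i θ y := iteratedFDeriv ℝ i θ.1 y
  hadd i θ θ' y := iter_add θ θ' i y
  hsmul i c θ y := iteratedFDeriv_const_smul_apply (a := c) (θ.2.1.of_le (by norm_cast; exact le_top) : ContDiff ℝ i _).contDiffAt
  hcont i θ := iter_cont θ i
  hsupp i θ R h y hy := iter_zero_out θ h i y hy
  hinj θ y h := by
    rw [← norm_eq_zero, norm_iteratedFDeriv_zero, norm_eq_zero] at h
    exact h
  hlip i θ := by
    obtain ⟨K, hK0, hK⟩ := iter_bdd θ (i + 1)
    exact ⟨K, hK0, fun y z => lip_iter θ i hK y z⟩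
  htr i x θ y := iter_tr x θ i y
  hcv i g η y := by
    have e : (cv g η).1 = cvv η.1 g.1 := cvv_comm g.1 η.1
    rw [e, iter_cvv (IsTestFun.cont η.2) g.2.1 g.2.2]
    rfl

theorem fT_concl {n : ℕ} (f : Dstrb n) (hf : MemSe' n f) :
    (∀ g, Continuous fun z => fT f (tr z g)) ∧ ∀ g η, fT f (cv g η) = ∫ z, η.1 z * fT f (tr z g) := by
  obtain ⟨C, N, hC, h⟩ := hf
  refine (iterD n).concl (fT f) (C := C) (N := N) hC.le fun θ B hB => ?_
  have h1 := h θ.1 θ.2.1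
  have hB0 : 0 ≤ B := le_trans (by positivity) (hB 0)
  have h2 : seSeminorm n N θ.1 ≤ ENNReal.ofReal B := iSup_le fun y => ENNReal.ofReal_le_ofReal (hB y)
  have h3 := h1.trans (mul_le_mul_right h2 _)
  rwa [← ENNReal.ofReal_mul hC.le, ENNReal.ofReal_le_ofReal_iff (by positivity)] at h3

theorem fT_cv_le {n : ℕ} (f : Dstrb n) (hf : MemSe' n f) (g η : TF n) :
    ‖fT f (cv g η)‖ₑ ≤ ∫⁻ z, ‖fT f (tr z g)‖ₑ * ‖η.1 z‖ₑ := by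
  rw [(fT_concl f hf).2]
  refine (enorm_integral_le_lintegral_enorm _).trans (le_of_eq ?_)
  congr 1
  funext z
  rw [enorm_mul, mul_comm]

theorem psi_deriv {n : ℕ} (φ : TF n) (i : ℕ) : ∃ K : ℝ, 0 ≤ K ∧ ∀ j y,
    ‖iteratedFDeriv ℝ i (psi φ j).1 y‖ ≤ K * (2 ^ (j * n) * 2 ^ (j * i)) := by
  obtain ⟨K, hK0, hK⟩ := iter_bdd φ i
  refine ⟨K, hK0, fun j y => ?_⟩
  have e : (psi φ j).1 = ((2 : ℝ) ^ (j * n)) • fun t => φ.1 ((-(2 : ℝ) ^ j) • t) := by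
    funext t
    simp [psi]
  have hc : ContDiff ℝ i φ.1 := φ.2.1.of_le (by norm_cast; exact le_top)
  have hc' : ContDiff ℝ i fun t => φ.1 ((-(2 : ℝ) ^ j) • t) := by fun_prop
  rw [e, iteratedFDeriv_const_smul_apply hc'.contDiffAt, iteratedFDeriv_comp_const_smul _ hc]
  simp only [norm_smul, norm_pow, norm_neg, Real.norm_ofNat]
  rw [← pow_mul, ← mul_assoc, mul_comm]
  gcongr
  exact hK _

theorem bk_deriv {n : ℕ} (φ : TF n) (i : ℕ) : ∃ K : ℝ, 0 ≤ K ∧ ∀ j y,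
    ‖iteratedFDeriv ℝ i (bk φ j).1 y‖ ≤ K * (2 ^ (j * n) * 2 ^ (j * i)) := by
  obtain ⟨K, hK0, hK⟩ := psi_deriv φ i
  refine ⟨2 * K, by positivity, fun j y => ?_⟩
  cases j with
  | zero =>
    refine (hK 0 y).trans ?_
    gcongr; linarith
  | succ j =>
    have e : (bk φ (j + 1)) = psi φ (j + 1) + (-1 : ℝ) • psi φ j := by
      refine Subtype.ext (funext fun t => ?_)
      change (psi φ (j + 1)).1 t - (psi φ j).1 t = (psi φ (j + 1)).1 t + (-1 : ℝ) * (psi φ j).1 t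
      ring
    have hc : ContDiff ℝ i (psi φ j).1 := (psi φ j).2.1.of_le (by norm_cast; exact le_top)
    have e2 : iteratedFDeriv ℝ i ((-1 : ℝ) • psi φ j).1 y = (-1 : ℝ) • iteratedFDeriv ℝ i (psi φ j).1 y :=
      iteratedFDeriv_const_smul_apply (a := (-1 : ℝ)) hc.contDiffAt
    rw [e, iter_add, e2]
    refine (norm_add_le _ _).trans ?_
    rw [norm_smul, norm_neg, norm_one, one_mul, two_mul, add_mul]
    refine add_le_add (hK _ y) ((hK j y).trans ?_)
    gcongr <;> first | norm_num | omega

theorem bk_support {n : ℕ} (φ : TF n) {R : ℝ} (hR0 : 0 ≤ R) (hR : Function.support φ.1 ⊆ Metric.closedBall 0 R) (j : ℕ) :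
    Function.support (bk φ j).1 ⊆ Metric.closedBall 0 (2 * R / 2 ^ j) := by
  cases j with
  | zero =>
    refine (psi_support φ hR 0).trans (Metric.closedBall_subset_closedBall ?_)
    gcongr; linarith
  | succ j =>
    refine (Function.support_sub _ _).trans (Set.union_subset ?_ ?_)
    · refine (psi_support φ hR _).trans (Metric.closedBall_subset_closedBall ?_)
      gcongr; linarith
    · refine (psi_support φ hR _).trans (Metric.closedBall_subset_closedBall (le_of_eq ?_))
      rw [pow_succ]; field_simp

theorem tr_support {n : ℕ} (θ : TF n) (x : Fin n → ℝ) {ρ : ℝ} (h : Function.support θ.1 ⊆ Metric.closedBall 0 ρ) :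
    Function.support (tr x θ).1 ⊆ Metric.closedBall x ρ := by
  intro y hy
  have := h (show y - x ∈ Function.support θ.1 from hy)
  rwa [mem_closedBall_zero_iff, ← mem_closedBall_iff_norm] at this

theorem growth {n : ℕ} (φ : TF n) (f : Dstrb n) (hf : MemSe' n f) : ∃ (C0 : ℝ≥0∞) (A0 : ℕ) (B0 : ℝ), C0 ≠ ∞ ∧ 0 ≤ B0 ∧
    ∀ k y, ‖fT f (tr y (bk φ k))‖ₑ ≤ C0 * 2 ^ (k * A0) * ENNReal.ofReal (Real.exp (B0 * ‖y‖)) := by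
  obtain ⟨C, N, hC, h⟩ := f_bound f hf
  obtain ⟨R, hR0, hR⟩ := IsTestFun.ball φ.2
  choose K hK0 hK using bk_deriv φ
  set K' := ∑ i ∈ Finset.range (N + 1), K i with hK'
  have hK'0 : 0 ≤ K' := Finset.sum_nonneg fun i _ => hK0 i
  refine ⟨ENNReal.ofReal (C * (Real.exp (N * (2 * R)) * K')), n + N, N, ofReal_ne_top, by positivity, fun k y => ?_⟩
  have hs : Function.support (tr y (bk φ k)).1 ⊆ Metric.closedBall y (2 * R) := by
    refine (tr_support _ y (bk_support φ hR0.le hR k)).trans (Metric.closedBall_subset_closedBall ?_)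
    exact div_le_self (by positivity) (one_le_pow₀ (by norm_num))
  have h1 := h (tr y (bk φ k)) y (2 * R) (K' * 2 ^ (k * (n + N))) hs (fun i hi w => by
    rw [iter_tr]
    refine (hK i k _).trans ?_
    rw [mul_add, pow_add]
    gcongr
    · exact Finset.single_le_sum (f := K) (fun i _ => hK0 i) (Finset.mem_range.2 (by omega))
    · norm_num)
  rw [← ofReal_norm, Real.norm_eq_abs, two_pow_eq, Real.rpow_natCast, ← ENNReal.ofReal_mul (by positivity), ← ENNReal.ofReal_mul (by positivity)]
  refine ENNReal.ofReal_le_ofReal (h1.trans (le_of_eq ?_))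
  rw [mul_add, Real.exp_add]; ring

theorem tail_tendsto {n : ℕ} (φ : TF n) (h1 : ∫ t, φ.1 t = 1) (m : ℕ) (hm : 1 ≤ m) (f : Dstrb n) (hf : MemSe' n f) (θ : TF n) :
    Tendsto (fun j => ‖fT f ((eO φ j ^ m) θ)‖ₑ) atTop (𝓝 0) := by
  obtain ⟨c, C, hc, hC, -, -, -, -, hE⟩ := opbounds φ h1 m hm
  obtain ⟨C', N, hC', h⟩ := f_bound f hf
  obtain ⟨R, hR0, hR⟩ := IsTestFun.ball θ.2
  obtain ⟨K, hK0, hK⟩ := iter_bdd' θ (N + m)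
  have hb : ∀ j, ‖fT f ((eO φ j ^ m) θ)‖ₑ ≤ ENNReal.ofReal (C' * (Real.exp (N * (R + c)) * (C * K)) * (1 / 2) ^ j) := by
    intro j
    have h2 := h ((eO φ j ^ m) θ) 0 (R + c) (C / 2 ^ (j * m) * K) ((hE j).1 θ 0 R hR) (fun i hi y =>
      (hE j).2 θ i K (hK (i + m) (by omega)) y)
    rw [← ofReal_norm, Real.norm_eq_abs]
    refine ENNReal.ofReal_le_ofReal (h2.trans ?_)
    rw [norm_zero, zero_add]
    have : (1 : ℝ) / 2 ^ (j * m) ≤ (1 / 2) ^ j := by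
      rw [one_div_pow]
      apply one_div_le_one_div_of_le (by positivity)
      exact pow_le_pow_right₀ (by norm_num) (Nat.le_mul_of_pos_right j hm)
    calc _ = C' * (Real.exp (N * (R + c)) * (C * K)) * (1 / 2 ^ (j * m)) := by ring
      _ ≤ _ := by gcongr
  refine tendsto_of_tendsto_of_tendsto_of_le_of_le tendsto_const_nhds ?_ (fun _ => zero_le) hb
  rw [← ENNReal.ofReal_zero]
  refine ENNReal.tendsto_ofReal ?_
  have := (tendsto_pow_atTop_nhds_zero_of_lt_one (by norm_num : (0:ℝ) ≤ 1 / 2) (by norm_num)).const_mul (C' * (Real.exp (N * (R + c)) * (C * K)))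
  simpa using this

theorem repr_le {n : ℕ} (φ : TF n) (h1 : ∫ t, φ.1 t = 1) (m : ℕ) (hm : 1 ≤ m) (f : Dstrb n) (hf : MemSe' n f) (θ : TF n) (J : ℕ) :
    ‖fT f θ‖ₑ ≤ ‖fT f (hO φ m J θ)‖ₑ + ∑' l, ∫⁻ z, ‖fT f (tr z (bk φ (J + l + 1)))‖ₑ *
      ‖((Sop φ m (J + l + 1) * aop φ (J + l + 1)) θ).1 z‖ₑ := by
  set X := ∑' l, ∫⁻ z, ‖fT f (tr z (bk φ (J + l + 1)))‖ₑ *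
      ‖((Sop φ m (J + l + 1) * aop φ (J + l + 1)) θ).1 z‖ₑ with hX
  have hb : ∀ N, ‖fT f θ‖ₑ ≤ ‖fT f (hO φ m J θ)‖ₑ + X + ‖fT f ((eO φ (J + N) ^ m) θ)‖ₑ := by
    intro N
    have e : θ = hO φ m (J + N) θ + (eO φ (J + N) ^ m) θ := by
      simp [hO]
    have e1 : fT f θ = fT f (hO φ m J θ) + ∑ l ∈ Finset.range N, fT f (bO φ (J + l + 1) ((Sop φ m (J + l + 1) * aop φ (J + l + 1)) θ))
        + fT f ((eO φ (J + N) ^ m) θ) := by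
      conv_lhs => rw [e, map_add, hO_sum]
      congr 1
      rw [LinearMap.add_apply, map_add, LinearMap.sum_apply, map_sum]
      rfl
    rw [e1]
    refine (enorm_add_le _ _).trans (add_le_add_left ((enorm_add_le _ _).trans (add_le_add_right ?_ _)) _)
    refine (enorm_sum_le _ _).trans ((Finset.sum_le_sum fun l _ => fT_cv_le f hf _ _).trans ?_)
    exact ENNReal.sum_le_tsum _
  have ht := tail_tendsto φ h1 m hm f hf θ
  have ht2 : Tendsto (fun N => ‖fT f (hO φ m J θ)‖ₑ + X + ‖fT f ((eO φ (J + N) ^ m) θ)‖ₑ) atTop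
      (𝓝 (‖fT f (hO φ m J θ)‖ₑ + X + 0)) := by
    refine tendsto_const_nhds.add ?_
    have := (tendsto_add_atTop_iff_nat J).2 ht
    simpa [add_comm] using this
  rw [add_zero] at ht2
  exact ge_of_tendsto' ht2 hb

theorem lint_le {n : ℕ} (u : (Fin n → ℝ) → ℝ≥0∞) (η : (Fin n → ℝ) → ℝ) {x : Fin n → ℝ} {ρ K : ℝ}
    (hK : ∀ y, |η y| ≤ K) (hs : Function.support η ⊆ Metric.closedBall x ρ) :
    ∫⁻ z, u z * ‖η z‖ₑ ≤ ENNReal.ofReal K * ∫⁻ z in Metric.closedBall x ρ, u z := by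
  rw [← lintegral_const_mul' _ _ ENNReal.ofReal_ne_top, ← lintegral_indicator measurableSet_closedBall]
  refine lintegral_mono fun z => ?_
  by_cases hz : z ∈ Metric.closedBall x ρ
  · rw [Set.indicator_of_mem hz, mul_comm]
    refine mul_le_mul' ?_ le_rfl
    rw [← ofReal_norm, Real.norm_eq_abs]
    exact ENNReal.ofReal_le_ofReal (hK z)
  · have : η z = 0 := by
      by_contra h
      exact hz (hs h)
    simp [this]

theorem ball_mono {n : ℕ} (u : (Fin n → ℝ) → ℝ≥0∞) {x : Fin n → ℝ} {ρ ρ' : ℝ} (h : ρ ≤ ρ') :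
    ∫⁻ z in Metric.closedBall x ρ, u z ≤ ∫⁻ z in Metric.closedBall x ρ', u z :=
  lintegral_mono_set (Metric.closedBall_subset_closedBall h)

theorem ofReal_two_pow (N : ℕ) : ENNReal.ofReal ((2:ℝ) ^ N) = 2 ^ N := by
  rw [two_pow_eq, Real.rpow_natCast]

theorem ofReal_half_pow (N : ℕ) : ENNReal.ofReal (((2:ℝ) ^ N)⁻¹) = (2⁻¹) ^ N := by
  rw [half_pow_eq, Real.rpow_neg (by norm_num), Real.rpow_natCast]

theorem opb_zero {n : ℕ} {T : Module.End ℝ (TF n)} {ρ K : ℝ} {s : ℕ} (h : OpB T ρ s K) (θ : TF n) {K0 : ℝ}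
    (h0 : ∀ y, ‖iteratedFDeriv ℝ s θ.1 y‖ ≤ K0) (y : Fin n → ℝ) : |(T θ).1 y| ≤ K * K0 := by
  have := h.2 θ 0 K0 (by rw [zero_add]; exact h0) y
  rwa [norm_iteratedFDeriv_zero] at this

theorem tail_term {n : ℕ} (φ : TF n) {A : ℕ} {c C : ℝ} (hc : 0 ≤ c) (hC : 0 ≤ C)
    (h1 : ∀ j, OpB (aop φ j) (c / 2 ^ j) 0 C)
    (h2 : ∀ j, OpB (Sop φ (A + 1) (j + 1)) (c / 2 ^ (j + 1)) (A + 1 - 1) (C / 2 ^ ((j + 1) * (A + 1 - 1))))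
    (u : (Fin n → ℝ) → ℝ≥0∞) (θ : TF n) {J : ℕ} {x : Fin n → ℝ} {ρ K : ℝ} (hK : 0 ≤ K)
    (hs : Function.support θ.1 ⊆ Metric.closedBall x (ρ / 2 ^ J))
    (hd : ∀ y, ‖iteratedFDeriv ℝ A θ.1 y‖ ≤ K * (2 ^ (J * n) * 2 ^ (J * A))) (l : ℕ) :
    ∫⁻ z, u z * ‖((Sop φ (A + 1) (J + l + 1) * aop φ (J + l + 1)) θ).1 z‖ₑ ≤
      ENNReal.ofReal (C * C * K) * 2 ^ (J * n) * (2⁻¹) ^ ((l + 1) * A) *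
        ∫⁻ z in Metric.closedBall x ((ρ + 2 * c) / 2 ^ J), u z := by
  have ho := (h2 (J + l)).mul (h1 (J + l + 1))
  rw [Nat.add_sub_cancel, add_zero] at ho
  have hpt := opb_zero ho θ hd
  have hsu := ho.1 θ x _ hs
  refine (lint_le u _ hpt hsu).trans (mul_le_mul' (le_of_eq ?_) (ball_mono u ?_))
  · rw [← ofReal_two_pow, ← ofReal_half_pow, ← ENNReal.ofReal_mul (by positivity), ← ENNReal.ofReal_mul (by positivity)]
    congr 1
    have e : (2:ℝ) ^ ((J + l + 1) * A) = 2 ^ (J * A) * 2 ^ ((l + 1) * A) := by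
      rw [← pow_add]; congr 1; ring
    rw [e]
    field_simp
  · have : c / 2 ^ (J + l + 1) ≤ c / 2 ^ J := by
      gcongr; norm_num; omega
    rw [add_div, mul_div_assoc]; linarith

theorem bip {n : ℕ} (φ : TF n) (h1 : ∫ t, φ.1 t = 1) (A : ℕ) : ∃ (C : ℝ≥0∞) (c : ℝ), C ≠ ∞ ∧ 0 ≤ c ∧
    ∀ f : Dstrb n, MemSe' n f → BIP (fun k y => ‖fT f (tr y (bk φ k))‖ₑ) A C c := by
  obtain ⟨c, C, hc, hC, ha, hS, hS', hh, -⟩ := opbounds φ h1 (A + 1) (by omega)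
  obtain ⟨R, hR0, hR⟩ := IsTestFun.ball φ.2
  obtain ⟨K, hK0, hK⟩ := psi_deriv φ 0
  obtain ⟨K', hK'0, hK'⟩ := bk_deriv φ A
  refine ⟨ENNReal.ofReal (C * K) + ENNReal.ofReal (C * C * K'), 2 * R + 2 * c, by simp, by positivity, fun f hf J x => ?_⟩
  refine (repr_le φ h1 (A + 1) (by omega) f hf (tr x (bk φ J)) J).trans ?_
  refine le_trans ?_ (le_of_eq (congrArg (fun w => (ENNReal.ofReal (C * K) + ENNReal.ofReal (C * C * K')) * w)
    (tsum_eq_zero_add' ENNReal.summable).symm))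
  simp only []
  rw [mul_add]
  refine add_le_add ?_ ?_
  · rw [hO_bk]
    refine (fT_cv_le f hf _ _).trans ?_
    have hpt := opb_zero (hh J) (tr x (psi φ J)) (K0 := K * 2 ^ (J * n)) (fun y => by
      rw [iter_tr]; simpa using hK J (y - x))
    have hsu := (hh J).1 (tr x (psi φ J)) x _ (tr_support _ x (psi_support φ hR J))
    refine (lint_le _ _ hpt hsu).trans ?_
    simp only [zero_mul, pow_zero, one_mul, add_zero]
    rw [← mul_assoc, ← mul_assoc, ENNReal.ofReal_mul (by positivity), ofReal_two_pow]
    refine mul_le_mul' (mul_le_mul' le_self_add le_rfl) (ball_mono _ ?_)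
    rw [← add_div]
    exact div_le_div_of_nonneg_right (by linarith) (by positivity)
  · rw [← ENNReal.tsum_mul_left]
    refine ENNReal.tsum_le_tsum fun l => ?_
    refine (tail_term φ hc hC ha hS' _ (tr x (bk φ J)) hK'0 (tr_support _ x (bk_support φ hR0.le hR J)) (fun y => by
      rw [iter_tr]; exact hK' J (y - x)) l).trans ?_
    rw [add_assoc J l 1, ← mul_assoc]
    refine mul_le_mul' ?_ le_rfl
    rw [mul_assoc, mul_comm ((2:ℝ≥0∞) ^ _)]
    exact mul_le_mul' le_add_self le_rfl

theorem mono_zero {n : ℕ} (φ : TF n) {L : ℤ} (hmom : MomentsVanish n L (phiOf n φ.1)) (k : ℕ) (β : Fin n → ℕ)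
    (hβ : ((∑ i, β i : ℕ) : ℤ) ≤ L) : ∫ w, (∏ i, w i ^ β i) * (bk φ (k + 1)).1 w = 0 := by
  have h0 := hmom β hβ
  set c : ℝ := -(2 ^ (k + 1)) with hc
  have hc0 : c ≠ 0 := by rw [hc]; exact neg_ne_zero.2 (by positivity)
  have e : ∀ w : Fin n → ℝ, (∏ i, w i ^ β i) * (bk φ (k + 1)).1 w =
      (2 ^ ((k + 1) * n) * (c ^ (∑ i, β i))⁻¹) * ((fun v : Fin n → ℝ => (∏ i, v i ^ β i) * phiOf n φ.1 v) (c • w)) := by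
    intro w
    rw [bk_apply]
    simp only [phiFam, Pi.smul_apply, smul_eq_mul, mul_pow, Finset.prod_mul_distrib, Finset.prod_pow_eq_pow_sum]
    have : (2:ℝ) ^ (k + 1) • -w = c • w := by rw [hc]; simp
    rw [this]
    have := pow_ne_zero (∑ i, β i) hc0
    field_simp
  simp_rw [e]
  rw [integral_const_mul, Measure.integral_comp_smul volume (fun v : Fin n → ℝ => (∏ i, v i ^ β i) * phiOf n φ.1 v), h0]
  simp

theorem int_test {n : ℕ} {P : (Fin n → ℝ) → ℝ} (hP : Continuous P) (θ : TF n) : Integrable (fun w => P w * θ.1 w) := by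
  refine Continuous.integrable_of_hasCompactSupport (hP.mul (IsTestFun.cont θ.2)) ?_
  exact HasCompactSupport.mul_left θ.2.2

theorem multi_expand {n i : ℕ} (P : (Fin n → ℝ) [×i]→L[ℝ] ℝ) (w : Fin n → ℝ) :
    P (fun _ => w) = ∑ r : Fin i → Fin n, (∏ a, w a ^ (Finset.univ.filter fun l => r l = a).card) *
      P (fun l => Pi.single (r l) 1) := by
  have e : (fun _ : Fin i => w) = fun _ => ∑ a, w a • (Pi.single a (1:ℝ) : Fin n → ℝ) := by
    funext l
    ext b
    simp [Finset.sum_apply, Pi.single_apply]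
  have h := P.toMultilinearMap.map_sum (fun (_ : Fin i) (a : Fin n) => w a • (Pi.single a (1:ℝ) : Fin n → ℝ))
  rw [e]
  refine h.trans (Finset.sum_congr rfl fun r _ => ?_)
  refine (P.toMultilinearMap.map_smul_univ (fun l => w (r l)) (fun l => Pi.single (r l) (1:ℝ))).trans ?_
  rw [smul_eq_mul]
  congr 1
  rw [← Finset.prod_fiberwise' (s := Finset.univ) (g := r) (f := fun a => w a)]
  refine Finset.prod_congr rfl fun a _ => ?_
  rw [Finset.prod_const]

theorem multi_zero {n : ℕ} (φ : TF n) {L : ℤ} (hmom : MomentsVanish n L (phiOf n φ.1)) (k : ℕ) {i : ℕ} (hi : (i : ℤ) ≤ L)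
    (P : (Fin n → ℝ) [×i]→L[ℝ] ℝ) : ∫ w, P (fun _ => w) * (bk φ (k + 1)).1 w = 0 := by
  simp_rw [multi_expand P, Finset.sum_mul]
  rw [integral_finsetSum]
  · refine Finset.sum_eq_zero fun r _ => ?_
    have e : ∀ w : Fin n → ℝ, (∏ a, w a ^ (Finset.univ.filter fun l => r l = a).card) *
      P (fun l => Pi.single (r l) 1) * (bk φ (k + 1)).1 w = P (fun l => Pi.single (r l) 1) *
        ((∏ a, w a ^ (Finset.univ.filter fun l => r l = a).card) * (bk φ (k + 1)).1 w) := fun w => by ring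
    simp_rw [e]
    rw [integral_const_mul, mono_zero φ hmom, mul_zero]
    rw [← Finset.card_eq_sum_card_fiberwise (f := r) (s := Finset.univ) (t := Finset.univ) (by intro a _; simp)]
    simpa using hi
  · intro r _
    exact int_test (by fun_prop) _

theorem taylor_bd {n : ℕ} {G : (Fin n → ℝ) → ℝ} (hG : ContDiff ℝ (⊤ : ℕ∞) G) {s : ℕ} {K : ℝ}
    (hK : ∀ y, ‖iteratedFDeriv ℝ s G y‖ ≤ K) (x w : Fin n → ℝ) :
    |G (x + w) - ∑ i ∈ Finset.range s, ((Nat.factorial i : ℝ))⁻¹ * (iteratedFDeriv ℝ i G x (fun _ => w))| ≤ K * ‖w‖ ^ s := by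
  have hK0 : 0 ≤ K := (norm_nonneg _).trans (hK 0)
  cases s with
  | zero => simpa using hK (x + w)
  | succ s =>
    have h := map_add_eq_sum_add_integral_iteratedFDeriv (n := s) (f := G) (x := x) (y := w) (fun t _ => 
      (hG.of_le (by norm_cast; exact le_top)).contDiffAt)
    rw [h]
    simp only [smul_eq_mul, add_sub_cancel_left]
    rw [abs_mul]
    have h1 : |((Nat.factorial s : ℝ))⁻¹| ≤ 1 := by
      rw [abs_of_nonneg (by positivity)]
      exact inv_le_one_of_one_le₀ (by exact_mod_cast Nat.succ_le_of_lt (Nat.factorial_pos s))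
    have h2 : |∫ t in (0:ℝ)..1, (1 - t) ^ s * iteratedFDeriv ℝ (s + 1) G (x + t • w) fun _ => w| ≤ K * ‖w‖ ^ (s + 1) := by
      have := intervalIntegral.norm_integral_le_of_norm_le_const (a := (0:ℝ)) (b := 1) (C := K * ‖w‖ ^ (s + 1))
        (f := fun t => (1 - t) ^ s * iteratedFDeriv ℝ (s + 1) G (x + t • w) fun _ => w) (by
          intro t ht
          rw [Set.uIoc_of_le zero_le_one] at ht
          rw [norm_mul, norm_pow]
          have a1 : ‖1 - t‖ ^ s ≤ 1 := pow_le_one₀ (norm_nonneg _) (by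
            rw [Real.norm_eq_abs, abs_le]; constructor <;> linarith [ht.1, ht.2])
          have a2 : ‖iteratedFDeriv ℝ (s + 1) G (x + t • w) fun _ => w‖ ≤ K * ‖w‖ ^ (s + 1) := by
            refine (ContinuousMultilinearMap.le_opNorm _ _).trans ?_
            rw [Finset.prod_const, Finset.card_univ, Fintype.card_fin]
            gcongr
            exact hK _
          calc _ ≤ 1 * (K * ‖w‖ ^ (s + 1)) := by gcongr
            _ = _ := one_mul _)
      simpa using this
    calc _ ≤ 1 * (K * ‖w‖ ^ (s + 1)) := mul_le_mul h1 h2 (abs_nonneg _) zero_le_one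
      _ = _ := one_mul _

theorem bk_int {n : ℕ} (φ : TF n) (k : ℕ) : ∫ w, |(bk φ k).1 w| ≤ 2 * ∫ w, |φ.1 w| := by
  have hp := fun j => psi_int φ j (fun y => |y|) (fun c hc y => by simp only [abs_mul, abs_of_nonneg hc])
  have h0 : 0 ≤ ∫ w, |φ.1 w| := integral_nonneg fun w => abs_nonneg _
  cases k with
  | zero =>
    have := hp 0
    change ∫ w, |(psi φ 0).1 w| ≤ _
    rw [this]; linarith
  | succ k =>
    have hi : ∀ j, Integrable (fun w => |(psi φ j).1 w|) := fun j => 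
      ((IsTestFun.cont (psi φ j).2).integrable_of_hasCompactSupport (psi φ j).2.2).abs
    have : ∫ w, |(bk φ (k + 1)).1 w| ≤ ∫ w, (|(psi φ (k + 1)).1 w| + |(psi φ k).1 w|) := by
      refine integral_mono ?_ ((hi _).add (hi _)) fun w => ?_
      · exact ((IsTestFun.cont (bk φ (k + 1)).2).integrable_of_hasCompactSupport (bk φ (k + 1)).2.2).abs
      · exact abs_sub _ _
    rw [integral_add (hi _) (hi _)] at this
    have e1 := hp k
    have e2 := hp (k + 1)
    linarith

theorem mom_est {n : ℕ} (φ : TF n) {L : ℤ} (hmom : MomentsVanish n L (phiOf n φ.1)) (k : ℕ) {s : ℕ} (hs : (s : ℤ) ≤ L + 1)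
    {G : (Fin n → ℝ) → ℝ} (hG : ContDiff ℝ (⊤ : ℕ∞) G) {K ρ : ℝ} (hρ0 : 0 ≤ ρ)
    (hK : ∀ y, ‖iteratedFDeriv ℝ s G y‖ ≤ K) (x : Fin n → ℝ)
    (hρ : Function.support (bk φ (k + 1)).1 ⊆ Metric.closedBall 0 ρ) :
    |∫ w, G (x + w) * (bk φ (k + 1)).1 w| ≤ K * ρ ^ s * (2 * ∫ w, |φ.1 w|) := by
  have hK0 : 0 ≤ K := (norm_nonneg _).trans (hK 0)
  set b := (bk φ (k + 1)).1 with hb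
  set T : (Fin n → ℝ) → ℝ := fun w => ∑ i ∈ Finset.range s, ((Nat.factorial i : ℝ))⁻¹ * (iteratedFDeriv ℝ i G x (fun _ => w)) with hT
  have hTc : Continuous T := by
    rw [hT]
    refine continuous_finsetSum _ fun i _ => continuous_const.mul ?_
    exact (ContinuousMultilinearMap.cont _).comp (continuous_pi fun _ => continuous_id)
  have hGc : Continuous fun w => G (x + w) := hG.continuous.comp (by fun_prop)
  have hT0 : ∫ w, T w * b w = 0 := by
    simp only [hT, Finset.sum_mul]
    rw [integral_finsetSum]
    · refine Finset.sum_eq_zero fun i hi => ?_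
      simp_rw [mul_assoc]
      rw [integral_const_mul, multi_zero φ hmom k (by have := Finset.mem_range.1 hi; omega), mul_zero]
    · intro i _
      refine int_test (continuous_const.mul ?_) _
      exact (ContinuousMultilinearMap.cont _).comp (continuous_pi fun _ => continuous_id)
  have e : ∫ w, G (x + w) * b w = ∫ w, (G (x + w) - T w) * b w := by
    simp_rw [_root_.sub_mul]
    rw [integral_sub (int_test hGc _) (int_test hTc _), hT0, sub_zero]
  rw [e]
  have hbi : Integrable (fun w => |b w|) := ((IsTestFun.cont (bk φ (k + 1)).2).integrable_of_hasCompactSupport (bk φ (k + 1)).2.2).abs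
  have h1 : |∫ w, (G (x + w) - T w) * b w| ≤ ∫ w, (K * ρ ^ s) * |b w| := by
    rw [← Real.norm_eq_abs]
    refine norm_integral_le_of_norm_le (hbi.const_mul _) (Eventually.of_forall fun w => ?_)
    rw [norm_mul, Real.norm_eq_abs, Real.norm_eq_abs]
    by_cases hw : b w = 0
    · simp [hw]
    · have hw' : ‖w‖ ≤ ρ := by simpa using hρ hw
      gcongr
      refine (taylor_bd hG hK x w).trans ?_
      gcongr
  rw [integral_const_mul] at h1
  refine h1.trans (mul_le_mul_of_nonneg_left (bk_int φ (k + 1)) ?_)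
  positivity

def mulT {n : ℕ} (ω θ : TF n) : TF n :=
  ⟨fun y => ω.1 y * θ.1 y, ω.2.1.mul θ.2.1, HasCompactSupport.mul_left θ.2.2⟩

def rflT {n : ℕ} (φ : TF n) : TF n :=
  ⟨fun y => φ.1 (-y), φ.2.1.comp contDiff_neg, φ.2.2.comp_homeomorph (Homeomorph.neg _)⟩

theorem mul_deriv {n : ℕ} (ω : TF n) (Kf : ℕ → ℝ) (hKf : ∀ i, 0 ≤ Kf i) (s : ℕ) : ∃ K : ℝ, 0 ≤ K ∧ ∀ (θ : TF n) (j : ℕ),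
    (∀ i y, ‖iteratedFDeriv ℝ i θ.1 y‖ ≤ Kf i * (2 ^ (j * n) * 2 ^ (j * i))) → ∀ y,
    ‖iteratedFDeriv ℝ s (mulT ω θ).1 y‖ ≤ K * (2 ^ (j * n) * 2 ^ (j * s)) := by
  choose W hW0 hW using iter_bdd ω
  refine ⟨∑ i ∈ Finset.range (s + 1), (s.choose i : ℝ) * W i * Kf (s - i), ?_, fun θ j h y => ?_⟩
  · exact Finset.sum_nonneg fun i _ => mul_nonneg (mul_nonneg (by positivity) (hW0 i)) (hKf _)
  refine (norm_iteratedFDeriv_mul_le (N := ((⊤ : ℕ∞) : WithTop ℕ∞)) ω.2.1 θ.2.1 y (by norm_cast; exact le_top)).trans ?_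
  rw [Finset.sum_mul]
  refine Finset.sum_le_sum fun i _ => ?_
  rw [mul_assoc _ (Kf _)]
  have hp : (2:ℝ) ^ (j * (s - i)) ≤ 2 ^ (j * s) := pow_le_pow_right₀ (by norm_num) (Nat.mul_le_mul_left _ (by omega))
  have := hW0 i
  have := hKf (s - i)
  gcongr
  · exact hW i y
  · refine (h (s - i) y).trans ?_
    gcongr

theorem aO_bound {n : ℕ} (φ ω : TF n) {L : ℤ} (hmom : MomentsVanish n L (phiOf n φ.1)) {s : ℕ} (hs : (s : ℤ) ≤ L + 1) :
    ∃ C : ℝ, 0 ≤ C ∧ ∀ k j x y, j ≤ k + 1 → 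
      |(aO φ j (mulT ω (tr x (bk φ (k + 1))))).1 y| ≤ C * 2 ^ (j * n) * (2 ^ ((k + 1 - j) * s))⁻¹ := by
  obtain ⟨R, hR0, hR⟩ := IsTestFun.ball φ.2
  choose Kf hKf0 hKf using psi_deriv (rflT φ)
  obtain ⟨K, hK0, hK⟩ := mul_deriv ω Kf hKf0 s
  have hI : 0 ≤ ∫ w, |φ.1 w| := integral_nonneg fun w => abs_nonneg _
  refine ⟨K * (2 * R) ^ s * (2 * ∫ w, |φ.1 w|), by positivity, fun k j x y hjk => ?_⟩
  have hGd := hK (tr y (psi (rflT φ) j)) j (fun i z => by rw [iter_tr]; exact hKf i j (z - y))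
  have h := mom_est φ hmom k hs (mulT ω (tr y (psi (rflT φ) j))).2.1 (ρ := 2 * R / 2 ^ (k + 1)) (by positivity) hGd x
    (bk_support φ hR0.le hR (k + 1))
  have e : (aO φ j (mulT ω (tr x (bk φ (k + 1))))).1 y =
      ∫ w, (mulT ω (tr y (psi (rflT φ) j))).1 (x + w) * (bk φ (k + 1)).1 w := by
    change cvv (psi φ j).1 (mulT ω (tr x (bk φ (k + 1)))).1 y = _
    rw [cvv_comm]
    unfold cvv
    rw [← integral_add_left_eq_self _ x]
    congr 1
    funext w
    have e1 : (psi φ j).1 (y - (x + w)) = (tr y (psi (rflT φ) j)).1 (x + w) := by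
      change 2 ^ (j * n) * φ.1 (-((2 : ℝ) ^ j • (y - (x + w)))) = 2 ^ (j * n) * φ.1 (- -((2 : ℝ) ^ j • (x + w - y)))
      rw [neg_neg, ← smul_neg, neg_sub]
    rw [e1]
    change (ω.1 (x + w) * (bk φ (k + 1)).1 (x + w - x)) * _ = (ω.1 (x + w) * _) * _
    rw [add_sub_cancel_left]
    ring
  rw [e]
  refine h.trans (le_of_eq ?_)
  rw [div_pow, ← pow_mul]
  have e2 : (2:ℝ) ^ ((k + 1) * s) = 2 ^ (j * s) * 2 ^ ((k + 1 - j) * s) := by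
    rw [← pow_add, ← add_mul]; congr 2; omega
  rw [e2]
  field_simp

theorem aop_bound {n : ℕ} (φ ω : TF n) {L : ℤ} (hmom : MomentsVanish n L (phiOf n φ.1)) {s : ℕ} (hs : (s : ℤ) ≤ L + 1) :
    ∃ C : ℝ, 0 ≤ C ∧ ∀ k j x y, j ≤ k → 
      |(aop φ j (mulT ω (tr x (bk φ k)))).1 y| ≤ C * 2 ^ (j * n) * (2 ^ ((k - j) * s))⁻¹ := by
  obtain ⟨C, hC, h⟩ := aO_bound φ ω hmom hs
  have hz : ∃ C0 : ℝ, 0 ≤ C0 ∧ ∀ x y, |(aO φ 0 (mulT ω (tr x (bk φ 0)))).1 y| ≤ C0 := by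
    obtain ⟨R, hR0, hR⟩ := IsTestFun.ball φ.2
    choose Kf hKf0 hKf using bk_deriv φ
    obtain ⟨K, hK0, hK⟩ := mul_deriv ω Kf hKf0 0
    have hI : 0 ≤ ∫ w, |(psi φ 0).1 w| := integral_nonneg fun w => abs_nonneg _
    refine ⟨(∫ w, |(psi φ 0).1 w|) * K, by positivity, fun x y => ?_⟩
    have hb := hK (tr x (bk φ 0)) 0 (fun i z => by rw [iter_tr]; exact hKf i 0 (z - x))
    exact opb_zero (OpB.cv (psi φ 0) (psi_support φ hR 0)) _ (fun y => by simpa using hb y) y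
  obtain ⟨C0, hC0, h0⟩ := hz
  refine ⟨C0 + 2 * C, by positivity, fun k j x y hjk => ?_⟩
  cases k with
  | zero =>
    obtain rfl : j = 0 := by omega
    refine (h0 x y).trans ?_
    simp
    positivity
  | succ k =>
    have hC' : C * 2 ^ (j * n) * (2 ^ ((k + 1 - j) * s))⁻¹ ≤ (C0 + 2 * C) * 2 ^ (j * n) * (2 ^ ((k + 1 - j) * s))⁻¹ := by
      gcongr; linarith
    cases j with
    | zero => exact (h k 0 x y hjk).trans hC'
    | succ j =>
      have a1 := h k (j + 1) x y hjk
      have a2 := h k j x y (by omega)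
      have a3 : C * 2 ^ (j * n) * (2 ^ ((k + 1 - j) * s))⁻¹ ≤ C * 2 ^ ((j + 1) * n) * (2 ^ ((k + 1 - (j + 1)) * s))⁻¹ := by
        gcongr
        · norm_num
        · omega
        · norm_num
        · omega
      have a4 : |(aop φ (j + 1) (mulT ω (tr x (bk φ (k + 1))))).1 y| ≤ 
        |(aO φ (j + 1) (mulT ω (tr x (bk φ (k + 1))))).1 y| + |(aO φ j (mulT ω (tr x (bk φ (k + 1))))).1 y| := abs_add_le _ _
      have a5 : 0 ≤ C0 * 2 ^ ((j + 1) * n) * (2 ^ ((k + 1 - (j + 1)) * s))⁻¹ := by positivity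
      nlinarith

theorem ball_PM {n : ℕ} (A : ℕ) {B c : ℝ} (hB : 0 ≤ B) (hc : 0 ≤ c) (u : ℕ → (Fin n → ℝ) → ℝ≥0∞) (j l : ℕ) (x : Fin n → ℝ) :
    2 ^ (j * n) * ∫⁻ z in Metric.closedBall x (c / 2 ^ j), u (j + l) z ≤
      ENNReal.ofReal ((2 * c) ^ n) * ENNReal.ofReal (Real.exp (B * c)) * 2 ^ (l * A) * PM A B u j x := by
  have h : ∀ z ∈ Metric.closedBall x (c / 2 ^ j), u (j + l) z ≤ ENNReal.ofReal (Real.exp (B * c)) * 2 ^ (l * A) * PM A B u j x := by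
    intro z hz
    have h1 : (1 : ℝ≥0∞) ≤ ENNReal.ofReal (Real.exp (B * c)) * ew B j x z := by
      have := ew_le_ball hB j 0 x x z hc (by simpa using hz)
      refine le_trans (le_of_eq ?_) this
      simp [ew]
    have h2 : (2⁻¹ : ℝ≥0∞) ^ (l * A) * ew B j x z * u (j + l) z ≤ PM A B u j x :=
      le_iSup_of_le (f := fun k => ⨆ y, (2⁻¹ : ℝ≥0∞) ^ (k * A) * ew B j x y * u (j + k) y) l
        (le_iSup (fun z => (2⁻¹ : ℝ≥0∞) ^ (l * A) * ew B j x z * u (j + l) z) z)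
    have h3 : (2 : ℝ≥0∞) ^ (l * A) * (2⁻¹) ^ (l * A) = 1 := by
      rw [← mul_pow, ENNReal.mul_inv_cancel (by simp) (by simp), one_pow]
    calc u (j + l) z = 1 * ((2 : ℝ≥0∞) ^ (l * A) * (2⁻¹) ^ (l * A)) * u (j + l) z := by rw [h3, one_mul, one_mul]
      _ ≤ (ENNReal.ofReal (Real.exp (B * c)) * ew B j x z) * ((2 : ℝ≥0∞) ^ (l * A) * (2⁻¹) ^ (l * A)) * u (j + l) z := by gcongr
      _ = ENNReal.ofReal (Real.exp (B * c)) * 2 ^ (l * A) * ((2⁻¹ : ℝ≥0∞) ^ (l * A) * ew B j x z * u (j + l) z) := by ring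
      _ ≤ _ := by gcongr
  have h4 : ∫⁻ z in Metric.closedBall x (c / 2 ^ j), u (j + l) z ≤
      (ENNReal.ofReal (Real.exp (B * c)) * 2 ^ (l * A) * PM A B u j x) * volume (Metric.closedBall x (c / 2 ^ j)) := by
    rw [← setLIntegral_const]
    exact setLIntegral_mono' measurableSet_closedBall h
  rw [Real.volume_pi_closedBall x (by positivity), Fintype.card_fin] at h4
  have e : (2 : ℝ≥0∞) ^ (j * n) * ENNReal.ofReal ((2 * (c / 2 ^ j)) ^ n) = ENNReal.ofReal ((2 * c) ^ n) := by
    rw [← ofReal_two_pow, ← ENNReal.ofReal_mul (by positivity)]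
    congr 1
    rw [pow_mul, ← mul_pow]
    congr 1
    field_simp
  calc _ ≤ (2 : ℝ≥0∞) ^ (j * n) * ((ENNReal.ofReal (Real.exp (B * c)) * 2 ^ (l * A) * PM A B u j x) * ENNReal.ofReal ((2 * (c / 2 ^ j)) ^ n)) := by gcongr
    _ = ((2 : ℝ≥0∞) ^ (j * n) * ENNReal.ofReal ((2 * (c / 2 ^ j)) ^ n)) * ENNReal.ofReal (Real.exp (B * c)) * 2 ^ (l * A) * PM A B u j x := by ring
    _ = _ := by rw [e]

theorem hO_all {n : ℕ} (φ : TF n) (m k : ℕ) : hO φ m k = ∑ j ∈ Finset.range (k + 1), bO φ j * (Sop φ m j * aop φ j) := by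
  have := hO_sum φ m 0 k
  rw [zero_add] at this
  rw [this, hO_zero, Finset.sum_range_succ', add_comm]
  simp only [zero_add]

theorem mult_pt {n : ℕ} (φ ω : TF n) (h1 : ∫ t, φ.1 t = 1) {L : ℤ} (hmom : MomentsVanish n L (phiOf n φ.1)) {s : ℕ}
    (hs : (s : ℤ) ≤ L + 1) (A : ℕ) {B : ℝ} (hB : 0 ≤ B) : ∃ K : ℝ≥0∞, K ≠ ∞ ∧ ∀ f : Dstrb n, MemSe' n f → ∀ k x,
      ‖fT f (mulT ω (tr x (bk φ k)))‖ₑ ≤ K * ∑ j ∈ Finset.range (k + 1), (2⁻¹ : ℝ≥0∞) ^ ((k - j) * s) *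
        PM A B (fun k y => ‖fT f (tr y (bk φ k))‖ₑ) j x := by
  obtain ⟨c, C, hc, hC, ha, hS, hS', -, -⟩ := opbounds φ h1 (A + 1 + 1) (by omega)
  obtain ⟨R, hR0, hR⟩ := IsTestFun.ball φ.2
  obtain ⟨Ca, hCa, haop⟩ := aop_bound φ ω hmom hs
  choose Kf hKf0 hKf using bk_deriv φ
  obtain ⟨Kd, hKd0, hKd⟩ := mul_deriv ω Kf hKf0 (A + 1)
  set c' := 2 * R + 2 * c with hc'
  have hc'0 : 0 ≤ c' := by positivity
  set D := ENNReal.ofReal ((2 * c') ^ n) * ENNReal.ofReal (Real.exp (B * c')) with hD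
  have hDt : D ≠ ∞ := ENNReal.mul_ne_top ENNReal.ofReal_ne_top ENNReal.ofReal_ne_top
  refine ⟨ENNReal.ofReal (C * Ca) * D + ENNReal.ofReal (C * C * Kd) * D, 
    ENNReal.add_ne_top.2 ⟨ENNReal.mul_ne_top ENNReal.ofReal_ne_top hDt, ENNReal.mul_ne_top ENNReal.ofReal_ne_top hDt⟩, 
    fun f hf k x => ?_⟩
  set u : ℕ → (Fin n → ℝ) → ℝ≥0∞ := fun k y => ‖fT f (tr y (bk φ k))‖ₑ with hu
  set θ := mulT ω (tr x (bk φ k)) with hθ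
  have hθs : Function.support θ.1 ⊆ Metric.closedBall x (2 * R / 2 ^ k) := by
    refine subset_trans ?_ (tr_support _ x (bk_support φ hR0.le hR k))
    intro z hz
    exact right_ne_zero_of_mul hz
  refine (repr_le φ h1 (A + 1 + 1) (by omega) f hf θ k).trans ?_
  rw [add_mul]
  refine add_le_add ?_ ?_
  · rw [hO_all, LinearMap.sum_apply, map_sum]
    refine (enorm_sum_le _ _).trans ?_
    rw [Finset.mul_sum]
    refine Finset.sum_le_sum fun j hj => ?_
    have hjk : j ≤ k := by have := Finset.mem_range.1 hj; omega
    refine (fT_cv_le f hf _ _).trans ?_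
    have hpt := opb_zero (hS j) (aop φ j θ) (K0 := Ca * 2 ^ (j * n) * (2 ^ ((k - j) * s))⁻¹) (fun y => by
      rw [norm_iteratedFDeriv_zero]; exact haop k j x y hjk)
    have hsu := (hS j).1 _ x _ ((ha j).1 θ x _ hθs)
    refine (lint_le (u j) _ hpt hsu).trans ?_
    have hb : ∫⁻ z in Metric.closedBall x (2 * R / 2 ^ k + c / 2 ^ j + c / 2 ^ j), u j z ≤
        ∫⁻ z in Metric.closedBall x (c' / 2 ^ j), u j z := by
      refine ball_mono _ ?_
      have : 2 * R / 2 ^ k ≤ 2 * R / 2 ^ j := by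
        gcongr; norm_num
      rw [hc', add_div, mul_div_assoc 2 c]; linarith
    have hP := ball_PM A hB hc'0 u j 0 x
    rw [zero_mul, pow_zero, mul_one, add_zero, ← hD] at hP
    calc _ ≤ ENNReal.ofReal (C * (Ca * 2 ^ (j * n) * (2 ^ ((k - j) * s))⁻¹)) * ∫⁻ z in Metric.closedBall x (c' / 2 ^ j), u j z := by gcongr
      _ = ENNReal.ofReal (C * Ca) * (2⁻¹) ^ ((k - j) * s) * (2 ^ (j * n) * ∫⁻ z in Metric.closedBall x (c' / 2 ^ j), u j z) := by
          rw [← mul_assoc, ← mul_assoc, ENNReal.ofReal_mul (by positivity), ENNReal.ofReal_mul (by positivity), ofReal_two_pow, ofReal_half_pow]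
          ring
      _ ≤ ENNReal.ofReal (C * Ca) * (2⁻¹) ^ ((k - j) * s) * (D * PM A B u j x) := by gcongr
      _ = _ := by ring
  · have hterm : ∀ l, ∫⁻ z, ‖fT f (tr z (bk φ (k + l + 1)))‖ₑ * ‖((Sop φ (A + 1 + 1) (k + l + 1) * aop φ (k + l + 1)) θ).1 z‖ₑ ≤
        ENNReal.ofReal (C * C * Kd) * D * PM A B u k x * (2⁻¹) ^ (l + 1) := by
      intro l
      refine (tail_term φ hc hC ha hS' (u (k + l + 1)) θ hKd0 hθs (hKd _ k fun i y => by
        rw [iter_tr]; exact hKf i k (y - x)) l).trans ?_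
      have hP := ball_PM A hB hc'0 u k (l + 1) x
      rw [← hD, ← add_assoc] at hP
      have e : (2⁻¹ : ℝ≥0∞) ^ ((l + 1) * (A + 1)) * 2 ^ ((l + 1) * A) = (2⁻¹) ^ (l + 1) := by
        rw [mul_add, mul_one, pow_add, mul_right_comm, ← mul_pow, ENNReal.inv_mul_cancel (by simp) (by simp), one_pow, one_mul]
      calc _ = ENNReal.ofReal (C * C * Kd) * (2⁻¹) ^ ((l + 1) * (A + 1)) * (2 ^ (k * n) * ∫⁻ z in Metric.closedBall x (c' / 2 ^ k), u (k + l + 1) z) := by ring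
        _ ≤ ENNReal.ofReal (C * C * Kd) * (2⁻¹) ^ ((l + 1) * (A + 1)) * (D * 2 ^ ((l + 1) * A) * PM A B u k x) := by gcongr
        _ = ENNReal.ofReal (C * C * Kd) * D * PM A B u k x * ((2⁻¹) ^ ((l + 1) * (A + 1)) * 2 ^ ((l + 1) * A)) := by ring
        _ = _ := by rw [e]
    refine (ENNReal.tsum_le_tsum hterm).trans ?_
    rw [ENNReal.tsum_mul_left, ENNReal.tsum_geometric_add_one]
    have e : (2⁻¹ : ℝ≥0∞) * (1 - 2⁻¹)⁻¹ = 1 := by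
      rw [ENNReal.one_sub_inv_two, inv_inv, ENNReal.inv_mul_cancel (by simp) (by simp)]
    rw [e, mul_one]
    refine mul_le_mul' le_rfl ?_
    refine le_trans (le_of_eq ?_) (Finset.single_le_sum (f := fun j => (2⁻¹ : ℝ≥0∞) ^ ((k - j) * s) * PM A B u j x)
      (fun _ _ => zero_le) (Finset.mem_range.2 (Nat.lt_succ_self k)))
    simp

/-- Lemma 3.1, pointwise multiplier estimate in `B^{φ₀}_{p,q}({t_k})`. -/
theorem multiplier_estimate (d : ℕ) (p q σ₁ σ₂ : ℝ≥0∞) (α₁ α₂ α₃ : ℝ)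
    (hp : 0 < p) (hq : 0 < q) (hσ₁ : 0 < σ₁) (hσ₂ : 0 < σ₂) (hα₃ : 0 ≤ α₃)
    (t : ℕ → (Fin (d + 1) → ℝ) → ℝ) (ht : MemX (d + 1) p σ₁ σ₂ α₁ α₂ α₃ t)
    (hσ₂p : p ≤ σ₂)
    (M : ℝ) (hM : 1 ≤ M) (ϖ : (Fin d → ℝ) → ℝ) (hϖ : IsLipFun d M ϖ)
    (φ₀ : (Fin (d + 1) → ℝ) → ℝ) (hφ₀ : IsTestFun (d + 1) φ₀)
    (hsupp : tsupport φ₀ ⊆ negConeK d M) (hint : (∫ x, φ₀ x) = 1)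
    (Lφ : ℤ) (hLφ : -1 ≤ Lφ) (hmom : MomentsVanish (d + 1) Lφ (phiOf (d + 1) φ₀))
    (hLφα : α₂ < (Lφ : ℝ) + 1)
    (ω : (Fin (d + 1) → ℝ) → ℝ) (hω : IsTestFun (d + 1) ω) :
    ∃ C : ℝ, 0 < C ∧ ∀ f : Dstrb (d + 1), MemSe' (d + 1) f →
      besovNorm (d + 1) p q t φ₀ f ≠ ∞ →
      besovNorm (d + 1) p q t φ₀ (mulDist (d + 1) ω f) ≤
        ENNReal.ofReal C * besovNorm (d + 1) p q t φ₀ f := by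
  have hs : α₂ < ((Lφ + 1).toNat : ℝ) := by
    have : (((Lφ + 1).toNat : ℤ) : ℝ) = ((Lφ + 1 : ℤ) : ℝ) := by
      rw [Int.toNat_of_nonneg (by omega)]
    have h2 : ((Lφ + 1).toNat : ℝ) = (Lφ : ℝ) + 1 := by
      rw [← Int.cast_natCast, this]; push_cast; rfl
    rw [h2]; exact hLφα
  have hs' : (((Lφ + 1).toNat : ℕ) : ℤ) ≤ Lφ + 1 := by
    rw [Int.toNat_of_nonneg (by omega)]
  obtain ⟨A, B, rr, hB, hrr0, hrr1, hmain⟩ := abstract_est p q σ₁ σ₂ α₁ α₂ α₃ hp hq hσ₁ hα₃ t ht hσ₂p _ hs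
  set φ : TF (d + 1) := ⟨φ₀, hφ₀⟩ with hφ
  set Ω : TF (d + 1) := ⟨ω, hω⟩ with hΩ
  obtain ⟨K, hK, hpt⟩ := mult_pt φ Ω hint hmom hs' A hB
  choose CA cA hCA hcA hbip using bip φ hint
  set K' := CA A * ENNReal.ofReal (Real.exp (B * cA A)) with hK'
  have hK't : K' ≠ ∞ := ENNReal.mul_ne_top (hCA A) ENNReal.ofReal_ne_top
  obtain ⟨C, hC, hfin⟩ := hmain (K + K') (ENNReal.add_ne_top.2 ⟨hK, hK't⟩)
  refine ⟨C.toReal + 1, by positivity, fun f hf _ => ?_⟩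
  have key := hfin (fun k x => fT f (tr x (bk φ k))) (fun k x => ‖fT f (mulT Ω (tr x (bk φ k)))‖ₑ)
    (fun k => (fT_concl f hf).1 _)
    (fun j x => (PM_le hCA hcA hB hrr0 hrr1 _ (fun A => hbip A f hf) (growth φ f hf) j x).trans
      (mul_le_mul' le_add_self le_rfl))
    (fun k x => (hpt f hf k x).trans (mul_le_mul' le_self_add le_rfl))
  have e1 : besovNorm (d + 1) p q t φ₀ f =
      lqNorm q (fun k => eLpNorm (fun x => t k x * fT f (tr x (bk φ k))) p volume) := by
    unfold besovNorm
    congr 1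
    funext k
    congr 1
    funext x
    rw [show φ₀ = φ.1 from rfl, distConv_eq]
    rfl
  have e2 : besovNorm (d + 1) p q t φ₀ (mulDist (d + 1) ω f) =
      lqNorm q (fun k => eLpNorm (fun x => ‖t k x‖ₑ * ‖fT f (mulT Ω (tr x (bk φ k)))‖ₑ) p volume) := by
    unfold besovNorm
    congr 1
    funext k
    refine eLpNorm_congr_enorm_ae (Eventually.of_forall fun x => ?_)
    rw [show φ₀ = φ.1 from rfl, distConv_eq, enorm_mul]
    rfl
  rw [e1, e2]
  refine key.trans (mul_le_mul' ?_ le_rfl)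
  rw [← ENNReal.ofReal_toReal hC]
  refine ENNReal.ofReal_le_ofReal ?_
  rw [ENNReal.toReal_ofReal ENNReal.toReal_nonneg]
  linarith
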